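/- arXiv:1710.06470 — 3 statements merged into one kernel-verified Lean document; each statement's English description precedes it below -/
import Mathlib

section
/- Let β and ρ be simple closed curves in ℝ² with β ∩ ρ ≠ ∅, and suppose that every point of β ∩ ρ is a crossing of β and ρ. Let B denote the union of all bounded connected components of ℝ² ∖ β, and let W denote the unbounded connected component of ℝ² ∖ β. Then there are at least two distinct digons (α, γ) of (β, ρ) such that γ minus its two endpoints is contained in B, and at least two distinct digons (α, γ) of (β, ρ) such that γ minus its two endpoints is contained in W. -/
/-- A simple closed curve: a subset of ℝ² homeomorphic to the unit circle. -/
def IsSimpleClosedCurve (c : Set (ℝ × ℝ)) : Prop :=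
  Nonempty (c ≃ₜ Metric.sphere (0 : EuclideanSpace ℝ (Fin 2)) 1)

/-- An arc: a subset of ℝ² homeomorphic to the closed interval [0,1]. -/
def IsArc (A : Set (ℝ × ℝ)) : Prop :=
  Nonempty (A ≃ₜ Set.Icc (0 : ℝ) 1)

/-- `a` is an endpoint of the arc `A` : `a ∈ A` and `A \ {a}` is connected. -/
def IsEndpointOf (a : ℝ × ℝ) (A : Set (ℝ × ℝ)) : Prop :=
  a ∈ A ∧ IsConnected (A \ {a})

/-- A digon of the pair of simple closed curves `(β, ρ)`. -/
def IsDigon (β ρ α γ : Set (ℝ × ℝ)) : Prop :=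
  IsArc α ∧ IsArc γ ∧ α ⊆ β ∧ γ ⊆ ρ ∧
  ∃ x y : ℝ × ℝ, x ≠ y ∧
    {a | IsEndpointOf a α} = {x, y} ∧
    {a | IsEndpointOf a γ} = {x, y} ∧
    β ∩ γ = {x, y} ∧
    ρ ∩ α = {x, y}

/-- `z` is a crossing of `β` and `ρ`. -/
def IsCrossing (β ρ : Set (ℝ × ℝ)) (z : ℝ × ℝ) : Prop :=
  ∃ (U : Set (ℝ × ℝ)) (_ : IsOpen U) (hz : z ∈ U) (h : U ≃ₜ ℝ × ℝ),
    h ⟨z, hz⟩ = (0, 0) ∧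
    ⇑h '' {p : U | (p : ℝ × ℝ) ∈ β} = {q : ℝ × ℝ | q.2 = 0} ∧
    ⇑h '' {p : U | (p : ℝ × ℝ) ∈ ρ} = {q : ℝ × ℝ | q.1 = 0}

/-- `z` is a tangential intersection of `β` and `ρ`. -/
def IsTangential (β ρ : Set (ℝ × ℝ)) (z : ℝ × ℝ) : Prop :=
  ∃ (U : Set (ℝ × ℝ)) (_ : IsOpen U) (hz : z ∈ U) (h : U ≃ₜ ℝ × ℝ),
    h ⟨z, hz⟩ = (0, 0) ∧
    ⇑h '' {p : U | (p : ℝ × ℝ) ∈ β} = {q : ℝ × ℝ | q.2 = 0} ∧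
    ⇑h '' {p : U | (p : ℝ × ℝ) ∈ ρ} ⊆ {q : ℝ × ℝ | 0 ≤ q.2} ∧
    ⇑h '' {p : U | (p : ℝ × ℝ) ∈ ρ} ∩ {q : ℝ × ℝ | q.2 = 0} = {((0 : ℝ), (0 : ℝ))}

section

open Set Topology

/-- `g` is a continuous logarithm of `f` on `s`. -/
def HasLogOn {X : Type*} [TopologicalSpace X] (f : X → ℂ) (s : Set X) : Prop :=
  ∃ g : X → ℂ, ContinuousOn g s ∧ ∀ x ∈ s, Complex.exp (g x) = f x

lemma HasLogOn.mono {X : Type*} [TopologicalSpace X] {f : X → ℂ} {s t : Set X}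
    (h : HasLogOn f t) (hst : s ⊆ t) : HasLogOn f s := by
  obtain ⟨g, hg, h⟩ := h
  exact ⟨g, hg.mono hst, fun x hx => h x (hst hx)⟩

lemma HasLogOn.mul {X : Type*} [TopologicalSpace X] {f f' : X → ℂ} {s : Set X}
    (h : HasLogOn f s) (h' : HasLogOn f' s) : HasLogOn (fun x => f x * f' x) s := by
  obtain ⟨g, hg, h⟩ := h
  obtain ⟨g', hg', h'⟩ := h'
  exact ⟨fun x => g x + g' x, hg.add hg', fun x hx => by rw [Complex.exp_add, h x hx, h' x hx]⟩

lemma hasLogOn_const {X : Type*} [TopologicalSpace X] {a : ℂ} (ha : a ≠ 0) (s : Set X) :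
    HasLogOn (fun _ : X => a) s :=
  ⟨fun _ => Complex.log a, continuousOn_const, fun _ _ => Complex.exp_log ha⟩

/-- A nonvanishing function homotopic through nonvanishing functions to one with a logarithm has
a logarithm. -/
lemma hasLogOn_of_homotopy {X : Type*} [TopologicalSpace X] {s : Set X}
    (H : unitInterval → X → ℂ)
    (hH : ContinuousOn (fun q : unitInterval × X => H q.1 q.2) (univ ×ˢ s))
    (hne : ∀ t, ∀ x ∈ s, H t x ≠ 0) (h0 : HasLogOn (H 0) s) : HasLogOn (H 1) s := by
  classical
  obtain ⟨g, hg, hgH⟩ := h0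
  let K : C(unitInterval × s, {z : ℂ // z ≠ 0}) :=
    ⟨fun q => ⟨H q.1 q.2, hne _ _ q.2.2⟩, by
      refine Continuous.subtype_mk ?_ _
      exact hH.comp_continuous (by fun_prop : Continuous fun q : unitInterval × s =>
        ((q.1, (q.2 : X)) : unitInterval × X)) (fun q => ⟨mem_univ _, q.2.2⟩)⟩
  let f : C(s, ℂ) := ⟨fun x => g x, continuousOn_iff_continuous_domRestrict.1 hg⟩
  have hK : ∀ a, K (0, a) = ⟨_, (f a).exp_ne_zero⟩ := fun a =>
    Subtype.ext (hgH a a.2).symm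
  have hl := Complex.isCoveringMap_exp.liftHomotopy_lifts K f hK
  let G := Complex.isCoveringMap_exp.liftHomotopy K f hK
  refine ⟨fun x => if hx : x ∈ s then G (1, ⟨x, hx⟩) else 0, ?_, fun x hx => ?_⟩
  · rw [continuousOn_iff_continuous_domRestrict]
    have : Continuous fun x : s => G (1, x) := by fun_prop
    convert this using 1
    ext x
    simp
  · have := congrArg Subtype.val (congrFun hl (1, ⟨x, hx⟩))
    simp only [hx, dite_true]
    exact this

lemma hasLogOn_div_of_joinedIn {X : Type*} [TopologicalSpace X] {s : Set X} {φ : X → ℂ}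
    (hφ : ContinuousOn φ s) {p q : ℂ} (h : JoinedIn (φ '' s)ᶜ q p) :
    HasLogOn (fun x => (φ x - p) / (φ x - q)) s := by
  obtain ⟨σ, hσ⟩ := h
  have hn : ∀ t, ∀ x ∈ s, φ x - σ t ≠ 0 := fun t x hx h =>
    hσ t ⟨x, hx, sub_eq_zero.1 h⟩
  have hq : ∀ x ∈ s, φ x - q ≠ 0 := fun x hx => by simpa using hn 0 x hx
  have := hasLogOn_of_homotopy (s := s) (fun t x => (φ x - σ t) / (φ x - q)) ?_ ?_ ?_
  · simpa using this
  · have h1 : ContinuousOn (fun q : unitInterval × X => φ q.2) (univ ×ˢ s) :=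
      hφ.comp continuousOn_snd (fun q hq => hq.2)
    refine ContinuousOn.div (h1.sub ?_) (h1.sub continuousOn_const) fun y hy => hq _ hy.2
    exact (σ.continuous.comp continuous_fst).continuousOn
  · intro t x hx
    exact div_ne_zero (hn t x hx) (hq x hx)
  · refine ⟨fun _ => 0, continuousOn_const, fun x hx => ?_⟩
    simp [div_self (hq x hx)]

/-- A nonvanishing continuous function on a star-shaped set has a logarithm. -/
lemma hasLogOn_of_starConvex {E : Type*} [AddCommGroup E] [Module ℝ E] [TopologicalSpace E]
    [IsTopologicalAddGroup E] [ContinuousSMul ℝ E] {s : Set E} {a : E}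
    (hs : StarConvex ℝ a s) (ha : a ∈ s) {f : E → ℂ} (hf : ContinuousOn f s)
    (hne : ∀ x ∈ s, f x ≠ 0) : HasLogOn f s := by
  have hmem : ∀ (t : unitInterval), ∀ x ∈ s, a + (t : ℝ) • (x - a) ∈ s := fun t x hx => by
    have := hs hx (sub_nonneg.2 t.2.2) t.2.1 (by ring)
    convert this using 1
    module
  have := hasLogOn_of_homotopy (s := s) (fun t x => f (a + (t : ℝ) • (x - a))) ?_ ?_ ?_
  · simpa using this
  · refine hf.comp ?_ fun y hy => hmem _ _ hy.2
    fun_prop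
  · intro t x hx
    exact hne _ (hmem t x hx)
  · simpa using hasLogOn_const (hne a ha) s

/-- The identity has no continuous logarithm on a circle centred at the origin. -/
lemma not_hasLogOn_circle {R : ℝ} (hR : 0 < R) {f : ℂ → ℂ} (hf : Continuous f)
    (h : ∀ z : ℂ, ‖z‖ = R → Complex.exp (f z) = z) : False := by
  let k : ℝ → ℂ := fun θ => (f (R * Complex.exp (θ * Complex.I)) - Real.log R - θ * Complex.I)
    / (2 * Real.pi * Complex.I)
  have hk : Continuous k := by fun_prop
  have hpi : (2 * Real.pi * Complex.I : ℂ) ≠ 0 := by simp [Real.pi_ne_zero]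
  have hk_int : ∀ θ, ∃ n : ℤ, k θ = n := by
    intro θ
    have h1 : Complex.exp
        (f (R * Complex.exp (θ * Complex.I)) - Real.log R - θ * Complex.I) = 1 := by
      rw [Complex.exp_sub, Complex.exp_sub, h _ (by simp [Complex.norm_exp, abs_of_pos hR]),
        ← Complex.ofReal_exp, Real.exp_log hR]
      have : (R : ℂ) ≠ 0 := by exact_mod_cast hR.ne'
      field_simp
    obtain ⟨n, hn⟩ := Complex.exp_eq_one_iff.1 h1
    refine ⟨n, ?_⟩
    simp only [k]
    rw [hn]
    field_simp
  choose n hn using hk_int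
  have hnc : Continuous n := by
    have : Topology.IsClosedEmbedding (fun n : ℤ => (n : ℂ)) := Complex.isClosedEmbedding_intCast
    rw [this.isEmbedding.continuous_iff]
    convert hk using 1
    ext θ
    exact (hn θ).symm
  have h02 : n 0 = n (2 * Real.pi) :=
    PreconnectedSpace.constant inferInstance hnc
  have : k 0 = k (2 * Real.pi) := by rw [hn, hn, h02]
  simp only [k] at this
  have e : Complex.exp (((2 * Real.pi : ℝ) : ℂ) * Complex.I) = 1 := by
    push_cast; exact Complex.exp_two_pi_mul_I
  have e0 : Complex.exp (((0 : ℝ) : ℂ) * Complex.I) = 1 := by simp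
  rw [e] at this
  have := (div_left_inj' hpi).1 this
  rw [e0, ← sub_eq_zero] at this
  ring_nf at this
  simp [Real.pi_ne_zero] at this

/-- The inclusion of the plane into the complex numbers. -/
noncomputable def toC : (ℝ × ℝ) ≃ₜ ℂ := Complex.equivRealProdCLM.symm.toHomeomorph

/-- A point of a bounded set has no logarithm of the distance vector on the frontier. -/
lemma not_hasLogOn_frontier {Ω : Set (ℝ × ℝ)} (hb : Bornology.IsBounded Ω)
    {p : ℝ × ℝ} (hp : p ∈ Ω) (h : HasLogOn (fun w => toC w - toC p) (frontier Ω)) : False := by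
  classical
  obtain ⟨g, hg, hgp⟩ := h
  obtain ⟨G, hG⟩ := ContinuousMap.exists_restrict_eq (isClosed_frontier (s := Ω))
    ⟨_, continuousOn_iff_continuous_domRestrict.1 hg⟩
  have hG' : ∀ x ∈ frontier Ω, G x = g x := fun x hx => by
    simpa using DFunLike.congr_fun hG ⟨x, hx⟩
  let F : ℝ × ℝ → ℂ := fun w => if w ∈ Ω then Complex.exp (G w) else toC w - toC p
  have hF : Continuous F := by
    refine Continuous.if ?_ (by fun_prop) ?_
    · intro a ha
      rw [hG' a ha, hgp a ha]
    · exact (toC.continuous.sub continuous_const)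
  have hF0 : ∀ w, F w ≠ 0 := by
    intro w
    simp only [F]
    split_ifs with h
    · exact Complex.exp_ne_zero _
    · intro h0
      have := toC.injective (sub_eq_zero.1 h0)
      exact h (this ▸ hp)
  obtain ⟨N, hN, hNF⟩ := hasLogOn_of_starConvex (s := (univ : Set (ℝ × ℝ))) (a := 0)
    (fun _ _ _ _ _ _ _ => mem_univ _) (mem_univ _) hF.continuousOn fun w _ => hF0 w
  have hb' : Bornology.IsBounded ((fun w => toC w - toC p) '' Ω) := by
    have hc := hb.isCompact_closure.image (f := fun w => toC w - toC p)
      (toC.continuous.sub continuous_const)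
    exact hc.isBounded.subset (image_mono subset_closure)
  obtain ⟨R, hR0, hR⟩ := hb'.exists_pos_norm_lt
  refine not_hasLogOn_circle hR0 (f := fun z => N (toC.symm (z + toC p))) ?_ ?_
  · exact (continuousOn_univ.1 hN).comp (toC.symm.continuous.comp (by fun_prop))
  · intro z hz
    rw [hNF _ (mem_univ _)]
    have : toC.symm (z + toC p) ∉ Ω := by
      intro hmem
      have := hR _ ⟨_, hmem, rfl⟩
      simp [hz] at this
    simp [F, this]

lemma HasLogOn.image_of_isEmbedding {X Y : Type*} [TopologicalSpace X] [TopologicalSpace Y]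
    {e : X → Y} (he : IsEmbedding e) {f : Y → ℂ} {s : Set X}
    (h : HasLogOn (fun x => f (e x)) s) : HasLogOn f (e '' s) := by
  obtain ⟨g, hg, hgf⟩ := h
  rcases s.eq_empty_or_nonempty with rfl | ⟨a₀, ha₀⟩
  · exact ⟨fun _ => 0, by simp, by simp⟩
  have : Nonempty X := ⟨a₀⟩
  have hinv : ∀ a, Function.invFun e (e a) = a := Function.leftInverse_invFun he.injective
  refine ⟨fun y => g (Function.invFun e y), ?_, ?_⟩
  · rintro _ ⟨a, ha, rfl⟩
    have := hg a ha
    simp only [ContinuousWithinAt, ← he.map_nhdsWithin_eq, Filter.tendsto_map'_iff,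
      Function.comp_def, hinv] at this ⊢
    exact this
  · rintro _ ⟨a, ha, rfl⟩
    simpa only [hinv] using hgf a ha

/-- Two continuous logarithms of the same function differ by a constant on a preconnected set. -/
lemma exists_const_of_exp_eq {X : Type*} [TopologicalSpace X] {s : Set X} (hs : IsPreconnected s)
    {f g : X → ℂ} (hf : ContinuousOn f s) (hg : ContinuousOn g s)
    (h : ∀ x ∈ s, Complex.exp (f x) = Complex.exp (g x)) :
    ∃ c : ℂ, Complex.exp c = 1 ∧ ∀ x ∈ s, f x = g x + c := by
  rcases s.eq_empty_or_nonempty with rfl | ⟨a, ha⟩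
  · exact ⟨0, by simp⟩
  have hpi : (2 * Real.pi * Complex.I : ℂ) ≠ 0 := by simp [Real.pi_ne_zero]
  have h1 : ∀ x ∈ s, ∃ n : ℤ, f x = g x + n * (2 * Real.pi * Complex.I) := fun x hx =>
    Complex.exp_eq_exp_iff_exists_int.1 (h x hx)
  choose! n hn using h1
  have hnc : ContinuousOn n s := by
    have : IsClosedEmbedding (fun n : ℤ => (n : ℂ)) := Complex.isClosedEmbedding_intCast
    rw [this.isEmbedding.continuousOn_iff]
    refine ((hf.sub hg).div_const (2 * Real.pi * Complex.I)).congr fun x hx => ?_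
    simp only [Function.comp, Pi.sub_apply, hn x hx]
    field_simp
    ring
  refine ⟨n a * (2 * Real.pi * Complex.I), Complex.exp_eq_one_iff.2 ⟨_, rfl⟩, fun x hx => ?_⟩
  rw [hn x hx, hs.constant hnc hx ha]

lemma joinedIn_of_isPreconnected {C T : Set (ℝ × ℝ)} (hC : IsClosed C) (hT : IsPreconnected T)
    (hTC : T ⊆ Cᶜ) {p q : ℝ × ℝ} (hp : p ∈ T) (hq : q ∈ T) : JoinedIn Cᶜ p q := by
  have ho : IsOpen (connectedComponentIn Cᶜ p) := hC.isOpen_compl.connectedComponentIn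
  have hc : IsConnected (connectedComponentIn Cᶜ p) :=
    isConnected_connectedComponentIn_iff.2 (hTC hp)
  have := (ho.isConnected_iff_isPathConnected.1 hc).joinedIn p (mem_connectedComponentIn (hTC hp)) q
    (hT.subset_connectedComponentIn hp hTC hq)
  exact this.mono (connectedComponentIn_subset _ _)

/-- A closed set that locally at a point is a line, and stays connected when the point is removed,
locally separates the plane at the point. -/
theorem separates_of_isPreconnected_diff {C T : Set (ℝ × ℝ)} {e : ℝ × ℝ → ℝ × ℝ}
    (he : IsOpenEmbedding e) (hC : IsClosed C) (heC : ∀ a, e a ∈ C ↔ a.2 = 0)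
    (hD : IsPreconnected (C \ {e 0})) (hT : IsPreconnected T) (hTC : T ⊆ Cᶜ)
    (hp : e (0, 1) ∈ T) (hq : e (0, -1) ∈ T) : False := by
  classical
  set P := e (0, 1) with hP
  set Q := e (0, -1) with hQ
  set S : Set (ℝ × ℝ) := e '' ({0} ×ˢ Icc (-1) 1) with hS
  let r : ℝ × ℝ → ℂ := fun w => (toC w - toC P) / (toC w - toC Q)
  have hjoin : ∀ s : Set (ℝ × ℝ), JoinedIn s Q P → JoinedIn (toC '' sᶜ)ᶜ (toC Q) (toC P) := by
    intro s hs
    obtain ⟨σ, hσ⟩ := hs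
    refine ⟨σ.map toC.continuous, fun t => ?_⟩
    rintro ⟨y, hy, hxy⟩
    have hxy' : y = σ t := toC.injective hxy
    exact hy (hxy' ▸ hσ t)
  obtain ⟨M, hM, hMr⟩ : HasLogOn r C := by
    have := hjoin _ (joinedIn_of_isPreconnected hC hT hTC hq hp)
    rw [compl_compl] at this
    exact hasLogOn_div_of_joinedIn toC.continuous.continuousOn this
  obtain ⟨L, hL, hLr⟩ : HasLogOn r Sᶜ := by
    refine hasLogOn_div_of_joinedIn toC.continuous.continuousOn (hjoin _ ?_)
    have hb : IsPathConnected (({0} : Set ℝ) ×ˢ Icc (-1 : ℝ) 1) :=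
      ((convex_singleton _).prod (convex_Icc _ _)).isPathConnected ⟨(0, 0), by simp⟩
    exact (hb.image he.continuous).joinedIn _ ⟨(0, -1), by simp, rfl⟩ _ ⟨(0, 1), by simp, rfl⟩
  have hDS : C \ {e 0} ⊆ Sᶜ := by
    rintro w ⟨hw, hw0⟩ ⟨⟨a, b⟩, hab, rfl⟩
    have h1 := (heC _).1 hw
    apply hw0
    simp only [mem_prod, mem_singleton_iff] at hab h1
    rw [hab.1, h1]; rfl
  obtain ⟨c, hc1, hc⟩ := exists_const_of_exp_eq hD (hL.mono hDS) (hM.mono sdiff_subset)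
    fun x hx => by rw [hLr x (hDS hx), hMr x hx.1]
  set box : Set (ℝ × ℝ) := Icc (-1) 1 ×ˢ Icc 0 2 with hbox
  set Ω : Set (ℝ × ℝ) := e '' (Ioo (-1) 1 ×ˢ Ioo 0 2) with hΩ
  have hboxc : IsCompact (e '' box) := (isCompact_Icc.prod isCompact_Icc).image he.continuous
  have hΩbox : Ω ⊆ e '' box :=
    image_mono (prod_mono Ioo_subset_Icc_self Ioo_subset_Icc_self)
  have hΩo : IsOpen Ω := he.isOpenMap _ (isOpen_Ioo.prod isOpen_Ioo)
  have hfr : frontier Ω ⊆ e '' (box \ Ioo (-1) 1 ×ˢ Ioo 0 2) := by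
    rw [hΩo.frontier_eq]
    rintro w ⟨hw, hwn⟩
    obtain ⟨a, ha, rfl⟩ := closure_minimal hΩbox hboxc.isClosed hw
    exact ⟨a, ⟨ha, fun h => hwn ⟨a, h, rfl⟩⟩, rfl⟩
  have hfrS : frontier Ω \ {e 0} ⊆ Sᶜ := by
    rintro w ⟨hw, hw0⟩ ⟨⟨a, b⟩, hab, rfl⟩
    obtain ⟨y, hy, hya⟩ := hfr hw
    have := he.injective hya
    subst this
    simp only [hbox, mem_sdiff, mem_prod, mem_Icc, mem_Ioo, mem_singleton_iff] at hy hab hw0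
    obtain ⟨ha, hb⟩ := hab
    subst ha
    have : b = 0 := by
      by_contra hb0
      refine hy.2 ⟨by norm_num, lt_of_le_of_ne hy.1.2.1 (Ne.symm hb0), by linarith⟩
    subst this
    exact hw0 rfl
  refine not_hasLogOn_frontier (Ω := Ω) (p := P) (hboxc.isBounded.subset hΩbox)
    ⟨(0, 1), by simp, rfl⟩ ?_
  have hratio : HasLogOn r (frontier Ω) := by
    refine ⟨fun w => if w ∈ C then M w + c else L w, ?_, ?_⟩
    · intro w hw
      by_cases hw0 : w = e 0
      · subst hw0
        have hnb : e '' {a | a.1 ∈ Ioo (-1) 1 ∧ a.2 < 1} ∈ 𝓝 (e 0) := by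
          refine (he.isOpenMap _ ?_).mem_nhds ⟨0, by simp, rfl⟩
          exact (isOpen_Ioo.preimage continuous_fst).inter (isOpen_Iio.preimage continuous_snd)
        have hsub : ∀ x ∈ frontier Ω ∩ e '' {a | a.1 ∈ Ioo (-1) 1 ∧ a.2 < 1}, x ∈ C := by
          rintro _ ⟨hx, ⟨a, b⟩, ⟨ha, hb⟩, rfl⟩
          obtain ⟨y, hy, hya⟩ := hfr hx
          have := he.injective hya
          subst this
          rw [heC]
          simp only [hbox, mem_sdiff, mem_prod, mem_Icc, mem_Ioo] at hy ha hb
          by_contra hb0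
          exact hy.2 ⟨ha, lt_of_le_of_ne hy.1.2.1 (Ne.symm hb0), by linarith⟩
        rw [← continuousWithinAt_inter hnb]
        have h0 : e 0 ∈ C := (heC 0).2 rfl
        refine ContinuousWithinAt.congr (f := fun w => M w + c) ?_ (fun y hy => ?_) ?_
        · exact ((hM _ h0).mono hsub).add continuousWithinAt_const
        · rw [if_pos (hsub y hy)]
        · rw [if_pos h0]
      · have hnb : ({e 0}ᶜ : Set (ℝ × ℝ)) ∈ 𝓝 w := isOpen_compl_singleton.mem_nhds hw0
        rw [← continuousWithinAt_inter hnb]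
        have heq : ∀ x, x ≠ e 0 → (if x ∈ C then M x + c else L x) = L x := by
          intro x hx
          split_ifs with h
          · exact (hc x ⟨h, hx⟩).symm
          · rfl
        refine ContinuousWithinAt.congr (f := L) ?_ (fun y hy => heq y hy.2) (heq w hw0)
        exact (hL w (hfrS ⟨hw, hw0⟩)).mono hfrS
    · intro w hw
      dsimp only
      split_ifs with h
      · rw [Complex.exp_add, hc1, mul_one, hMr w h]
      · refine hLr w (hfrS ⟨hw, ?_⟩)
        rintro rfl
        exact h ((heC 0).2 rfl)
  have hQ' : ∀ w ∈ e '' box, toC w - toC Q ≠ 0 := by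
    rintro _ ⟨⟨a, b⟩, hab, rfl⟩ h0
    have := he.injective (toC.injective (sub_eq_zero.1 h0))
    simp only [Prod.mk.injEq] at this
    have h2 : (0 : ℝ) ≤ b := hab.2.1
    linarith [this.2]
  have hlogQ : HasLogOn (fun w => toC w - toC Q) (e '' box) := by
    refine HasLogOn.image_of_isEmbedding he.isEmbedding ?_
    have hb0 : ((0, 0) : ℝ × ℝ) ∈ box := by simp [hbox]
    refine hasLogOn_of_starConvex (((convex_Icc _ _).prod (convex_Icc _ _)).starConvex hb0) hb0
      ?_ fun x hx => hQ' _ ⟨x, hx, rfl⟩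
    exact ((toC.continuous.comp he.continuous).sub continuous_const).continuousOn
  obtain ⟨g, hg, hgr⟩ := hratio.mul (hlogQ.mono (hfr.trans (image_mono sdiff_subset)))
  refine ⟨g, hg, fun x hx => ?_⟩
  rw [hgr x hx]
  exact div_mul_cancel₀ _ (hQ' x (image_mono sdiff_subset (hfr hx)))

/-- `c` parametrizes `C` as an injective loop of period one. -/
structure IsLoopParam (C : Set (ℝ × ℝ)) (c : ℝ → ℝ × ℝ) : Prop where
  cont : Continuous c
  range_eq : range c = C
  eq_iff : ∀ s t, c s = c t ↔ ∃ n : ℤ, t = s + n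

lemma exists_isLoopParam {C : Set (ℝ × ℝ)} (hC : IsSimpleClosedCurve C) {z : ℝ × ℝ} (hz : z ∈ C) :
    ∃ c, IsLoopParam C c ∧ c 0 = z := by
  obtain ⟨φ⟩ := hC
  let p : ℝ → ℝ → Metric.sphere (0 : EuclideanSpace ℝ (Fin 2)) 1 := fun a θ =>
    ⟨!₂[Real.cos (2 * Real.pi * θ + a), Real.sin (2 * Real.pi * θ + a)], by
      simp [EuclideanSpace.norm_eq]⟩
  have hpc : ∀ a, Continuous (p a) := by
    intro a
    refine Continuous.subtype_mk ?_ _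
    refine (PiLp.continuous_toLp 2 _).comp (continuous_pi fun i => ?_)
    fin_cases i
    · exact Real.continuous_cos.comp (by fun_prop)
    · exact Real.continuous_sin.comp (by fun_prop)
  have hs : ∀ a, Function.Surjective (p a) := by
    rintro a ⟨v, hv⟩
    have hv1 : v 0 ^ 2 + v 1 ^ 2 = 1 := by
      have : ‖v‖ = 1 := by simpa using hv
      rw [EuclideanSpace.norm_eq, Real.sqrt_eq_one] at this
      simpa using this
    let w : ℂ := ⟨v 0, v 1⟩
    have hw : ‖w‖ = 1 := by
      rw [Complex.norm_def, Real.sqrt_eq_one, Complex.normSq_apply]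
      simp only [w]; nlinarith
    have hw0 : w ≠ 0 := by
      rw [← norm_ne_zero_iff, hw]; exact one_ne_zero
    refine ⟨(w.arg - a) / (2 * Real.pi), ?_⟩
    have he : 2 * Real.pi * ((w.arg - a) / (2 * Real.pi)) + a = w.arg := by
      field_simp; ring
    apply Subtype.ext
    ext i
    fin_cases i
    · simp only [p, he]
      simp [Complex.cos_arg hw0, hw, w]
    · simp only [p, he]
      simp [Complex.sin_arg, hw, w]
  obtain ⟨a, ha⟩ := hs 0 (φ ⟨z, hz⟩)
  refine ⟨fun θ => φ.symm (p (2 * Real.pi * a) θ), ⟨?_, ?_, ?_⟩, ?_⟩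
  · exact continuous_subtype_val.comp (φ.symm.continuous.comp (hpc _))
  · ext w
    constructor
    · rintro ⟨θ, rfl⟩
      exact Subtype.coe_prop _
    · intro hw
      obtain ⟨θ, hθ⟩ := hs (2 * Real.pi * a) (φ ⟨w, hw⟩)
      exact ⟨θ, by simp only [hθ, φ.symm_apply_apply]⟩
  · intro s t
    rw [Subtype.val_inj, φ.symm.injective.eq_iff]
    have key : (p (2 * Real.pi * a) s = p (2 * Real.pi * a) t) ↔
        (Real.cos (2 * Real.pi * s + 2 * Real.pi * a) =
          Real.cos (2 * Real.pi * t + 2 * Real.pi * a) ∧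
        Real.sin (2 * Real.pi * s + 2 * Real.pi * a) =
          Real.sin (2 * Real.pi * t + 2 * Real.pi * a)) := by
      rw [Subtype.ext_iff]
      constructor
      · intro h
        exact ⟨congrArg (fun v => v 0) h, congrArg (fun v => v 1) h⟩
      · rintro ⟨h1, h2⟩
        ext i
        fin_cases i
        · exact h1
        · exact h2
    rw [key]
    constructor
    · rintro ⟨h1, h2⟩
      have := Real.Angle.cos_sin_inj h1 h2
      obtain ⟨n, hn⟩ := Real.Angle.angle_eq_iff_two_pi_dvd_sub.1 this
      refine ⟨-n, ?_⟩
      have hpi := Real.pi_pos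
      have : 2 * Real.pi * (s - t - n) = 0 := by linarith
      have := (mul_eq_zero.1 this).resolve_left (by positivity)
      push_cast; linarith
    · rintro ⟨n, rfl⟩
      have : 2 * Real.pi * (s + n) + 2 * Real.pi * a =
        2 * Real.pi * s + 2 * Real.pi * a + n * (2 * Real.pi) := by ring
      rw [this, Real.cos_add_int_mul_two_pi, Real.sin_add_int_mul_two_pi]
      exact ⟨rfl, rfl⟩
  · have : p (2 * Real.pi * a) 0 = p 0 a := by
      simp [p]
    simp only [this, ha, φ.symm_apply_apply]

namespace IsLoopParam

variable {C : Set (ℝ × ℝ)} {c : ℝ → ℝ × ℝ}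

lemma add_one (h : IsLoopParam C c) (s : ℝ) : c (s + 1) = c s :=
  ((h.eq_iff _ _).2 ⟨1, by simp⟩).symm

lemma reverse (h : IsLoopParam C c) : IsLoopParam C (fun t => c (-t)) := by
  refine ⟨h.cont.comp continuous_neg, ?_, fun s t => ?_⟩
  · rw [← h.range_eq]
    exact (neg_surjective (G := ℝ)).range_comp c
  · rw [h.eq_iff]
    constructor
    · rintro ⟨n, hn⟩
      exact ⟨-n, by push_cast; linarith⟩
    · rintro ⟨n, hn⟩
      exact ⟨-n, by push_cast; linarith⟩

lemma eq_of_abs_lt (h : IsLoopParam C c) {s t : ℝ} (hst : c s = c t) (h1 : s < t + 1)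
    (h2 : t < s + 1) : s = t := by
  obtain ⟨n, rfl⟩ := (h.eq_iff _ _).1 hst
  have h3 : (n : ℝ) < 1 := by linarith
  have h4 : (-1 : ℝ) < n := by linarith
  have h5 : n < 1 := by exact_mod_cast h3
  have h6 : -1 < n := by exact_mod_cast h4
  have : n = 0 := by omega
  simp [this]

lemma exists_mem_Ico (h : IsLoopParam C c) {z : ℝ × ℝ} (hz : z ∈ C) (s : ℝ) :
    ∃ t ∈ Ico s (s + 1), c t = z := by
  rw [← h.range_eq] at hz
  obtain ⟨t, rfl⟩ := hz
  refine ⟨toIcoMod one_pos s t, toIcoMod_mem_Ico _ _ _, ?_⟩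
  rw [h.eq_iff]
  exact ⟨toIcoDiv one_pos s t, by
    have := toIcoMod_add_toIcoDiv_zsmul (one_pos : (0 : ℝ) < 1) s t
    simp at this; linarith⟩

lemma image_Icc_add_one (h : IsLoopParam C c) (s t : ℝ) :
    c '' Icc (s + 1) (t + 1) = c '' Icc s t := by
  rw [← image_add_const_Icc, image_image]
  simp only [h.add_one]

lemma mem (h : IsLoopParam C c) (t : ℝ) : c t ∈ C := h.range_eq ▸ mem_range_self t

lemma isClosedEmbedding_Icc (hc : IsLoopParam C c) {s t : ℝ} (h2 : t < s + 1) :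
    IsClosedEmbedding (fun u : Icc s t => c u) := by
  refine (hc.cont.comp continuous_subtype_val).isClosedEmbedding ?_
  intro u v huv
  exact Subtype.ext (hc.eq_of_abs_lt huv (by linarith [u.2.2, v.2.1]) (by linarith [u.2.1, v.2.2]))

end IsLoopParam

/-- The points `x`, `y` split the simple closed curve `C` into the arcs `A`, `A'`. -/
def IsSplit (C : Set (ℝ × ℝ)) (x y : ℝ × ℝ) (A A' : Set (ℝ × ℝ)) : Prop :=
  ∃ c, IsLoopParam C c ∧ ∃ s t, s < t ∧ t < s + 1 ∧ c s = x ∧ c t = y ∧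
    A = c '' Icc s t ∧ A' = c '' Icc t (s + 1)

namespace IsSplit

variable {C A A' : Set (ℝ × ℝ)} {x y : ℝ × ℝ}

lemma swap (h : IsSplit C x y A A') : IsSplit C y x A' A := by
  obtain ⟨c, hc, s, t, h1, h2, rfl, rfl, rfl, rfl⟩ := h
  exact ⟨c, hc, t, s + 1, h2, by linarith, rfl, hc.add_one _, rfl, (hc.image_Icc_add_one _ _).symm⟩

lemma reverse (h : IsSplit C x y A A') : IsSplit C y x A A' := by
  obtain ⟨c, hc, s, t, h1, h2, rfl, rfl, rfl, rfl⟩ := h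
  refine ⟨_, hc.reverse, -t, -s, by linarith, by linarith, by simp, by simp, ?_, ?_⟩
  · have : c '' Icc s t = (c ∘ Neg.neg) '' Icc (-t) (-s) := by
      rw [image_comp]; simp
    exact this
  · have h3 := hc.reverse.image_Icc_add_one (-s - 1) (-t)
    rw [sub_add_cancel] at h3
    rw [h3]
    have : c '' Icc t (s + 1) = (c ∘ Neg.neg) '' Icc (-s - 1) (-t) := by
      rw [image_comp, image_neg_Icc]; simp [add_comm]
    exact this

lemma ne (h : IsSplit C x y A A') : x ≠ y := by
  obtain ⟨c, hc, s, t, h1, h2, rfl, rfl, rfl, rfl⟩ := h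
  intro h
  exact h1.ne (hc.eq_of_abs_lt h (by linarith) h2)

lemma left_mem (h : IsSplit C x y A A') : x ∈ A := by
  obtain ⟨c, hc, s, t, h1, h2, rfl, rfl, rfl, rfl⟩ := h
  exact ⟨s, ⟨le_rfl, h1.le⟩, rfl⟩

lemma right_mem (h : IsSplit C x y A A') : y ∈ A := h.reverse.left_mem

lemma isCompact (h : IsSplit C x y A A') : IsCompact A := by
  obtain ⟨c, hc, s, t, h1, h2, rfl, rfl, rfl, rfl⟩ := h
  exact isCompact_Icc.image hc.cont

lemma subset (h : IsSplit C x y A A') : A ⊆ C := by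
  obtain ⟨c, hc, s, t, h1, h2, rfl, rfl, rfl, rfl⟩ := h
  rintro _ ⟨u, _, rfl⟩
  exact hc.mem u

lemma union_eq (h : IsSplit C x y A A') : A ∪ A' = C := by
  refine (union_subset h.subset h.swap.subset).antisymm ?_
  obtain ⟨c, hc, s, t, h1, h2, rfl, rfl, rfl, rfl⟩ := h
  intro z hz
  obtain ⟨u, hu, rfl⟩ := hc.exists_mem_Ico hz s
  rcases le_total u t with h | h
  · exact Or.inl ⟨u, ⟨hu.1, h⟩, rfl⟩
  · exact Or.inr ⟨u, ⟨h, hu.2.le⟩, rfl⟩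

lemma inter_eq (h : IsSplit C x y A A') : A ∩ A' = {x, y} := by
  refine Subset.antisymm ?_ ?_
  · obtain ⟨c, hc, s, t, h1, h2, rfl, rfl, rfl, rfl⟩ := h
    rintro _ ⟨⟨u, hu, rfl⟩, v, hv, huv⟩
    rcases hv.2.eq_or_lt with rfl | hv'
    · left
      rw [← huv, hc.add_one]
    · right
      have := hc.eq_of_abs_lt huv (by linarith [hu.1]) (by linarith [hu.2, hv.1])
      subst this
      rw [le_antisymm hu.2 hv.1]
      rfl
  · rintro z (rfl | rfl)
    · exact ⟨h.left_mem, h.swap.right_mem⟩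
    · exact ⟨h.right_mem, h.swap.left_mem⟩

lemma diff_eq (h : IsSplit C x y A A') : ∃ c, IsLoopParam C c ∧ ∃ s t, s < t ∧ t < s + 1 ∧
    c s = x ∧ c t = y ∧ A = c '' Icc s t ∧ A \ {x, y} = c '' Ioo s t := by
  obtain ⟨c, hc, s, t, h1, h2, rfl, rfl, rfl, rfl⟩ := h
  refine ⟨c, hc, s, t, h1, h2, rfl, rfl, rfl, ?_⟩
  ext z
  constructor
  · rintro ⟨⟨u, hu, rfl⟩, hn⟩
    refine ⟨u, ⟨lt_of_le_of_ne hu.1 ?_, lt_of_le_of_ne hu.2 ?_⟩, rfl⟩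
    · rintro rfl; exact hn (Or.inl rfl)
    · rintro rfl; exact hn (Or.inr rfl)
  · rintro ⟨u, hu, rfl⟩
    refine ⟨⟨u, Ioo_subset_Icc_self hu, rfl⟩, ?_⟩
    rintro (h | h)
    · have := hc.eq_of_abs_lt h (by linarith [hu.2]) (by linarith [hu.1])
      exact hu.1.ne' this
    · have := hc.eq_of_abs_lt h (by linarith [hu.2]) (by linarith [hu.1])
      exact hu.2.ne this

lemma isPreconnected_diff (h : IsSplit C x y A A') : IsPreconnected (A \ {x, y}) := by
  obtain ⟨c, hc, s, t, h1, h2, -, -, -, h3⟩ := h.diff_eq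
  rw [h3]
  exact isPreconnected_Ioo.image _ hc.cont.continuousOn

lemma subset_closure (h : IsSplit C x y A A') : A ⊆ closure (A \ {x, y}) := by
  obtain ⟨c, hc, s, t, h1, h2, -, -, h4, h3⟩ := h.diff_eq
  rw [h3, h4]
  rw [← closure_Ioo h1.ne]
  exact image_closure_subset_closure_image hc.cont

lemma isArc (h : IsSplit C x y A A') : IsArc A := by
  obtain ⟨c, hc, s, t, h1, h2, rfl, rfl, rfl, rfl⟩ := h
  have he := hc.isClosedEmbedding_Icc h2
  have := he.isEmbedding.toHomeomorph
  have hr : range (fun u : Icc s t => c u) = c '' Icc s t := by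
    rw [image_eq_range]
  exact ⟨((Homeomorph.setCongr hr).symm.trans this.symm).trans (iccHomeoI s t h1)⟩

lemma endpoints (h : IsSplit C x y A A') : {a | IsEndpointOf a A} = {x, y} := by
  obtain ⟨c, hc, s, t, h1, h2, rfl, rfl, rfl, rfl⟩ := h
  have he := hc.isClosedEmbedding_Icc h2
  have hA : c '' Icc s t = (fun u : Icc s t => c u) '' univ := by
    rw [image_univ, image_eq_range]
  have hiff : ∀ u (hu : u ∈ Icc s t), IsEndpointOf (c u) (c '' Icc s t) ↔
      IsConnected (Icc s t \ {u}) := by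
    intro u hu
    have h3 : c '' Icc s t \ {c u} = (fun u : Icc s t => c u) '' {⟨u, hu⟩}ᶜ := by
      rw [compl_eq_univ_sdiff, image_sdiff he.injective, hA, image_singleton]
    have h4 : Icc s t \ {u} = Subtype.val '' ({⟨u, hu⟩}ᶜ : Set (Icc s t)) := by
      rw [compl_eq_univ_sdiff, image_sdiff Subtype.val_injective, image_singleton, image_univ,
        Subtype.range_coe]
    rw [IsEndpointOf, and_iff_right ⟨u, hu, rfl⟩, h3, h4, IsConnected, IsConnected,
      he.isInducing.isPreconnected_image, IsInducing.subtypeVal.isPreconnected_image,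
      image_nonempty, image_nonempty]
  ext z
  constructor
  · intro hz
    obtain ⟨u, hu, rfl⟩ := hz.1
    have := ((hiff u hu).1 hz).isPreconnected.ordConnected
    by_contra hn
    have hus : u ≠ s := by rintro rfl; exact hn (Or.inl rfl)
    have hut : u ≠ t := by rintro rfl; exact hn (Or.inr rfl)
    have := this.out (x := s) ⟨⟨le_rfl, h1.le⟩, hus.symm⟩ (y := t) ⟨⟨h1.le, le_rfl⟩, hut.symm⟩ hu
    exact this.2 rfl
  · rintro (rfl | rfl)
    · refine (hiff s ⟨le_rfl, h1.le⟩).2 ?_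
      rw [Icc_sdiff_left]
      exact isConnected_Ioc h1
    · refine (hiff t ⟨h1.le, le_rfl⟩).2 ?_
      rw [Icc_sdiff_right]
      exact isConnected_Ico h1

/-- Removing an interior point of an arc leaves two connected pieces, one at each end. -/
lemma exists_pieces (h : IsSplit C x y A A') {u : ℝ × ℝ} (hu : u ∈ A \ {x, y}) :
    ∃ A₁ A₂, IsPreconnected A₁ ∧ IsPreconnected A₂ ∧ x ∈ A₁ ∧ y ∈ A₂ ∧ A \ {u} = A₁ ∪ A₂ := by
  obtain ⟨c, hc, s, t, h1, h2, rfl, rfl, rfl, h3⟩ := h.diff_eq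
  rw [h3] at hu
  obtain ⟨r, hr, rfl⟩ := hu
  refine ⟨c '' Ico s r, c '' Ioc r t, isPreconnected_Ico.image _ hc.cont.continuousOn,
    isPreconnected_Ioc.image _ hc.cont.continuousOn, ⟨s, ⟨le_rfl, hr.1⟩, rfl⟩,
    ⟨t, ⟨hr.2, le_rfl⟩, rfl⟩, ?_⟩
  ext z
  constructor
  · rintro ⟨⟨v, hv, rfl⟩, hn⟩
    rcases lt_trichotomy v r with h | rfl | h
    · exact Or.inl ⟨v, ⟨hv.1, h⟩, rfl⟩
    · exact absurd rfl hn
    · exact Or.inr ⟨v, ⟨h, hv.2⟩, rfl⟩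
  · have key : ∀ v ∈ Icc s t, v ≠ r → c v ∈ c '' Icc s t \ {c r} := fun v hv hvr =>
      ⟨⟨v, hv, rfl⟩, fun h => hvr (hc.eq_of_abs_lt h (by linarith [hv.2, hr.1])
        (by linarith [hv.1, hr.2]))⟩
    rintro (⟨v, hv, rfl⟩ | ⟨v, hv, rfl⟩)
    · exact key v ⟨hv.1, by linarith [hv.2, hr.2]⟩ hv.2.ne
    · exact key v ⟨by linarith [hv.1, hr.1], hv.2⟩ hv.1.ne'

lemma exists_sub (h : IsSplit C x y A A') {u v : ℝ × ℝ} (hu : u ∈ A \ {x, y})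
    (hv : v ∈ A \ {x, y}) (huv : u ≠ v) :
    ∃ A₁ A₁', IsSplit C u v A₁ A₁' ∧ A₁ ⊆ A \ {x, y} := by
  obtain ⟨c, hc, s, t, h1, h2, -, -, -, h3⟩ := h.diff_eq
  rw [h3] at hu hv ⊢
  obtain ⟨a, ha, rfl⟩ := hu
  obtain ⟨b, hb, rfl⟩ := hv
  have key : ∀ a ∈ Ioo s t, ∀ b ∈ Ioo s t, a < b →
      IsSplit C (c a) (c b) (c '' Icc a b) (c '' Icc b (a + 1)) ∧
        c '' Icc a b ⊆ c '' Ioo s t := fun a ha b hb hab =>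
    ⟨⟨c, hc, a, b, hab, by linarith [ha.1, hb.2], rfl, rfl, rfl, rfl⟩,
      image_mono fun w hw => ⟨by linarith [ha.1, hw.1], by linarith [hb.2, hw.2]⟩⟩
  rcases lt_trichotomy a b with hab | rfl | hab
  · exact ⟨_, _, key a ha b hb hab⟩
  · exact absurd rfl huv
  · obtain ⟨k1, k2⟩ := key b hb a ha hab
    exact ⟨_, _, k1.reverse, k2⟩

end IsSplit

lemma exists_isSplit {C : Set (ℝ × ℝ)} (hC : IsSimpleClosedCurve C) {x y : ℝ × ℝ} (hx : x ∈ C)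
    (hy : y ∈ C) (hxy : x ≠ y) : ∃ A A', IsSplit C x y A A' := by
  obtain ⟨c, hc, rfl⟩ := exists_isLoopParam hC hx
  obtain ⟨t, ht, rfl⟩ := hc.exists_mem_Ico hy 0
  have : t ≠ 0 := by rintro rfl; exact hxy rfl
  exact ⟨_, _, c, hc, 0, t, lt_of_le_of_ne ht.1 this.symm, ht.2, rfl, rfl, rfl, rfl⟩

lemma hasLogOn_of_isArc {A : Set (ℝ × ℝ)} (hA : IsArc A) {f : ℝ × ℝ → ℂ} (hf : Continuous f)
    (hne : ∀ x ∈ A, f x ≠ 0) : HasLogOn f A := by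
  obtain ⟨φ⟩ := hA
  have he : IsEmbedding (fun u : Icc (0 : ℝ) 1 => ((φ.symm u : A) : ℝ × ℝ)) :=
    IsEmbedding.subtypeVal.comp φ.symm.isEmbedding
  have hr : A = (fun u : Icc (0 : ℝ) 1 => ((φ.symm u : A) : ℝ × ℝ)) '' univ := by
    ext z
    constructor
    · intro hz
      exact ⟨φ ⟨z, hz⟩, mem_univ _, by simp⟩
    · rintro ⟨u, -, rfl⟩
      exact Subtype.coe_prop _
  rw [hr]
  refine HasLogOn.image_of_isEmbedding he ?_
  have h1 : HasLogOn (fun t : ℝ => f (φ.symm (projIcc 0 1 zero_le_one t))) univ := by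
    refine hasLogOn_of_starConvex (a := 0) (fun _ _ _ _ _ _ _ => mem_univ _) (mem_univ _) ?_ ?_
    · exact (hf.comp (continuous_subtype_val.comp
        (φ.symm.continuous.comp continuous_projIcc))).continuousOn
    · intro t _
      exact hne _ (Subtype.coe_prop _)
  obtain ⟨g, hg, hgf⟩ := h1
  refine ⟨fun u => g u, ((continuousOn_univ.1 hg).comp continuous_subtype_val).continuousOn,
    fun u _ => ?_⟩
  simp only [hgf _ (mem_univ _), projIcc_val]

/-- The points of the plane outside `β` lying in a bounded component of the complement. -/
def innerSide (β : Set (ℝ × ℝ)) : Set (ℝ × ℝ) :=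
  {x | x ∈ βᶜ ∧ Bornology.IsBounded (connectedComponentIn βᶜ x)}

/-- The points of the plane outside `β` lying in an unbounded component of the complement. -/
def outerSide (β : Set (ℝ × ℝ)) : Set (ℝ × ℝ) :=
  {x | x ∈ βᶜ ∧ ¬ Bornology.IsBounded (connectedComponentIn βᶜ x)}

lemma isPreconnected_compl_closedBall {R : ℝ} (hR : 0 ≤ R) :
    IsPreconnected {w : ℝ × ℝ | R < ‖toC w‖} := by
  have h : {w : ℝ × ℝ | R < ‖toC w‖} =
      (fun q : ℝ × ℝ => toC.symm (q.1 * Complex.exp (q.2 * Complex.I))) '' (Ioi R ×ˢ univ) := by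
    ext w
    constructor
    · intro hw
      refine ⟨(‖toC w‖, (toC w).arg), ⟨hw, mem_univ _⟩, ?_⟩
      simp
    · rintro ⟨⟨r, θ⟩, ⟨hr, -⟩, rfl⟩
      have hr' : R < r := hr
      simp [Complex.norm_exp, abs_of_pos (hR.trans_lt hr'), hr']
  rw [h]
  refine (isPreconnected_Ioi.prod isPreconnected_univ).image _ ?_
  exact (toC.symm.continuous.comp (by fun_prop)).continuousOn

lemma exists_isBounded_compl_preconnected {β : Set (ℝ × ℝ)} (hβ : IsCompact β) :
    ∃ D : Set (ℝ × ℝ), IsPreconnected D ∧ D ⊆ βᶜ ∧ IsCompact Dᶜ := by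
  obtain ⟨R, hR0, hR⟩ := (hβ.image toC.continuous).isBounded.exists_pos_norm_le
  refine ⟨_, isPreconnected_compl_closedBall hR0.le, fun w hw hwβ => ?_, ?_⟩
  · exact absurd (hR _ ⟨w, hwβ, rfl⟩) (not_le.2 hw)
  · have : {w : ℝ × ℝ | R < ‖toC w‖}ᶜ = toC ⁻¹' Metric.closedBall 0 R := by
      ext w; simp
    rw [this, toC.isCompact_preimage]
    exact isCompact_closedBall _ _

lemma subset_of_not_isBounded {β D Ω : Set (ℝ × ℝ)} {w : ℝ × ℝ} (hD : IsPreconnected D)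
    (hDβ : D ⊆ βᶜ) (hDc : IsCompact Dᶜ) (hΩ : Ω = connectedComponentIn βᶜ w)
    (hb : ¬ Bornology.IsBounded Ω) : D ⊆ Ω := by
  have : (Ω ∩ D).Nonempty := by
    by_contra h
    refine hb (hDc.isBounded.subset fun x hx hxD => h ⟨x, hx, hxD⟩)
  obtain ⟨x, hx, hxD⟩ := this
  rw [hΩ] at hx ⊢
  rw [connectedComponentIn_eq hx]
  exact hD.subset_connectedComponentIn hxD hDβ

lemma subset_innerSide {β T : Set (ℝ × ℝ)} (hT : IsPreconnected T) (hTβ : T ⊆ βᶜ)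
    (h : (T ∩ innerSide β).Nonempty) : T ⊆ innerSide β := by
  obtain ⟨x, hx, hxi⟩ := h
  intro y hy
  refine ⟨hTβ hy, ?_⟩
  rw [← connectedComponentIn_eq (hT.subset_connectedComponentIn hx hTβ hy)]
  exact hxi.2

lemma subset_outerSide {β T : Set (ℝ × ℝ)} (hT : IsPreconnected T) (hTβ : T ⊆ βᶜ)
    (h : (T ∩ outerSide β).Nonempty) : T ⊆ outerSide β := by
  obtain ⟨x, hx, hxi⟩ := h
  intro y hy
  refine ⟨hTβ hy, ?_⟩
  rw [← connectedComponentIn_eq (hT.subset_connectedComponentIn hx hTβ hy)]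
  exact hxi.2

lemma IsLoopParam.isCompact {C : Set (ℝ × ℝ)} {c : ℝ → ℝ × ℝ} (hc : IsLoopParam C c) :
    IsCompact C := by
  have : C = c '' Icc 0 1 := by
    ext z
    constructor
    · intro hz
      obtain ⟨t, ht, rfl⟩ := hc.exists_mem_Ico hz 0
      exact ⟨t, ⟨ht.1, by linarith [ht.2]⟩, rfl⟩
    · rintro ⟨t, -, rfl⟩
      exact hc.mem t
  rw [this]
  exact isCompact_Icc.image hc.cont

lemma frontier_connectedComponentIn_subset {β : Set (ℝ × ℝ)} (hβ : IsClosed β) (w : ℝ × ℝ) :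
    frontier (connectedComponentIn βᶜ w) ⊆ β := by
  have ho : ∀ x, IsOpen (connectedComponentIn βᶜ x) := fun x =>
    hβ.isOpen_compl.connectedComponentIn
  rw [(ho w).frontier_eq]
  rintro x ⟨hx, hxn⟩
  by_contra hxβ
  have hx' := mem_connectedComponentIn (F := βᶜ) hxβ
  obtain ⟨y, hy, hyw⟩ := mem_closure_iff.1 hx _ (ho x) hx'
  rw [connectedComponentIn_eq hyw, ← connectedComponentIn_eq hy] at hxn
  exact hxn hx'

/-- Every point of a simple closed curve is in the closure of every component of the complement. -/
lemma mem_closure_connectedComponentIn {β : Set (ℝ × ℝ)} {c : ℝ → ℝ × ℝ} (hc : IsLoopParam β c)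
    {w : ℝ × ℝ} (hw : w ∉ β) : c 0 ∈ closure (connectedComponentIn βᶜ w) := by
  by_contra hz
  set Ω := connectedComponentIn βᶜ w with hΩ
  have hβc := hc.isCompact
  have hwΩ : w ∈ Ω := mem_connectedComponentIn hw
  have hfr : frontier Ω ⊆ β := frontier_connectedComponentIn_subset hβc.isClosed w
  obtain ⟨A, hA, hAβ, hzA, hfrA⟩ : ∃ A, IsArc A ∧ A ⊆ β ∧ c 0 ∉ A ∧ frontier Ω ⊆ A := by
    have hnb : c ⁻¹' (closure Ω)ᶜ ∈ 𝓝 (0 : ℝ) :=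
      hc.cont.continuousAt.preimage_mem_nhds (isClosed_closure.isOpen_compl.mem_nhds hz)
    obtain ⟨δ, hδ, hδs⟩ := Metric.mem_nhds_iff.1 hnb
    set ε := min δ (1 / 4) with hε
    have hε0 : 0 < ε := lt_min hδ (by norm_num)
    have hε1 : ε ≤ 1 / 4 := min_le_right _ _
    have hs : IsSplit β (c ε) (c (1 - ε)) (c '' Icc ε (1 - ε)) (c '' Icc (1 - ε) (ε + 1)) :=
      ⟨c, hc, ε, 1 - ε, by linarith, by linarith, rfl, rfl, rfl, rfl⟩
    refine ⟨_, hs.isArc, hs.subset, ?_, ?_⟩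
    · rintro ⟨t, ht, h⟩
      have := hc.eq_of_abs_lt h (by linarith [ht.2]) (by linarith [ht.1])
      linarith [ht.1]
    · intro x hx
      obtain ⟨t, ht, rfl⟩ := hc.exists_mem_Ico (hfr hx) (-(ε / 2))
      have hxc : c t ∈ closure Ω := frontier_subset_closure hx
      have hnot : ∀ u, |u| < ε → c u ∉ closure Ω := fun u hu =>
        hδs (by simpa using hu.trans_le (min_le_left _ _))
      have h1 : ε ≤ t := by
        by_contra hlt
        exact hnot t (abs_lt.2 ⟨by linarith [ht.1], not_le.1 hlt⟩) hxc
      refine ⟨t, ⟨h1, ?_⟩, rfl⟩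
      by_contra hlt
      refine hnot (t - 1) (abs_lt.2 ⟨by linarith [ht.2], by linarith [ht.2]⟩) ?_
      rwa [← hc.add_one, sub_add_cancel]
  have hlog : ∀ x ∉ A, HasLogOn (fun y => toC y - toC x) A := fun x hx =>
    hasLogOn_of_isArc hA (toC.continuous.sub continuous_const) fun y hy h =>
      hx (toC.injective (sub_eq_zero.1 h) ▸ hy)
  by_cases hb : Bornology.IsBounded Ω
  · exact not_hasLogOn_frontier hb hwΩ ((hlog w fun h => hw (hAβ h)).mono hfrA)
  · obtain ⟨D, hD, hDβ, hDc⟩ := exists_isBounded_compl_preconnected hβc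
    have hDΩ := subset_of_not_isBounded hD hDβ hDc hΩ hb
    refine not_hasLogOn_frontier (Ω := (closure Ω)ᶜ) (p := c 0) ?_ hz ((hlog _ hzA).mono ?_)
    · exact hDc.isBounded.subset (compl_subset_compl.2 (hDΩ.trans subset_closure))
    · rw [frontier_compl]
      exact frontier_closure_subset.trans hfrA

/-- `S` and `S'` are the two sides of `β`. -/
structure IsSidePair (β S S' : Set (ℝ × ℝ)) : Prop where
  union_eq : S ∪ S' = βᶜ
  disjoint : Disjoint S S'
  isPreconnected_left : IsPreconnected S
  isPreconnected_right : IsPreconnected S'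
  subset_left : ∀ T, IsPreconnected T → T ⊆ βᶜ → (T ∩ S).Nonempty → T ⊆ S
  subset_right : ∀ T, IsPreconnected T → T ⊆ βᶜ → (T ∩ S').Nonempty → T ⊆ S'
  chart : ∀ e : ℝ × ℝ → ℝ × ℝ, IsOpenEmbedding e → (∀ a, e a ∈ β ↔ a.2 = 0) →
    (e (0, 1) ∈ S ∧ e (0, -1) ∈ S') ∨ (e (0, 1) ∈ S' ∧ e (0, -1) ∈ S)

lemma IsSidePair.symm {β S S' : Set (ℝ × ℝ)} (h : IsSidePair β S S') : IsSidePair β S' S :=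
  ⟨by rw [union_comm]; exact h.1, h.2.symm, h.4, h.3, h.6, h.5, fun e he heβ => (h.7 e he heβ).symm⟩

lemma isPreconnected_image_upper {e : ℝ × ℝ → ℝ × ℝ} (he : Continuous e) :
    IsPreconnected (e '' {a | 0 < a.2}) := by
  refine IsPreconnected.image ?_ _ he.continuousOn
  exact (convex_halfSpace_gt (f := fun a : ℝ × ℝ => a.2) ⟨fun _ _ => rfl, fun _ _ => rfl⟩
    0).isPreconnected

lemma isPreconnected_image_lower {e : ℝ × ℝ → ℝ × ℝ} (he : Continuous e) :
    IsPreconnected (e '' {a | a.2 < 0}) := by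
  refine IsPreconnected.image ?_ _ he.continuousOn
  exact (convex_halfSpace_lt (f := fun a : ℝ × ℝ => a.2) ⟨fun _ _ => rfl, fun _ _ => rfl⟩
    0).isPreconnected

lemma mem_connectedComponentIn_of_chart {β : Set (ℝ × ℝ)} (hβ : IsSimpleClosedCurve β)
    {e : ℝ × ℝ → ℝ × ℝ} (he : IsOpenEmbedding e) (heβ : ∀ a, e a ∈ β ↔ a.2 = 0) {w : ℝ × ℝ}
    (hw : w ∉ β) :
    e (0, 1) ∈ connectedComponentIn βᶜ w ∨ e (0, -1) ∈ connectedComponentIn βᶜ w := by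
  obtain ⟨c, hc, hc0⟩ := exists_isLoopParam hβ ((heβ 0).2 rfl)
  have h := mem_closure_connectedComponentIn hc hw
  rw [hc0] at h
  obtain ⟨_, ⟨a, rfl⟩, hy⟩ := mem_closure_iff.1 h _ he.isOpen_range ⟨0, rfl⟩
  have ha : a.2 ≠ 0 := fun h0 => connectedComponentIn_subset _ _ hy ((heβ a).2 h0)
  rw [connectedComponentIn_eq hy]
  rcases ha.lt_or_gt with ha | ha
  · right
    refine (isPreconnected_image_lower he.continuous).subset_connectedComponentIn ⟨a, ha, rfl⟩ ?_
      ⟨_, by simp, rfl⟩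
    rintro _ ⟨b, hb, rfl⟩ h
    exact hb.ne ((heβ b).1 h)
  · left
    refine (isPreconnected_image_upper he.continuous).subset_connectedComponentIn ⟨a, ha, rfl⟩ ?_
      ⟨_, by simp, rfl⟩
    rintro _ ⟨b, hb, rfl⟩ h
    exact hb.ne' ((heβ b).1 h)

lemma chart_mem_sides {β : Set (ℝ × ℝ)} (hβ : IsSimpleClosedCurve β)
    {e : ℝ × ℝ → ℝ × ℝ} (he : IsOpenEmbedding e) (heβ : ∀ a, e a ∈ β ↔ a.2 = 0) :
    (e (0, 1) ∈ innerSide β ∧ e (0, -1) ∈ outerSide β) ∨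
      (e (0, 1) ∈ outerSide β ∧ e (0, -1) ∈ innerSide β) := by
  obtain ⟨c, hc, hc0⟩ := exists_isLoopParam hβ ((heβ 0).2 rfl)
  have hβc := hc.isCompact
  have hp : e (0, 1) ∈ βᶜ := fun h => by simpa using (heβ _).1 h
  have hq : e (0, -1) ∈ βᶜ := fun h => by simpa using (heβ _).1 h
  have hne : e (0, -1) ∉ connectedComponentIn βᶜ (e (0, 1)) := by
    intro h
    refine separates_of_isPreconnected_diff he hβc.isClosed heβ ?_
      isPreconnected_connectedComponentIn (connectedComponentIn_subset _ _)
      (mem_connectedComponentIn hp) h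
    have : β \ {e 0} = c '' Ioo 0 1 := by
      rw [← hc0]
      ext z
      constructor
      · rintro ⟨hz, hz0⟩
        obtain ⟨t, ht, rfl⟩ := hc.exists_mem_Ico hz 0
        refine ⟨t, ⟨lt_of_le_of_ne ht.1 ?_, by linarith [ht.2]⟩, rfl⟩
        rintro rfl
        exact hz0 rfl
      · rintro ⟨t, ht, rfl⟩
        refine ⟨hc.mem t, fun h => ?_⟩
        have := hc.eq_of_abs_lt h (by linarith [ht.2]) (by linarith [ht.1])
        exact ht.1.ne' this
    rw [this]
    exact isPreconnected_Ioo.image _ hc.cont.continuousOn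
  obtain ⟨D, hD, hDβ, hDc⟩ := exists_isBounded_compl_preconnected hβc
  have hDne : D.Nonempty := by
    by_contra h
    rw [not_nonempty_iff_eq_empty.1 h, compl_empty] at hDc
    exact noncompact_univ (ℝ × ℝ) hDc
  by_cases h1 : Bornology.IsBounded (connectedComponentIn βᶜ (e (0, 1))) <;>
    by_cases h2 : Bornology.IsBounded (connectedComponentIn βᶜ (e (0, -1)))
  · exfalso
    obtain ⟨w, hw⟩ := hDne
    refine noncompact_univ (ℝ × ℝ) (Metric.isCompact_of_isClosed_isBounded isClosed_univ ?_)
    refine ((h1.union h2).union hβc.isBounded).subset fun w _ => ?_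
    by_cases hwβ : w ∈ β
    · exact Or.inr hwβ
    · left
      rcases mem_connectedComponentIn_of_chart hβ he heβ hwβ with h | h
      · left
        rw [← connectedComponentIn_eq h]
        exact mem_connectedComponentIn hwβ
      · right
        rw [← connectedComponentIn_eq h]
        exact mem_connectedComponentIn hwβ
  · exact Or.inl ⟨⟨hp, h1⟩, hq, h2⟩
  · exact Or.inr ⟨⟨hp, h1⟩, hq, h2⟩
  · exfalso
    obtain ⟨w, hw⟩ := hDne
    have k1 := subset_of_not_isBounded hD hDβ hDc rfl h1 hw
    have k2 := subset_of_not_isBounded hD hDβ hDc rfl h2 hw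
    rw [connectedComponentIn_eq k1, ← connectedComponentIn_eq k2] at hne
    exact hne (mem_connectedComponentIn hq)

/-- The Jordan curve theorem for a curve that is locally flat at some point. -/
theorem isSidePair_inner_outer {β : Set (ℝ × ℝ)} (hβ : IsSimpleClosedCurve β)
    {e : ℝ × ℝ → ℝ × ℝ} (he : IsOpenEmbedding e) (heβ : ∀ a, e a ∈ β ↔ a.2 = 0) :
    IsSidePair β (innerSide β) (outerSide β) := by
  have hdisj : Disjoint (innerSide β) (outerSide β) :=
    disjoint_left.2 fun x hx hx' => hx'.2 hx.2
  have key : ∀ p q, p ∈ innerSide β → q ∈ outerSide β →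
      (∀ w ∉ β, p ∈ connectedComponentIn βᶜ w ∨ q ∈ connectedComponentIn βᶜ w) →
      IsPreconnected (innerSide β) ∧ IsPreconnected (outerSide β) := by
    intro p q hp hq h
    have e1 : innerSide β = connectedComponentIn βᶜ p := by
      refine Subset.antisymm (fun w hw => ?_) ?_
      · rcases h w hw.1 with h | h
        · rw [← connectedComponentIn_eq h]; exact mem_connectedComponentIn hw.1
        · refine absurd hw.2 ?_
          rw [connectedComponentIn_eq h]; exact hq.2
      · exact subset_innerSide isPreconnected_connectedComponentIn
          (connectedComponentIn_subset _ _) ⟨p, mem_connectedComponentIn hp.1, hp⟩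
    have e2 : outerSide β = connectedComponentIn βᶜ q := by
      refine Subset.antisymm (fun w hw => ?_) ?_
      · rcases h w hw.1 with h | h
        · refine absurd ?_ hw.2
          rw [connectedComponentIn_eq h]; exact hp.2
        · rw [← connectedComponentIn_eq h]; exact mem_connectedComponentIn hw.1
      · exact subset_outerSide isPreconnected_connectedComponentIn
          (connectedComponentIn_subset _ _) ⟨q, mem_connectedComponentIn hq.1, hq⟩
    rw [e1, e2]
    exact ⟨isPreconnected_connectedComponentIn, isPreconnected_connectedComponentIn⟩
  have hconn : IsPreconnected (innerSide β) ∧ IsPreconnected (outerSide β) := by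
    rcases chart_mem_sides hβ he heβ with ⟨h1, h2⟩ | ⟨h1, h2⟩
    · exact key _ _ h1 h2 fun w hw => mem_connectedComponentIn_of_chart hβ he heβ hw
    · exact key _ _ h2 h1 fun w hw => (mem_connectedComponentIn_of_chart hβ he heβ hw).symm
  refine ⟨?_, hdisj, hconn.1, hconn.2, fun T h1 h2 h3 => subset_innerSide h1 h2 h3,
    fun T h1 h2 h3 => subset_outerSide h1 h2 h3, fun e he heβ => chart_mem_sides hβ he heβ⟩
  ext x
  constructor
  · rintro (h | h) <;> exact h.1
  · intro h
    by_cases hb : Bornology.IsBounded (connectedComponentIn βᶜ x)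
    · exact Or.inl ⟨h, hb⟩
    · exact Or.inr ⟨h, hb⟩

/-- A chart of the plane centred at `z` in which `β` and `ρ` are the coordinate axes. -/
structure IsCrossChart (β ρ : Set (ℝ × ℝ)) (z : ℝ × ℝ) (e : ℝ × ℝ → ℝ × ℝ) : Prop where
  isOpenEmbedding : IsOpenEmbedding e
  map_zero : e 0 = z
  mem_left : ∀ a, e a ∈ β ↔ a.2 = 0
  mem_right : ∀ a, e a ∈ ρ ↔ a.1 = 0

lemma IsCrossing.exists_chart {β ρ : Set (ℝ × ℝ)} {z : ℝ × ℝ} (h : IsCrossing β ρ z) :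
    ∃ e, IsCrossChart β ρ z e := by
  obtain ⟨U, hU, hz, φ, h0, h1, h2⟩ := h
  have key : ∀ (C : Set (ℝ × ℝ)) (p : ℝ × ℝ → Prop), φ '' {q : U | (q : ℝ × ℝ) ∈ C} = {q | p q} →
      ∀ a, ((φ.symm a : U) : ℝ × ℝ) ∈ C ↔ p a := by
    intro C p h a
    have : a ∈ φ '' {q : U | (q : ℝ × ℝ) ∈ C} ↔ p a := by rw [h]; rfl
    rw [← this]
    constructor
    · intro ha
      exact ⟨φ.symm a, ha, φ.apply_symm_apply a⟩
    · rintro ⟨q, hq, rfl⟩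
      rwa [φ.symm_apply_apply]
  refine ⟨fun a => φ.symm a, hU.isOpenEmbedding_subtypeVal.comp φ.symm.isOpenEmbedding, ?_,
    key β _ h1, key ρ _ h2⟩
  have : φ.symm 0 = ⟨z, hz⟩ := by rw [φ.symm_apply_eq]; exact h0.symm
  rw [this]

lemma isOpenEmbedding_mul_arctan {δ : ℝ} (hδ : 0 < δ) :
    IsOpenEmbedding fun t : ℝ => δ * Real.arctan t := by
  have h1 : IsOpenEmbedding Real.arctan := by
    refine ⟨Real.arctan_strictMono.isEmbedding_of_ordConnected ?_, ?_⟩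
    · rw [Real.range_arctan]; exact ordConnected_Ioo
    · rw [Real.range_arctan]; exact isOpen_Ioo
  exact (Homeomorph.mulLeft₀ δ hδ.ne').isOpenEmbedding.comp h1

namespace IsCrossChart

variable {β ρ N S S' : Set (ℝ × ℝ)} {z : ℝ × ℝ} {e : ℝ × ℝ → ℝ × ℝ}

lemma mem (he : IsCrossChart β ρ z e) : z ∈ β ∩ ρ := by
  rw [← he.map_zero]
  exact ⟨(he.mem_left 0).2 rfl, (he.mem_right 0).2 rfl⟩

lemma range_mem_nhds (he : IsCrossChart β ρ z e) : range e ∈ 𝓝 z :=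
  he.isOpenEmbedding.isOpen_range.mem_nhds ⟨0, he.map_zero⟩

lemma eq_of_mem (he : IsCrossChart β ρ z e) {w : ℝ × ℝ} (hw : w ∈ range e) (hβ : w ∈ β)
    (hρ : w ∈ ρ) : w = z := by
  obtain ⟨a, rfl⟩ := hw
  rw [← he.map_zero]
  congr 1
  exact Prod.ext ((he.mem_right a).1 hρ) ((he.mem_left a).1 hβ)

lemma flip (he : IsCrossChart β ρ z e) : IsCrossChart β ρ z (fun a => e (a.1, -a.2)) := by
  refine ⟨?_, by simpa [Prod.mk_zero_zero] using he.map_zero, fun a => by simp [he.mem_left],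
    fun a => by simp [he.mem_right]⟩
  exact he.isOpenEmbedding.comp
    ((Homeomorph.refl ℝ).prodCongr (Homeomorph.neg ℝ)).isOpenEmbedding

lemma shrink (he : IsCrossChart β ρ z e) (hN : N ∈ 𝓝 z) :
    ∃ e', IsCrossChart β ρ z e' ∧ range e' ⊆ N := by
  have h1 : e ⁻¹' N ∈ 𝓝 (0 : ℝ × ℝ) :=
    he.isOpenEmbedding.continuous.continuousAt.preimage_mem_nhds (by rwa [he.map_zero])
  obtain ⟨ε, hε, hb⟩ := Metric.mem_nhds_iff.1 h1
  have hδ : 0 < ε / 2 := by linarith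
  have hf := isOpenEmbedding_mul_arctan hδ
  have hz : ∀ t : ℝ, ε / 2 * Real.arctan t = 0 ↔ t = 0 := by
    intro t
    simp [hδ.ne']
  have hlt : ∀ t : ℝ, |ε / 2 * Real.arctan t| < ε := by
    intro t
    have h2 : |Real.arctan t| < 2 := by
      rw [abs_lt]
      constructor <;> linarith [Real.neg_pi_div_two_lt_arctan t, Real.arctan_lt_pi_div_two t,
        Real.pi_lt_d2]
    rw [abs_mul, abs_of_pos hδ]
    nlinarith
  refine ⟨fun a => e (ε / 2 * Real.arctan a.1, ε / 2 * Real.arctan a.2),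
    ⟨he.isOpenEmbedding.comp (hf.prodMap hf), ?_, fun a => ?_, fun a => ?_⟩, ?_⟩
  · simpa [Prod.mk_zero_zero] using he.map_zero
  · rw [he.mem_left, hz]
  · rw [he.mem_right, hz]
  · rintro _ ⟨a, rfl⟩
    refine hb ?_
    rw [mem_ball_zero_iff, Prod.norm_def]
    exact max_lt (hlt _) (hlt _)

end IsCrossChart

/-- A cross chart with the upper half plane on the side `S` and the lower one on `S'`. -/
structure IsSidedChart (β ρ S S' : Set (ℝ × ℝ)) (z : ℝ × ℝ) (e : ℝ × ℝ → ℝ × ℝ) : Prop extends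
    IsCrossChart β ρ z e where
  upper : ∀ a, 0 < a.2 → e a ∈ S
  lower : ∀ a, a.2 < 0 → e a ∈ S'

lemma IsSidePair.exists_sidedChart {β ρ S S' N : Set (ℝ × ℝ)} {z : ℝ × ℝ}
    (hS : IsSidePair β S S') (hz : IsCrossing β ρ z) (hN : N ∈ 𝓝 z) :
    ∃ e, IsSidedChart β ρ S S' z e ∧ range e ⊆ N := by
  obtain ⟨e₀, he₀⟩ := hz.exists_chart
  obtain ⟨e, he, heN⟩ := he₀.shrink hN
  have key : ∀ e, IsCrossChart β ρ z e → e (0, 1) ∈ S → e (0, -1) ∈ S' →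
      IsSidedChart β ρ S S' z e := by
    intro e he h1 h2
    refine ⟨he, fun a ha => ?_, fun a ha => ?_⟩
    · refine hS.subset_left _ (isPreconnected_image_upper he.isOpenEmbedding.continuous) ?_
        ⟨_, ⟨(0, 1), by simp, rfl⟩, h1⟩ ⟨a, ha, rfl⟩
      rintro _ ⟨b, hb, rfl⟩ hbβ
      exact (ne_of_gt hb) ((he.mem_left b).1 hbβ)
    · refine hS.subset_right _ (isPreconnected_image_lower he.isOpenEmbedding.continuous) ?_
        ⟨_, ⟨(0, -1), by simp, rfl⟩, h2⟩ ⟨a, ha, rfl⟩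
      rintro _ ⟨b, hb, rfl⟩ hbβ
      exact (ne_of_lt hb) ((he.mem_left b).1 hbβ)
  rcases hS.chart e he.isOpenEmbedding he.mem_left with ⟨h1, h2⟩ | ⟨h1, h2⟩
  · exact ⟨e, key e he h1 h2, heN⟩
  · refine ⟨_, key _ he.flip (by simpa using h2) (by simpa using h1), ?_⟩
    rintro _ ⟨a, rfl⟩
    exact heN (mem_range_self _)

lemma IsSplit.subset_of_isPreconnected {C A A' T : Set (ℝ × ℝ)} {x y : ℝ × ℝ}
    (h : IsSplit C x y A A') (hT : IsPreconnected T) (hTC : T ⊆ C) (hx : x ∉ T) (hy : y ∉ T)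
    (hTA : (T ∩ A).Nonempty) : T ⊆ A := by
  intro w hw
  by_contra hwA
  have hcov : T ⊆ A ∪ A' := by rwa [h.union_eq]
  obtain ⟨v, hv, hvA⟩ := isPreconnected_closed_iff.1 hT A A' h.isCompact.isClosed
    h.swap.isCompact.isClosed hcov hTA ⟨w, hw, (hcov hw).resolve_left hwA⟩
  rw [h.inter_eq] at hvA
  rcases hvA with rfl | rfl
  · exact hx hv
  · exact hy hv

/-- A subarc `γ` of `ρ` with end points `x`, `y` on `β`, crossing the side `S` of `β`. -/
structure IsChord (β ρ S : Set (ℝ × ℝ)) (x y : ℝ × ℝ) (γ γ' : Set (ℝ × ℝ)) : Prop where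
  split : IsSplit ρ x y γ γ'
  left_mem : x ∈ β
  right_mem : y ∈ β
  diff_subset : γ \ {x, y} ⊆ S

namespace IsChord

variable {β ρ S S' γ γ' : Set (ℝ × ℝ)} {x y : ℝ × ℝ} {e : ℝ × ℝ → ℝ × ℝ}

lemma reverse (h : IsChord β ρ S x y γ γ') : IsChord β ρ S y x γ γ' :=
  ⟨h.split.reverse, h.right_mem, h.left_mem, by rw [pair_comm]; exact h.diff_subset⟩

lemma pair_subset (h : IsChord β ρ S x y γ γ') : {x, y} ⊆ β := by
  rintro z (rfl | rfl)
  · exact h.left_mem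
  · exact h.right_mem

lemma inter_eq (h : IsChord β ρ S x y γ γ') (hS : IsSidePair β S S') : β ∩ γ = {x, y} := by
  refine Subset.antisymm ?_ ?_
  · rintro w ⟨hwβ, hwγ⟩
    by_contra hw
    exact (hS.union_eq ▸ Or.inl (h.diff_subset ⟨hwγ, hw⟩) : w ∈ βᶜ) hwβ
  · intro w hw
    refine ⟨h.pair_subset hw, ?_⟩
    rw [← h.split.inter_eq] at hw
    exact hw.1

lemma chart_mem (h : IsChord β ρ S x y γ γ') (hS : IsSidePair β S S')
    (he : IsSidedChart β ρ S S' x e) (hy : y ∉ range e) {a : ℝ × ℝ} (ha : a.1 = 0)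
    (ha2 : 0 < a.2) : e a ∈ γ := by
  have hpos : ∀ a, e a ∈ S → 0 < a.2 := by
    intro a ha
    by_contra hle
    rcases (not_lt.1 hle).eq_or_lt with h0 | h0
    · exact (hS.union_eq ▸ Or.inl ha : e a ∈ βᶜ) ((he.mem_left a).2 h0)
    · exact disjoint_left.1 hS.disjoint ha (he.lower a h0)
  refine h.split.subset_of_isPreconnected (T := e '' ({0} ×ˢ Ioi 0)) ?_ ?_ ?_ ?_ ?_
    ⟨a, ⟨ha, ha2⟩, rfl⟩
  · exact (isPreconnected_singleton.prod isPreconnected_Ioi).image _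
      he.isOpenEmbedding.continuous.continuousOn
  · rintro _ ⟨b, ⟨hb, -⟩, rfl⟩
    exact (he.mem_right b).2 hb
  · rintro ⟨b, ⟨-, hb⟩, hbx⟩
    exact (ne_of_gt hb) ((he.mem_left b).1 (hbx ▸ h.left_mem))
  · rintro ⟨b, -, hb⟩
    exact hy ⟨b, hb⟩
  · obtain ⟨_, ⟨b, rfl⟩, hb⟩ := mem_closure_iff_nhds.1 (h.split.subset_closure h.split.left_mem) _
      he.range_mem_nhds
    exact ⟨e b, ⟨b, ⟨(he.mem_right b).1 (h.split.subset hb.1), hpos b (h.diff_subset hb)⟩, rfl⟩,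
      hb.1⟩

lemma left_notMem_closure (h : IsChord β ρ S x y γ γ') (hS : IsSidePair β S S')
    (hx : IsCrossing β ρ x) : x ∉ closure (γ' ∩ S) := by
  intro hcl
  obtain ⟨e, he, hr⟩ := hS.exists_sidedChart hx (isOpen_compl_singleton.mem_nhds h.split.ne)
  obtain ⟨_, ⟨a, rfl⟩, haγ, haS⟩ := mem_closure_iff_nhds.1 hcl _ he.range_mem_nhds
  have hnβ : e a ∉ β := (hS.union_eq ▸ Or.inl haS : e a ∈ βᶜ)
  have ha : 0 < a.2 := by
    by_contra hle
    rcases (not_lt.1 hle).eq_or_lt with h0 | h0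
    · exact hnβ ((he.mem_left a).2 h0)
    · exact disjoint_left.1 hS.disjoint haS (he.lower a h0)
  have := h.chart_mem hS he (fun hy => hr hy rfl)
    ((he.mem_right a).1 (h.split.swap.subset haγ)) ha
  exact hnβ (h.pair_subset (h.split.inter_eq ▸ ⟨this, haγ⟩))

/-- Two chords on the same side of `β` have end points that do not interleave along `β`. -/
lemma right_mem_of_left_mem (h : IsChord β ρ S x y γ γ') (hS : IsSidePair β S S')
    (hcr : ∀ z ∈ β ∩ ρ, IsCrossing β ρ z) {α α' γ₂ γ₂' : Set (ℝ × ℝ)}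
    {u v : ℝ × ℝ} (hα : IsSplit β x y α α') (h₂ : IsChord β ρ S u v γ₂ γ₂')
    (hu : u ∈ α \ {x, y}) : v ∈ α \ {x, y} := by
  have hSβ : ∀ w ∈ S, w ∉ β := fun w hw => (hS.union_eq ▸ Or.inl hw : w ∈ βᶜ)
  have hS'β : ∀ w ∈ S', w ∉ β := fun w hw => (hS.union_eq ▸ Or.inr hw : w ∈ βᶜ)
  have hnot : ∀ w ∈ β, w ∉ ({x, y} : Set (ℝ × ℝ)) → w ∉ γ := fun w hw hn hγ =>
    hn (h.inter_eq hS ▸ ⟨hw, hγ⟩)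
  have hmem : ∀ w ∈ γ₂ \ {u, v}, w ∉ γ := by
    intro w hw hwγ
    refine hnot u h₂.left_mem hu.2 (h.split.isCompact.isClosed.closure_subset_iff.2 ?_
      (h₂.split.subset_closure h₂.split.left_mem))
    refine h.split.subset_of_isPreconnected h₂.split.isPreconnected_diff
      (sdiff_subset.trans h₂.split.subset) ?_ ?_ ⟨w, hw, hwγ⟩
    · exact fun hx => hSβ x (h₂.diff_subset hx) h.left_mem
    · exact fun hy => hSβ y (h₂.diff_subset hy) h.right_mem
  have hsub : γ₂ \ {u, v} ⊆ γ' ∩ S := by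
    intro w hw
    refine ⟨?_, h₂.diff_subset hw⟩
    have : w ∈ γ ∪ γ' := h.split.union_eq ▸ h₂.split.subset hw.1
    exact this.resolve_left (hmem w hw)
  have hvcl : v ∈ closure (γ' ∩ S) :=
    closure_mono hsub (h₂.split.subset_closure h₂.split.right_mem)
  have hxρ : x ∈ β ∩ ρ := ⟨h.left_mem, h.split.subset h.split.left_mem⟩
  have hyρ : y ∈ β ∩ ρ := ⟨h.right_mem, h.split.subset h.split.right_mem⟩
  have hv : v ∉ ({x, y} : Set (ℝ × ℝ)) := by
    rintro (rfl | rfl)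
    · exact h.left_notMem_closure hS (hcr _ hxρ) hvcl
    · exact h.reverse.left_notMem_closure hS (hcr _ hyρ) hvcl
  by_contra hvα
  have hvα : v ∉ α := fun h => hvα ⟨h, hv⟩
  have huα' : u ∉ α' := fun h => hu.2 (hα.inter_eq ▸ ⟨hu.1, h⟩)
  have huγ := hnot u h₂.left_mem hu.2
  have hvγ := hnot v h₂.right_mem hv
  have hC : IsClosed (α ∪ γ) := hα.isCompact.isClosed.union h.split.isCompact.isClosed
  obtain ⟨e, he, her⟩ := hS.exists_sidedChart (N := (γ ∪ α' ∪ {v})ᶜ)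
    (hcr u ⟨h₂.left_mem, h₂.split.subset h₂.split.left_mem⟩) (by
      refine (((h.split.isCompact.isClosed.union hα.swap.isCompact.isClosed).union
        isClosed_singleton).isOpen_compl).mem_nhds ?_
      rintro ((h | h) | h)
      · exact huγ h
      · exact huα' h
      · exact h₂.split.ne h)
  obtain ⟨e', he', her'⟩ := hS.exists_sidedChart (N := (α ∪ γ)ᶜ)
    (hcr v ⟨h₂.right_mem, h₂.split.subset h₂.split.right_mem⟩) (by
      refine hC.isOpen_compl.mem_nhds ?_
      rintro (h | h)
      · exact hvα h
      · exact hvγ h)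
  have hγ₂u : γ₂ \ {u, v} ⊆ γ₂ \ {u} := sdiff_subset_sdiff_right (by simp)
  have hpc : IsPreconnected (γ₂ \ {u}) := h₂.split.isPreconnected_diff.subset_closure hγ₂u
    (sdiff_subset.trans h₂.split.subset_closure)
  refine separates_of_isPreconnected_diff (T := γ₂ \ {u} ∪ range e' ∪ S') he.isOpenEmbedding hC
    ?_ ?_ ?_ ?_ (Or.inl (Or.inl ⟨?_, ?_⟩)) (Or.inr (he.lower _ (by simp)))
  · intro a
    rw [← he.mem_left a, ← hα.union_eq]
    constructor
    · rintro (h | h)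
      · exact Or.inl h
      · exact absurd (Or.inl (Or.inl h)) (her (mem_range_self a))
    · rintro (h | h)
      · exact Or.inl h
      · exact absurd (Or.inl (Or.inr h)) (her (mem_range_self a))
  · obtain ⟨A₁, A₂, h1, h2, hx1, hy2, hA⟩ := hα.exists_pieces hu
    have hγ : IsPreconnected γ := h.split.isPreconnected_diff.subset_closure sdiff_subset
      h.split.subset_closure
    rw [he.map_zero, union_sdiff_distrib, hA, sdiff_singleton_eq_self huγ, union_right_comm]
    exact (h1.union x hx1 h.split.left_mem hγ).union y (Or.inr h.split.right_mem) hy2 h2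
  · have h1 : v ∈ γ₂ \ {u} := ⟨h₂.split.right_mem, h₂.split.ne.symm⟩
    have h2 : v ∈ range e' := ⟨0, he'.map_zero⟩
    exact (hpc.union v h1 h2
      (isPreconnected_range he'.isOpenEmbedding.continuous)).union (e' (0, -1))
      (Or.inr (mem_range_self _)) (he'.lower _ (by simp)) hS.isPreconnected_right
  · rintro w ((⟨hw, hwu⟩ | hw) | hw) hwC
    · by_cases hwv : w = v
      · subst hwv
        exact hwC.elim hvα hvγ
      · have hw' : w ∈ γ₂ \ {u, v} := ⟨hw, by rintro (h | h); exacts [hwu h, hwv h]⟩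
        exact hwC.elim (fun h => hSβ w (hsub hw').2 (hα.subset h)) (hmem w hw')
    · exact her' hw hwC
    · rcases hwC with hwC | hwC
      · exact hS'β w hw (hα.subset hwC)
      · refine disjoint_left.1 hS.disjoint (h.diff_subset ⟨hwC, fun hxy => ?_⟩) hw
        exact hS'β w hw (h.pair_subset hxy)
  · exact h₂.chart_mem hS he (fun hr => her hr (Or.inr rfl)) rfl one_pos
  · intro h0
    exact hSβ _ (he.upper (0, 1) (by simp)) (h0 ▸ h₂.left_mem)

end IsChord

lemma IsSidePair.exists_param_mem {β ρ S S' : Set (ℝ × ℝ)} (hS : IsSidePair β S S')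
    {c : ℝ → ℝ × ℝ} (hc : IsLoopParam ρ c) (hz : IsCrossing β ρ (c 0)) {ε : ℝ} (hε : 0 < ε) :
    ∃ t, t ≠ 0 ∧ |t| < ε ∧ c t ∈ S := by
  have hK : IsCompact (c '' {t | t ∈ Icc (-(1 / 2)) (1 / 2) ∧ ε ≤ |t|}) :=
    (isCompact_Icc.inter_right (isClosed_le continuous_const continuous_abs)).image hc.cont
  obtain ⟨e, he, hr⟩ := hS.exists_sidedChart hz (hK.isClosed.isOpen_compl.mem_nhds (by
    rintro ⟨t, ⟨ht, ht2⟩, h⟩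
    have := hc.eq_of_abs_lt h (by linarith [ht.2]) (by linarith [ht.1])
    rw [this, abs_zero] at ht2
    linarith))
  obtain ⟨t, ht, h⟩ := hc.exists_mem_Ico ((he.mem_right (0, 1)).2 rfl) (-(1 / 2))
  refine ⟨t, ?_, ?_, h ▸ he.upper _ (by simp)⟩
  · rintro rfl
    have h1 := he.mem.1
    rw [h, he.mem_left] at h1
    simp at h1
  · by_contra hle
    exact hr (mem_range_self (0, 1)) ⟨t, ⟨⟨ht.1, by linarith [ht.2]⟩, not_lt.1 hle⟩, h⟩

lemma IsSidePair.exists_sided_param {β ρ S S' : Set (ℝ × ℝ)} (hS : IsSidePair β S S')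
    (hρ : IsSimpleClosedCurve ρ) {z : ℝ × ℝ} (hzρ : z ∈ ρ) (hz : IsCrossing β ρ z) :
    ∃ c, IsLoopParam ρ c ∧ c 0 = z ∧ ∃ ε > 0, c '' Ioo 0 ε ⊆ S ∧ c '' Ioo (-ε) 0 ⊆ S' := by
  obtain ⟨c, hc, rfl⟩ := exists_isLoopParam hρ hzρ
  obtain ⟨e, he⟩ := hz.exists_chart
  obtain ⟨δ, hδ, hb⟩ := Metric.mem_nhds_iff.1
    (hc.cont.continuousAt.preimage_mem_nhds he.range_mem_nhds)
  set ε := min δ (1 / 2) with hε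
  have hε0 : 0 < ε := lt_min hδ (by norm_num)
  have hε2 : ε ≤ 1 / 2 := min_le_right _ _
  have hnot : ∀ t, t ≠ 0 → |t| < ε → c t ∉ β := by
    intro t ht htε htβ
    have h1 : c t ∈ range e := hb (by
      rw [mem_ball_zero_iff, Real.norm_eq_abs]
      exact htε.trans_le (min_le_left _ _))
    have := abs_lt.1 htε
    exact ht (hc.eq_of_abs_lt (he.eq_of_mem h1 htβ (hc.mem t)) (by linarith) (by linarith))
  have hpos : c '' Ioo 0 ε ⊆ βᶜ := by
    rintro _ ⟨t, ht, rfl⟩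
    exact hnot t ht.1.ne' (by rw [abs_of_pos ht.1]; exact ht.2)
  have hneg : c '' Ioo (-ε) 0 ⊆ βᶜ := by
    rintro _ ⟨t, ht, rfl⟩
    exact hnot t ht.2.ne (by rw [abs_of_neg ht.2]; linarith [ht.1])
  have hcp : IsPreconnected (c '' Ioo 0 ε) := isPreconnected_Ioo.image _ hc.cont.continuousOn
  have hcn : IsPreconnected (c '' Ioo (-ε) 0) := isPreconnected_Ioo.image _ hc.cont.continuousOn
  obtain ⟨s, hs0, hsε, hs⟩ := hS.exists_param_mem hc hz hε0
  obtain ⟨t, ht0, htε, ht⟩ := hS.symm.exists_param_mem hc hz hε0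
  rw [abs_lt] at hsε htε
  rcases hs0.lt_or_gt with hs0 | hs0
  · have h1 : c '' Ioo (-ε) 0 ⊆ S := hS.subset_left _ hcn hneg ⟨c s, ⟨s, ⟨hsε.1, hs0⟩, rfl⟩, hs⟩
    have ht0 : 0 < t := by
      refine lt_of_le_of_ne (not_lt.1 fun h => ?_) ht0.symm
      exact disjoint_left.1 hS.disjoint (h1 ⟨t, ⟨htε.1, h⟩, rfl⟩) ht
    have h2 : c '' Ioo 0 ε ⊆ S' := hS.subset_right _ hcp hpos ⟨c t, ⟨t, ⟨ht0, htε.2⟩, rfl⟩, ht⟩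
    refine ⟨_, hc.reverse, by simp, ε, hε0, ?_, ?_⟩
    · rintro _ ⟨r, hr, rfl⟩
      exact h1 ⟨-r, ⟨by linarith [hr.2], by linarith [hr.1]⟩, rfl⟩
    · rintro _ ⟨r, hr, rfl⟩
      exact h2 ⟨-r, ⟨by linarith [hr.2], by linarith [hr.1]⟩, rfl⟩
  · have h1 : c '' Ioo 0 ε ⊆ S := hS.subset_left _ hcp hpos ⟨c s, ⟨s, ⟨hs0, hsε.2⟩, rfl⟩, hs⟩
    have ht0 : t < 0 := by
      refine lt_of_le_of_ne (not_lt.1 fun h => ?_) ht0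
      exact disjoint_left.1 hS.disjoint (h1 ⟨t, ⟨h, htε.2⟩, rfl⟩) ht
    exact ⟨c, hc, rfl, ε, hε0, h1,
      hS.subset_right _ hcn hneg ⟨c t, ⟨t, ⟨htε.1, ht0⟩, rfl⟩, ht⟩⟩

lemma IsSidePair.exists_isChord {β ρ S S' : Set (ℝ × ℝ)} (hS : IsSidePair β S S')
    (hβ : IsClosed β) (hρ : IsSimpleClosedCurve ρ) {z : ℝ × ℝ} (hz : z ∈ β ∩ ρ)
    (hcr : IsCrossing β ρ z) : ∃ y γ γ', IsChord β ρ S z y γ γ' := by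
  obtain ⟨c, hc, rfl, δ, hδ, h1, h2⟩ := hS.exists_sided_param hρ hz.2 hcr
  have hSβ : ∀ w ∈ S, w ∉ β := fun w hw => (hS.union_eq ▸ Or.inl hw : w ∈ βᶜ)
  have hS'β : ∀ w ∈ S', w ∉ β := fun w hw => (hS.union_eq ▸ Or.inr hw : w ∈ βᶜ)
  set ε := min δ (1 / 2) with hε
  have hε0 : 0 < ε := lt_min hδ (by norm_num)
  have hε2 : ε ≤ 1 / 2 := min_le_right _ _
  have hεδ : ε ≤ δ := min_le_left _ _
  have h1' : ∀ t, 0 < t → t < ε → c t ∈ S := fun t h h' => h1 ⟨t, ⟨h, by linarith⟩, rfl⟩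
  have h2' : ∀ t, 1 - ε < t → t < 1 → c t ∈ S' := by
    intro t h h'
    have := hc.add_one (t - 1)
    rw [sub_add_cancel] at this
    rw [this]
    exact h2 ⟨t - 1, ⟨by linarith, by linarith⟩, rfl⟩
  have hKc : IsCompact (Icc (ε / 2) (1 - ε / 2) ∩ c ⁻¹' β) :=
    isCompact_Icc.inter_right (hβ.preimage hc.cont)
  have hKn : (Icc (ε / 2) (1 - ε / 2) ∩ c ⁻¹' β).Nonempty := by
    by_contra hK
    have hsub : c '' Ioo 0 1 ⊆ βᶜ := by
      rintro _ ⟨t, ht, rfl⟩ htβ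
      refine hK ⟨t, ⟨not_lt.1 fun h => ?_, not_lt.1 fun h => ?_⟩, htβ⟩
      · exact hSβ _ (h1' t ht.1 (by linarith)) htβ
      · exact hS'β _ (h2' t (by linarith) ht.2) htβ
    have := hS.subset_left _ (isPreconnected_Ioo.image _ hc.cont.continuousOn) hsub
      ⟨c (ε / 2), ⟨_, ⟨by linarith, by linarith⟩, rfl⟩, h1' _ (by linarith) (by linarith)⟩
    exact disjoint_left.1 hS.disjoint (this ⟨1 - ε / 2, ⟨by linarith, by linarith⟩, rfl⟩)
      (h2' _ (by linarith) (by linarith))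
  obtain ⟨t, ⟨ht, htβ⟩, hmin⟩ := hKc.exists_isLeast hKn
  have hsub : c '' Ioo 0 t ⊆ S := by
    refine hS.subset_left _ (isPreconnected_Ioo.image _ hc.cont.continuousOn) ?_
      ⟨c (ε / 4), ⟨_, ⟨by linarith, by linarith [ht.1]⟩, rfl⟩, h1' _ (by linarith) (by linarith)⟩
    rintro _ ⟨r, hr, rfl⟩ hrβ
    rcases lt_or_ge r (ε / 2) with h | h
    · exact hSβ _ (h1' r hr.1 (by linarith)) hrβ
    · exact not_lt.2 (hmin ⟨⟨h, by linarith [hr.2, ht.2]⟩, hrβ⟩) hr.2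
  refine ⟨c t, _, _, ⟨c, hc, 0, t, by linarith [ht.1], by linarith [ht.2], rfl, rfl, rfl, rfl⟩,
    hz.1, htβ, ?_⟩
  rintro _ ⟨⟨r, hr, rfl⟩, hn⟩
  refine hsub ⟨r, ⟨lt_of_le_of_ne hr.1 ?_, lt_of_le_of_ne hr.2 ?_⟩, rfl⟩
  · rintro rfl; exact hn (Or.inl rfl)
  · rintro rfl; exact hn (Or.inr rfl)

lemma finite_inter_of_isCrossing {β ρ : Set (ℝ × ℝ)} (h : IsCompact (β ∩ ρ))
    (hcr : ∀ z ∈ β ∩ ρ, IsCrossing β ρ z) : (β ∩ ρ).Finite := by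
  choose! e he using fun z hz => (hcr z hz).exists_chart
  obtain ⟨t, ht, hsub⟩ := h.elim_nhds_subcover (fun z => range (e z))
    fun z hz => (he z hz).range_mem_nhds
  refine t.finite_toSet.subset fun w hw => ?_
  obtain ⟨z, hz, hwz⟩ := mem_iUnion₂.1 (hsub hw)
  rwa [(he z (ht z hz)).eq_of_mem hwz hw.1 hw.2]

/-- Every arc of `β` cut off by a chord contains the `β`-side of a digon on the same side. -/
lemma IsChord.exists_digon {β ρ S S' : Set (ℝ × ℝ)} (hS : IsSidePair β S S')
    (hβ : IsClosed β) (hρ : IsSimpleClosedCurve ρ) (hfin : (β ∩ ρ).Finite)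
    (hcr : ∀ z ∈ β ∩ ρ, IsCrossing β ρ z) {x y : ℝ × ℝ} {γ γ' α α' : Set (ℝ × ℝ)}
    (h : IsChord β ρ S x y γ γ') (hα : IsSplit β x y α α') :
    ∃ α₁ γ₁, IsDigon β ρ α₁ γ₁ ∧ α₁ ⊆ α ∧ γ₁ \ {a | IsEndpointOf a γ₁} ⊆ S := by
  induction hn : (ρ ∩ (α \ {x, y})).ncard using Nat.strong_induction_on
    generalizing x y γ γ' α α' with
  | _ n ih =>
  rcases (ρ ∩ (α \ {x, y})).eq_empty_or_nonempty with h0 | ⟨u, huρ, hu⟩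
  · refine ⟨α, γ, ⟨hα.isArc, h.split.isArc, hα.subset, h.split.subset, x, y, hα.ne,
      hα.endpoints, h.split.endpoints, h.inter_eq hS, Subset.antisymm ?_ ?_⟩, Subset.rfl, ?_⟩
    · rintro w ⟨hwρ, hwα⟩
      by_contra hw
      exact (h0 ▸ ⟨hwρ, hwα, hw⟩ : w ∈ (∅ : Set (ℝ × ℝ)))
    · rintro w (rfl | rfl)
      · exact ⟨h.split.subset h.split.left_mem, hα.left_mem⟩
      · exact ⟨h.split.subset h.split.right_mem, hα.right_mem⟩
    · rw [h.split.endpoints]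
      exact h.diff_subset
  · have huβ := hα.subset hu.1
    obtain ⟨v, γ₂, γ₂', h₂⟩ := hS.exists_isChord hβ hρ ⟨huβ, huρ⟩ (hcr u ⟨huβ, huρ⟩)
    have hv := h.right_mem_of_left_mem hS hcr hα h₂ hu
    obtain ⟨α₂, α₂', hα₂, hsub⟩ := hα.exists_sub hu hv h₂.split.ne
    have hlt : (ρ ∩ (α₂ \ {u, v})).ncard < n := by
      rw [← hn]
      refine ncard_lt_ncard ⟨?_, fun hle => (hle ⟨huρ, hu⟩).2.2 (Or.inl rfl)⟩
        (hfin.subset fun w hw => ⟨hα.subset hw.2.1, hw.1⟩)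
      exact inter_subset_inter_right _ (sdiff_subset.trans hsub)
    obtain ⟨α₁, γ₁, k1, k2, k3⟩ := ih _ hlt h₂ hα₂ rfl
    exact ⟨α₁, γ₁, k1, k2.trans (hsub.trans sdiff_subset), k3⟩

lemma IsArc.infinite {A : Set (ℝ × ℝ)} (hA : IsArc A) : A.Infinite := by
  obtain ⟨φ⟩ := hA
  have : Infinite (Icc (0 : ℝ) 1) := (Icc_infinite zero_lt_one).to_subtype
  exact infinite_coe_iff.1 (Infinite.of_injective φ.symm φ.symm.injective)

lemma IsSidePair.exists_two_digons {β ρ S S' : Set (ℝ × ℝ)} (hS : IsSidePair β S S')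
    (hβ : IsSimpleClosedCurve β) (hρ : IsSimpleClosedCurve ρ) (hne : (β ∩ ρ).Nonempty)
    (hcr : ∀ z ∈ β ∩ ρ, IsCrossing β ρ z) :
    ∃ d₁ d₂ : Set (ℝ × ℝ) × Set (ℝ × ℝ), d₁ ≠ d₂ ∧
      IsDigon β ρ d₁.1 d₁.2 ∧ IsDigon β ρ d₂.1 d₂.2 ∧
      d₁.2 \ {a | IsEndpointOf a d₁.2} ⊆ S ∧
      d₂.2 \ {a | IsEndpointOf a d₂.2} ⊆ S := by
  obtain ⟨z, hz⟩ := hne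
  obtain ⟨b, hb, -⟩ := exists_isLoopParam hβ hz.1
  obtain ⟨r, hr, -⟩ := exists_isLoopParam hρ hz.2
  have hβc := hb.isCompact.isClosed
  have hfin := finite_inter_of_isCrossing (hb.isCompact.inter hr.isCompact) hcr
  obtain ⟨y, γ, γ', h⟩ := hS.exists_isChord hβc hρ hz (hcr z hz)
  obtain ⟨α, α', hα⟩ := exists_isSplit hβ h.left_mem h.right_mem h.split.ne
  obtain ⟨α₁, γ₁, k1, k2, k3⟩ := h.exists_digon hS hβc hρ hfin hcr hα
  obtain ⟨α₂, γ₂, l1, l2, l3⟩ := h.exists_digon hS hβc hρ hfin hcr hα.swap.reverse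
  refine ⟨(α₁, γ₁), (α₂, γ₂), fun heq => ?_, k1, l1, k3, l3⟩
  have heq : α₁ = α₂ := congrArg Prod.fst heq
  refine k1.1.infinite ((toFinite {z, y}).subset ?_)
  rw [← hα.inter_eq]
  exact subset_inter k2 (heq ▸ l2)

end

/-- If two non-disjoint simple closed curves intersect only in crossings, then there are at
least two distinct digons whose `ρ`-side (minus its endpoints) lies in the union `B` of the
bounded components of the complement of `β`, and at least two distinct digons whose
`ρ`-side (minus its endpoints) lies in the unbounded component `W`. -/
theorem two_inner_and_two_outer_digons
    (β ρ : Set (ℝ × ℝ))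
    (hβ : IsSimpleClosedCurve β) (hρ : IsSimpleClosedCurve ρ)
    (hne : (β ∩ ρ).Nonempty)
    (hcr : ∀ z ∈ β ∩ ρ, IsCrossing β ρ z)
    (B W : Set (ℝ × ℝ))
    (hB : B = {x : ℝ × ℝ | x ∈ βᶜ ∧ Bornology.IsBounded (connectedComponentIn βᶜ x)})
    (hW : W = {x : ℝ × ℝ | x ∈ βᶜ ∧ ¬ Bornology.IsBounded (connectedComponentIn βᶜ x)}) :
    (∃ d₁ d₂ : Set (ℝ × ℝ) × Set (ℝ × ℝ), d₁ ≠ d₂ ∧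
      IsDigon β ρ d₁.1 d₁.2 ∧ IsDigon β ρ d₂.1 d₂.2 ∧
      d₁.2 \ {a | IsEndpointOf a d₁.2} ⊆ B ∧
      d₂.2 \ {a | IsEndpointOf a d₂.2} ⊆ B) ∧
    (∃ d₁ d₂ : Set (ℝ × ℝ) × Set (ℝ × ℝ), d₁ ≠ d₂ ∧
      IsDigon β ρ d₁.1 d₁.2 ∧ IsDigon β ρ d₂.1 d₂.2 ∧
      d₁.2 \ {a | IsEndpointOf a d₁.2} ⊆ W ∧
      d₂.2 \ {a | IsEndpointOf a d₂.2} ⊆ W) := by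
  subst hB hW
  obtain ⟨z, hz⟩ := hne
  obtain ⟨e, he⟩ := (hcr z hz).exists_chart
  have hS := isSidePair_inner_outer hβ he.isOpenEmbedding he.mem_left
  exact ⟨hS.exists_two_digons hβ hρ ⟨z, hz⟩ hcr, hS.symm.exists_two_digons hβ hρ ⟨z, hz⟩ hcr⟩
end

section
/- Let β and ρ be simple closed curves in ℝ² that intersect in exactly ℓ ≥ 3 points. Suppose that exactly one point z of β ∩ ρ is a tangential intersection of β and ρ, and that every other point of β ∩ ρ is a crossing of β and ρ. Then there exists a digon (α, γ) of (β, ρ) such that α ∪ γ does not contain z. -/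
open Set Topology Filter

/-- A nowhere vanishing continuous function on a real normed space has a continuous logarithm. -/
theorem exists_continuous_log {E : Type*} [NormedAddCommGroup E] [NormedSpace ℝ E]
    {f : E → ℂ} (hf : Continuous f) (h0 : ∀ x, f x ≠ 0) :
    ∃ g : E → ℂ, Continuous g ∧ ∀ x, f x = Complex.exp (g x) := by
  have hU : IsSimplyConnected (univ : Set E) :=
    (Homeomorph.Set.univ E).toHomotopyEquiv.simplyConnectedSpace
  obtain ⟨g, hg, hge⟩ := Complex.exists_continuousOn_eqOn_exp_comp hU isOpen_univ hf.continuousOn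
    (by rintro ⟨x, -, hx⟩; exact h0 x hx)
  exact ⟨g, continuousOn_univ.1 hg, fun x => (hge (mem_univ x)).symm⟩

/-- Two continuous logarithms of the same function on a preconnected set differ by a constant. -/
theorem IsPreconnected.sub_eq_sub_of_exp_eq {X : Type*} [TopologicalSpace X] {s : Set X}
    (hs : IsPreconnected s) {f g : X → ℂ} (hf : ContinuousOn f s) (hg : ContinuousOn g s)
    (h : ∀ x ∈ s, Complex.exp (f x) = Complex.exp (g x)) {x y : X} (hx : x ∈ s) (hy : y ∈ s) :
    f x - g x = f y - g y := by
  have hd : IsDiscrete ((fun n : ℤ => (n : ℝ)) '' univ) :=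
    IsDiscrete.univ.image Int.isClosedEmbedding_coe_real.isEmbedding.isInducing
  have key : ∀ x ∈ s, ∃ n : ℤ, f x = g x + n * (2 * Real.pi * Complex.I) := fun x hx =>
    Complex.exp_eq_exp_iff_exists_int.1 (h x hx)
  have him : ∀ x ∈ s, ∃ n : ℤ, f x - g x = n * (2 * Real.pi * Complex.I) ∧
      (f x - g x).im / (2 * Real.pi) = n := by
    intro x hx
    obtain ⟨n, hn⟩ := key x hx
    refine ⟨n, by rw [hn]; ring, ?_⟩
    rw [hn]
    have : (2 * Real.pi) ≠ 0 := by positivity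
    simp only [add_sub_cancel_left]
    rw [div_eq_iff this]
    simp
  have hc : ContinuousOn (fun x => (f x - g x).im / (2 * Real.pi)) s := by
    exact (Complex.continuous_im.comp_continuousOn (hf.sub hg)).div_const _
  have := hs.constant_of_mapsTo hd hc (fun x hx => by
    obtain ⟨n, -, hn⟩ := him x hx
    exact ⟨n, mem_univ _, hn.symm⟩) hx hy
  obtain ⟨n, hn, hn'⟩ := him x hx
  obtain ⟨m, hm, hm'⟩ := him y hy
  simp only [hn', hm'] at this
  rw [hn, hm, Int.cast_injective this]

/-- The function `x ↦ x - p` has no continuous logarithm on a circle around the origin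
enclosing `p`. -/
theorem not_exists_log_on_sphere {p : ℂ} {R : ℝ} (hp : ‖p‖ < R) (g : ℂ → ℂ)
    (hg : ContinuousOn g (Metric.sphere 0 R)) :
    ¬ ∀ x ∈ Metric.sphere (0 : ℂ) R, x - p = Complex.exp (g x) := by
  intro h
  have hR : 0 < R := (norm_nonneg p).trans_lt hp
  let c : ℝ → ℂ := fun t => R * Complex.exp (t * Complex.I)
  have hc : Continuous c := by fun_prop
  have hcn : ∀ t, ‖c t‖ = R := fun t => by
    simp [c, Complex.norm_exp_ofReal_mul_I, abs_of_pos hR]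
  have hcs : ∀ t, c t ∈ Metric.sphere (0 : ℂ) R := fun t => by simp [hcn]
  have hc0 : ∀ t, c t ≠ 0 := fun t h => by
    have := hcn t
    rw [h, norm_zero] at this
    exact hR.ne this
  have hslit : ∀ t, 1 - p / c t ∈ Complex.slitPlane := fun t => by
    rw [sub_eq_add_neg]
    apply Complex.mem_slitPlane_of_norm_lt_one
    rw [norm_neg, norm_div, hcn, div_lt_one hR]
    exact hp
  let u : ℝ → ℂ := fun t => g (c t) - Complex.log (1 - p / c t)
  let v : ℝ → ℂ := fun t => Real.log R + t * Complex.I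
  have hu : Continuous u := by
    refine (hg.comp_continuous hc hcs).sub ?_
    exact Continuous.clog (by fun_prop (disch := exact hc0 _)) hslit
  have hv : Continuous v := by fun_prop
  have huv : ∀ t, Complex.exp (u t) = Complex.exp (v t) := fun t => by
    simp only [u, v]
    rw [Complex.exp_sub, ← h _ (hcs t), Complex.exp_log (Complex.slitPlane_ne_zero (hslit t)),
      Complex.exp_add, ← Complex.ofReal_exp, Real.exp_log hR]
    have h1 : 1 - p / c t ≠ 0 := Complex.slitPlane_ne_zero (hslit t)
    have h2 := hc0 t
    rw [div_eq_iff h1]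
    change c t - p = c t * _
    field_simp
  have := isPreconnected_univ.sub_eq_sub_of_exp_eq hu.continuousOn hv.continuousOn
    (fun t _ => huv t) (mem_univ 0) (mem_univ (2 * Real.pi))
  have hcc : c (2 * Real.pi) = c 0 := by simp [c]
  simp only [u, v, hcc] at this
  have h3 : ((2 * Real.pi : ℝ) : ℂ) * Complex.I = 0 := by
    simp at this ⊢
  simp [Real.pi_ne_zero] at h3

/-- The function `x ↦ (x - p) / (x - q)` has a continuous logarithm on `X`. -/
def LogEquiv (X : Set ℂ) (p q : ℂ) : Prop :=
  ∃ g : ℂ → ℂ, ContinuousOn g X ∧ ∀ x ∈ X, x - p = Complex.exp (g x) * (x - q)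

theorem LogEquiv.mono {X Y : Set ℂ} {p q : ℂ} (h : LogEquiv Y p q) (hXY : X ⊆ Y) :
    LogEquiv X p q := by
  obtain ⟨g, hg, h⟩ := h
  exact ⟨g, hg.mono hXY, fun x hx => h x (hXY hx)⟩

theorem LogEquiv.symm {X : Set ℂ} {p q : ℂ} (h : LogEquiv X p q) : LogEquiv X q p := by
  obtain ⟨g, hg, h⟩ := h
  refine ⟨fun x => - g x, hg.neg, fun x hx => ?_⟩
  rw [h x hx, ← mul_assoc, ← Complex.exp_add]
  simp

theorem LogEquiv.trans {X : Set ℂ} {p q r : ℂ} (h : LogEquiv X p q) (h' : LogEquiv X q r) :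
    LogEquiv X p r := by
  obtain ⟨g, hg, h⟩ := h
  obtain ⟨g', hg', h'⟩ := h'
  refine ⟨fun x => g x + g' x, hg.add hg', fun x hx => ?_⟩
  rw [h x hx, h' x hx, Complex.exp_add, mul_assoc]

/-- Points of a preconnected set missing the closed set `X` are equivalent. -/
theorem LogEquiv.of_isPreconnected {X K : Set ℂ} (hX : IsClosed X) (hK : IsPreconnected K)
    (hKX : Disjoint K X) {p q : ℂ} (hp : p ∈ K) (hq : q ∈ K) : LogEquiv X p q := by
  refine hK.induction₂ (LogEquiv X) ?_ (fun _ _ _ _ _ _ => LogEquiv.trans)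
    (fun _ _ _ _ => LogEquiv.symm) hp hq
  intro x hx
  have hxX : x ∉ X := disjoint_left.1 hKX hx
  obtain ⟨δ, hδ, hball⟩ := Metric.isOpen_iff.1 hX.isOpen_compl x hxX
  filter_upwards [mem_nhdsWithin_of_mem_nhds (Metric.ball_mem_nhds x hδ)] with y hy
  refine LogEquiv.symm ⟨fun t => Complex.log ((t - y) / (t - x)), ?_, ?_⟩
  · have h0 : ∀ t ∈ X, t - x ≠ 0 := fun t ht h => hxX (sub_eq_zero.1 h ▸ ht)
    refine ContinuousOn.clog (by fun_prop (disch := exact h0)) fun t ht => ?_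
    have h1 : (t - y) / (t - x) = 1 + (x - y) / (t - x) := by
      have := h0 t ht
      field_simp
      ring
    rw [h1]
    apply Complex.mem_slitPlane_of_norm_lt_one
    have h2 : δ ≤ ‖t - x‖ := by
      by_contra! h
      exact hball (by rwa [Metric.mem_ball, dist_eq_norm]) ht
    rw [norm_div, div_lt_one (hδ.trans_le h2)]
    rw [Metric.mem_ball, dist_comm, dist_eq_norm] at hy
    exact hy.trans_le h2
  · intro t ht
    have h0 : t - x ≠ 0 := fun h => hxX (sub_eq_zero.1 h ▸ ht)
    have h1 : t - y ≠ 0 := fun h => hball hy (sub_eq_zero.1 h ▸ ht)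
    rw [Complex.exp_log (div_ne_zero h1 h0), div_mul_cancel₀ _ h0]

/-- Janiszewski's theorem: if `A ∩ B` is connected and neither `A` nor `B` separates `p` from `q`,
then `A ∪ B` does not separate them either. -/
theorem LogEquiv.union {A B : Set ℂ} (hA : IsClosed A) (hB : IsClosed B)
    (hAB : IsPreconnected (A ∩ B)) {p q : ℂ} (hq : q ∉ A) (h : LogEquiv A p q)
    (h' : LogEquiv B p q) : LogEquiv (A ∪ B) p q := by
  classical
  obtain ⟨f, hf, h⟩ := h
  obtain ⟨g, hg, h'⟩ := h'
  have hexp : ∀ x ∈ A ∩ B, Complex.exp (f x) = Complex.exp (g x) := fun x hx => by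
    have h0 : x - q ≠ 0 := fun h => hq (sub_eq_zero.1 h ▸ hx.1)
    exact mul_right_cancel₀ h0 ((h x hx.1).symm.trans (h' x hx.2))
  obtain ⟨c, hc, hfg⟩ : ∃ c : ℂ, Complex.exp c = 1 ∧ ∀ x ∈ A ∩ B, f x = g x + c := by
    rcases (A ∩ B).eq_empty_or_nonempty with he | ⟨y, hy⟩
    · exact ⟨0, Complex.exp_zero, by simp [he]⟩
    · refine ⟨f y - g y, ?_, fun x hx => ?_⟩
      · rw [Complex.exp_sub, hexp y hy, div_self (Complex.exp_ne_zero _)]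
      · rw [← hAB.sub_eq_sub_of_exp_eq (hf.mono inter_subset_left) (hg.mono inter_subset_right)
          hexp hx hy]
        ring
  have hBeq : ∀ x ∈ B, (if x ∈ A then f x else g x + c) = g x + c := fun x hx => by
    split_ifs with hxA
    · exact hfg x ⟨hxA, hx⟩
    · rfl
  refine ⟨fun x => if x ∈ A then f x else g x + c, ?_, ?_⟩
  · refine ContinuousOn.union_of_isClosed ?_ ?_ hA hB
    · exact hf.congr fun x hx => if_pos hx
    · exact (hg.add continuousOn_const).congr hBeq
  · rintro x (hx | hx)
    · simp only [if_pos hx, h x hx]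
    · simp only [hBeq x hx, h' x hx, Complex.exp_add, hc, mul_one]

/-- If the boundary of an open set `V` is contained in the compact set `X`, then a point of `V`
is not equivalent to a point outside of `V`. -/
theorem not_logEquiv_of_frontier_subset {X V : Set ℂ} (hX : IsCompact X) (hV : IsOpen V)
    (hVX : frontier V ⊆ X) {p q : ℂ} (hp : p ∈ V) (hq : q ∉ V) :
    ¬ LogEquiv X p q := by
  classical
  rintro ⟨g, hg, h⟩
  obtain ⟨G, hG⟩ := ContinuousMap.exists_restrict_eq hX.isClosed
    ⟨X.domRestrict g, hg.domRestrict⟩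
  have hGg : ∀ x ∈ X, G x = g x := fun x hx => DFunLike.congr_fun hG ⟨x, hx⟩
  have hcl : ∀ x ∈ closure V, x ∉ V → x ∈ X := fun x hx hxV =>
    hVX ⟨hx, by rwa [hV.interior_eq]⟩
  let F : ℂ → ℂ := fun x => if x ∈ V then Complex.exp (G x) * (x - q) else x - p
  have hF : Continuous F := by
    refine continuous_if (fun x hx => ?_) ?_ (by fun_prop)
    · have := hVX hx
      rw [hGg x this, h x this]
    · fun_prop
  have hF0 : ∀ x, F x ≠ 0 := fun x => by
    simp only [F]
    split_ifs with hx
    · exact mul_ne_zero (Complex.exp_ne_zero _) (sub_ne_zero.2 fun e => hq (e ▸ hx))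
    · exact sub_ne_zero.2 fun e => hx (e ▸ hp)
  obtain ⟨H, hH, hFH⟩ := exists_continuous_log hF hF0
  obtain ⟨R, hR⟩ := ((hX.isBounded.union (Bornology.isBounded_singleton (x := p))).union
    (Bornology.isBounded_singleton (x := q))).subset_ball_lt 0 0 |>.imp fun _ h => h.2
  have hpR : ‖p‖ < R := by simpa using hR (show p ∈ _ by simp)
  have hqR : ‖q‖ < R := by simpa using hR (show q ∈ _ by simp)
  have hS : Disjoint (Metric.sphere (0 : ℂ) R) X := by
    rw [disjoint_left]
    intro x hx hxX
    have := hR (Or.inl (Or.inl hxX))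
    simp at this hx
    exact this.ne hx
  have hconn : IsPreconnected (Metric.sphere (0 : ℂ) R) := isPreconnected_sphere (by simp) 0 R
  by_cases hne : (Metric.sphere (0 : ℂ) R ∩ V).Nonempty
  · have hsub : Metric.sphere (0 : ℂ) R ⊆ V := by
      refine hconn.subset_left_of_subset_union hV isClosed_closure.isOpen_compl
        (disjoint_left.2 fun x hx hx' => hx' (subset_closure hx)) (fun x hx => ?_) hne
      by_cases hxV : x ∈ V
      · exact Or.inl hxV
      · exact Or.inr fun hxc => disjoint_left.1 hS hx (hcl x hxc hxV)
    refine not_exists_log_on_sphere hqR (fun x => H x - G x) (by fun_prop) fun x hx => ?_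
    rw [Complex.exp_sub, ← hFH x]
    simp only [F, if_pos (hsub hx)]
    field_simp
  · refine not_exists_log_on_sphere hpR H (by fun_prop) fun x hx => ?_
    rw [← hFH x]
    simp only [F, if_neg fun hxV => hne ⟨x, hx, hxV⟩]

/-- The two sides of a compact set `J` in a chart flattening `J` are not equivalent, provided that
the part of `J` outside of the chart is connected. -/
theorem not_logEquiv_of_flat {J : Set ℂ} (hJ : IsCompact J) {g : ℝ × ℝ → ℂ}
    (hg : IsOpenEmbedding g) (hgJ : ∀ p, ‖p‖ ≤ 1 → (g p ∈ J ↔ p.2 = 0))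
    (hA : IsPreconnected (J \ g '' Metric.ball 0 1)) :
    ¬ LogEquiv J (g (0, 1 / 2)) (g (0, -(1 / 2))) := by
  intro hlog
  have hp1 : ‖((0 : ℝ), (1 / 2 : ℝ))‖ = 1 / 2 := by
    rw [Prod.norm_mk, norm_zero, Real.norm_of_nonneg] <;> norm_num
  have hp2 : ‖((0 : ℝ), -(1 / 2 : ℝ))‖ = 1 / 2 := by
    rw [Prod.norm_mk, norm_zero, norm_neg, Real.norm_of_nonneg] <;> norm_num
  have hBo : IsOpen (g '' Metric.ball 0 1) := hg.isOpenMap _ Metric.isOpen_ball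
  have hAc : IsCompact (J \ g '' Metric.ball 0 1) := hJ.diff hBo
  have hup : IsClosed {p : ℝ × ℝ | 0 ≤ p.2} := isClosed_le continuous_const continuous_snd
  have hT : IsCompact (g '' (Metric.sphere 0 1 ∩ {p : ℝ × ℝ | 0 ≤ p.2})) :=
    ((isCompact_sphere 0 1).inter_right hup).image hg.continuous
  set A := J \ g '' Metric.ball 0 1 with hAdef
  set T := g '' (Metric.sphere 0 1 ∩ {p : ℝ × ℝ | 0 ≤ p.2}) with hTdef
  have hTB : Disjoint (g '' Metric.ball 0 1) T := by
    rw [hTdef, disjoint_image_iff hg.injective]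
    exact (Metric.sphere_disjoint_ball.mono_left inter_subset_left).symm
  have hAT : LogEquiv (A ∪ T) (g (0, 1 / 2)) (g (0, -(1 / 2))) := by
    refine LogEquiv.of_isPreconnected (K := g '' Metric.ball 0 1)
      (hAc.isClosed.union hT.isClosed)
      ((convex_ball _ _).isPreconnected.image _ hg.continuous.continuousOn)
      (disjoint_union_right.2 ⟨disjoint_sdiff_right, hTB⟩) ?_ ?_
    · exact mem_image_of_mem _ (by rw [mem_ball_zero_iff, hp1]; norm_num)
    · exact mem_image_of_mem _ (by rw [mem_ball_zero_iff, hp2]; norm_num)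
  have hJA : J ∩ (A ∪ T) = A := by
    refine Subset.antisymm ?_ fun x hx => ⟨hx.1, Or.inl hx⟩
    rintro x ⟨hxJ, hx | hx⟩
    · exact hx
    · exact ⟨hxJ, fun h => disjoint_left.1 hTB h hx⟩
  have hq : g (0, -(1 / 2)) ∉ J := by
    rw [hgJ _ (by rw [hp2]; norm_num)]
    norm_num
  have hunion : LogEquiv (J ∪ T) (g (0, 1 / 2)) (g (0, -(1 / 2))) :=
    (LogEquiv.union hJ.isClosed (hAc.isClosed.union hT.isClosed) (hJA.symm ▸ hA :) hq hlog hAT).mono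
      (union_subset_union_right _ subset_union_right)
  refine not_logEquiv_of_frontier_subset (hJ.union hT)
    (V := g '' (Metric.ball 0 1 ∩ {p : ℝ × ℝ | 0 < p.2})) ?_ ?_ ?_ ?_ hunion
  · exact hg.isOpenMap _ (Metric.isOpen_ball.inter (isOpen_lt continuous_const continuous_snd))
  · rintro x ⟨hxc, hxi⟩
    have h1 : g '' (Metric.ball 0 1 ∩ {p : ℝ × ℝ | 0 < p.2}) ⊆
        g '' (Metric.closedBall 0 1 ∩ {p : ℝ × ℝ | 0 ≤ p.2}) :=
      image_mono (inter_subset_inter Metric.ball_subset_closedBall fun p (hp : 0 < p.2) => hp.le)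
    obtain ⟨p, ⟨hp1, hp2⟩, rfl⟩ := closure_minimal h1
      (((isCompact_closedBall 0 1).inter_right hup).image hg.continuous).isClosed hxc
    rw [mem_closedBall_zero_iff] at hp1
    by_cases hp0 : p.2 = 0
    · exact Or.inl ((hgJ p hp1).2 hp0)
    · refine Or.inr (mem_image_of_mem _ ⟨?_, hp2⟩)
      by_contra hps
      rw [mem_sphere_zero_iff_norm] at hps
      refine hxi ?_
      rw [(hg.isOpenMap _ (Metric.isOpen_ball.inter
        (isOpen_lt continuous_const continuous_snd))).interior_eq]
      exact mem_image_of_mem _ ⟨mem_ball_zero_iff.2 (lt_of_le_of_ne hp1 hps),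
        lt_of_le_of_ne hp2 (Ne.symm hp0)⟩
  · exact mem_image_of_mem _ ⟨by rw [mem_ball_zero_iff, hp1]; norm_num, by simp⟩
  · rintro ⟨p, ⟨-, hp⟩, he⟩
    have := hg.injective he
    subst this
    norm_num at hp

/-- If the part of `J` outside of a chart flattening `J` does not separate the plane, then the chart
meets every component of the complement of `J`. -/
theorem connectedComponentIn_inter_chart_nonempty {J : Set ℂ} (hJ : IsCompact J)
    {g : ℝ × ℝ → ℂ} (hg : IsOpenEmbedding g) (hg0 : g 0 ∈ J) {r : ℂ} (hr : r ∉ J)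
    (hA : LogEquiv (J \ g '' Metric.ball 0 1) r (g 0)) :
    (connectedComponentIn Jᶜ r ∩ g '' Metric.ball 0 1).Nonempty := by
  by_contra hne
  have hBo : IsOpen (g '' Metric.ball 0 1) := hg.isOpenMap _ Metric.isOpen_ball
  have hVo : IsOpen (connectedComponentIn Jᶜ r) := hJ.isClosed.isOpen_compl.connectedComponentIn
  refine not_logEquiv_of_frontier_subset (hJ.diff hBo) hVo ?_ (mem_connectedComponentIn hr) ?_ hA
  · rintro x ⟨hxc, hxi⟩
    rw [hVo.interior_eq] at hxi
    refine ⟨?_, fun hx => ?_⟩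
    · by_contra hxJ
      obtain ⟨y, hy, hy'⟩ := mem_closure_iff.1 hxc _
        (hJ.isClosed.isOpen_compl.connectedComponentIn (x := x)) (mem_connectedComponentIn hxJ)
      rw [connectedComponentIn_eq hy', ← connectedComponentIn_eq hy] at hxi
      exact hxi (mem_connectedComponentIn hxJ)
    · obtain ⟨y, hy, hy'⟩ := mem_closure_iff.1 hxc _ hBo hx
      exact hne ⟨y, hy', hy⟩
  · exact fun h => connectedComponentIn_subset _ _ h hg0

/-- The inverse of a continuous map on a compact set is continuous on the image of any saturated
subset on which the map is injective. -/
theorem IsCompact.exists_continuousOn_leftInverse {X Y : Type*} [TopologicalSpace X]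
    [TopologicalSpace Y] [T2Space Y] [Nonempty X] {b : X → Y} {K U : Set X} (hK : IsCompact K)
    (hb : ContinuousOn b K) (hUK : U ⊆ K) (hinj : ∀ x ∈ U, ∀ y ∈ K, b x = b y → x = y) :
    ∃ θ : Y → X, ContinuousOn θ (b '' U) ∧ ∀ x ∈ U, θ (b x) = x := by
  have hθ : ∀ x ∈ U, Function.invFunOn b K (b x) = x := fun x hx =>
    (hinj x hx _ (Function.invFunOn_mem ⟨x, hUK hx, rfl⟩)
      (Function.invFunOn_eq ⟨x, hUK hx, rfl⟩).symm).symm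
  refine ⟨Function.invFunOn b K, ?_, hθ⟩
  rintro _ ⟨x, hx, rfl⟩ W hW
  rw [hθ x hx] at hW
  obtain ⟨W', hW'W, hW'o, hxW'⟩ := mem_nhds_iff.1 hW
  have hcl : IsClosed (b '' (K \ W')) :=
    ((hK.diff hW'o).image_of_continuousOn (hb.mono sdiff_subset)).isClosed
  have hnot : b x ∉ b '' (K \ W') := by
    rintro ⟨y, hy, hyx⟩
    exact hy.2 (hinj x hx y hy.1 hyx.symm ▸ hxW')
  rw [mem_map]
  filter_upwards [mem_nhdsWithin_of_mem_nhds (hcl.isOpen_compl.mem_nhds hnot),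
    self_mem_nhdsWithin]
  rintro _ hy ⟨y, hyU, rfl⟩
  rw [mem_preimage, hθ y hyU]
  by_contra h
  exact hy (mem_image_of_mem _ ⟨hUK hyU, fun h' => h (hW'W h')⟩)

/-- An arc does not separate the plane. -/
theorem logEquiv_arc {b : ℝ → ℂ} (hb : Continuous b) {c d : ℝ} (hcd : c ≤ d)
    (hinj : InjOn b (Icc c d)) {p q : ℂ} (hp : p ∉ b '' Icc c d) (hq : q ∉ b '' Icc c d) :
    LogEquiv (b '' Icc c d) p q := by
  obtain ⟨θ, hθ, hθb⟩ := isCompact_Icc.exists_continuousOn_leftInverse hb.continuousOn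
    (Subset.refl (Icc c d)) fun x hx y hy h => hinj hx hy h
  have hmem : ∀ t, b (projIcc c d hcd t) ∈ b '' Icc c d := fun t =>
    mem_image_of_mem _ (projIcc c d hcd t).2
  have h0 : ∀ a, a ∉ b '' Icc c d → ∀ t, b (projIcc c d hcd t) - a ≠ 0 := fun a ha t h =>
    ha (sub_eq_zero.1 h ▸ hmem t)
  have hc : Continuous fun t => b (projIcc c d hcd t) :=
    hb.comp (continuous_subtype_val.comp continuous_projIcc)
  obtain ⟨G, hG, hGe⟩ := exists_continuous_log
    (f := fun t => (b (projIcc c d hcd t) - p) / (b (projIcc c d hcd t) - q))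
    ((hc.sub continuous_const).div (hc.sub continuous_const) (h0 q hq))
    (fun t => div_ne_zero (h0 p hp t) (h0 q hq t))
  refine ⟨fun x => G (θ x), hG.comp_continuousOn hθ, ?_⟩
  rintro _ ⟨t, ht, rfl⟩
  have := hGe t
  simp only [projIcc_of_mem hcd ht] at this
  have hq0 := h0 q hq t
  rw [projIcc_of_mem hcd ht] at hq0
  simp only [hθb t ht]
  rw [← this, div_mul_cancel₀ _ hq0]

/-- `b` parametrizes the simple closed curve `β` on `[0, 1]`, starting and ending at `z`. -/
structure IsLoopParam_s8 (b : ℝ → ℂ) (β : Set ℂ) (z : ℂ) : Prop where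
  continuous : Continuous b
  injOn : InjOn b (Ico 0 1)
  zero : b 0 = z
  one : b 1 = z
  image : b '' Icc 0 1 = β

namespace IsLoopParam_s8

variable {b : ℝ → ℂ} {β : Set ℂ} {z : ℂ}

theorem isCompact_s8 (hb : IsLoopParam_s8 b β z) : IsCompact β :=
  hb.image ▸ isCompact_Icc.image hb.continuous

theorem mem_s8 (hb : IsLoopParam_s8 b β z) {t : ℝ} (ht : t ∈ Icc (0 : ℝ) 1) : b t ∈ β :=
  hb.image ▸ mem_image_of_mem b ht

theorem eq_of_eq (hb : IsLoopParam_s8 b β z) {s t : ℝ} (hs : s ∈ Ioo (0 : ℝ) 1)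
    (ht : t ∈ Icc (0 : ℝ) 1) (h : b s = b t) : s = t := by
  have hs' : s ∈ Ico (0 : ℝ) 1 := ⟨hs.1.le, hs.2⟩
  rcases ht.2.eq_or_lt with rfl | ht1
  · have := hb.injOn hs' (show (0 : ℝ) ∈ Ico (0 : ℝ) 1 from ⟨le_rfl, one_pos⟩)
      (h.trans (hb.one.trans hb.zero.symm))
    exact absurd this hs.1.ne'
  · exact hb.injOn hs' (show t ∈ Ico (0 : ℝ) 1 from ⟨ht.1, ht1⟩) h

theorem ne_base (hb : IsLoopParam_s8 b β z) {t : ℝ} (ht : t ∈ Ioo (0 : ℝ) 1) : b t ≠ z := fun h =>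
  ht.1.ne' (hb.eq_of_eq ht ⟨le_rfl, zero_le_one⟩ (h.trans hb.zero.symm))

theorem exists_eq (hb : IsLoopParam_s8 b β z) {x : ℂ} (hx : x ∈ β) (hxz : x ≠ z) :
    ∃ t ∈ Ioo (0 : ℝ) 1, b t = x := by
  rw [← hb.image] at hx
  obtain ⟨t, ht, rfl⟩ := hx
  refine ⟨t, ⟨lt_of_le_of_ne ht.1 ?_, lt_of_le_of_ne ht.2 ?_⟩, rfl⟩
  · rintro rfl
    exact hxz hb.zero
  · rintro rfl
    exact hxz hb.one

theorem image_Ioo (hb : IsLoopParam_s8 b β z) : b '' Ioo 0 1 = β \ {z} := by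
  ext x
  constructor
  · rintro ⟨t, ht, rfl⟩
    exact ⟨hb.mem_s8 (Ioo_subset_Icc_self ht), hb.ne_base ht⟩
  · rintro ⟨hx, hxz⟩
    obtain ⟨t, ht, rfl⟩ := hb.exists_eq hx hxz
    exact ⟨t, ht, rfl⟩

theorem injOn_Icc_left (hb : IsLoopParam_s8 b β z) {c : ℝ} (hc : c < 1) : InjOn b (Icc 0 c) :=
  hb.injOn.mono (Icc_subset_Ico_right hc)

theorem reverse_s8 (hb : IsLoopParam_s8 b β z) : IsLoopParam_s8 (fun t => b (1 - t)) β z where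
  continuous := hb.continuous.comp (continuous_const.sub continuous_id)
  injOn := by
    intro s hs t ht h
    rcases hs.1.eq_or_lt with rfl | hs0
    · rcases ht.1.eq_or_lt with rfl | ht0
      · rfl
      · have := hb.eq_of_eq (s := 1 - t) (t := 1 - 0) ⟨by linarith [ht.2], by linarith⟩
          ⟨by norm_num, by norm_num⟩ h.symm
        linarith
    · have := hb.eq_of_eq (s := 1 - s) (t := 1 - t) ⟨by linarith [hs.2], by linarith⟩
        ⟨by linarith [ht.2], by linarith [ht.1]⟩ h
      linarith
  zero := by simpa using hb.one
  one := by simpa using hb.zero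
  image := by
    rw [← hb.image]
    ext x
    constructor
    · rintro ⟨t, ht, rfl⟩
      exact ⟨1 - t, ⟨by linarith [ht.2], by linarith [ht.1]⟩, rfl⟩
    · rintro ⟨t, ht, rfl⟩
      exact ⟨1 - t, ⟨by linarith [ht.2], by linarith [ht.1]⟩, by simp⟩

theorem injOn_Icc_right (hb : IsLoopParam_s8 b β z) {d : ℝ} (hd : 0 < d) : InjOn b (Icc d 1) := by
  intro s hs t ht h
  have := hb.reverse_s8.injOn_Icc_left (c := 1 - d) (by linarith)
    (show 1 - s ∈ Icc 0 (1 - d) from ⟨by linarith [hs.2], by linarith [hs.1]⟩)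
    (show 1 - t ∈ Icc 0 (1 - d) from ⟨by linarith [ht.2], by linarith [ht.1]⟩) (by simp [h])
  linarith

theorem exists_time (hb : IsLoopParam_s8 b β z) :
    ∃ θ : ℂ → ℝ, ContinuousOn θ (β \ {z}) ∧ ∀ t ∈ Ioo (0 : ℝ) 1, θ (b t) = t := by
  rw [← hb.image_Ioo]
  exact isCompact_Icc.exists_continuousOn_leftInverse hb.continuous.continuousOn
    Ioo_subset_Icc_self fun x hx y hy h => hb.eq_of_eq hx hy h

end IsLoopParam_s8

/-- `g` is a chart around `w` carrying the horizontal axis to `β` and the vertical axis to `ρ`. -/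
structure IsCrossChart_s8 (β ρ : Set ℂ) (w : ℂ) (g : ℝ × ℝ → ℂ) : Prop where
  isOpenEmbedding : IsOpenEmbedding g
  map_zero : g 0 = w
  mem_left : ∀ p, g p ∈ β ↔ p.2 = 0
  mem_right : ∀ p, g p ∈ ρ ↔ p.1 = 0

namespace IsCrossChart_s8

variable {β ρ : Set ℂ} {w : ℂ} {g : ℝ × ℝ → ℂ}

theorem flip_s8 (hg : IsCrossChart_s8 β ρ w g) : IsCrossChart_s8 β ρ w fun p => g (p.1, -p.2) where
  isOpenEmbedding := hg.isOpenEmbedding.comp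
    ((Homeomorph.refl ℝ).prodCongr (Homeomorph.neg ℝ)).isOpenEmbedding
  map_zero := by
    rw [← hg.map_zero]
    simp [Prod.zero_eq_mk]
  mem_left p := by simp [hg.mem_left]
  mem_right p := by simp [hg.mem_right]

theorem exists_shrink (hg : IsCrossChart_s8 β ρ w g) {N : Set ℂ} (hN : N ∈ 𝓝 w) :
    ∃ g', IsCrossChart_s8 β ρ w g' ∧ g' '' Metric.closedBall 0 1 ⊆ N := by
  have hpre : g ⁻¹' N ∈ 𝓝 (0 : ℝ × ℝ) :=
    hg.isOpenEmbedding.continuous.continuousAt (by rwa [hg.map_zero])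
  obtain ⟨ε, hε, hεN⟩ := Metric.nhds_basis_closedBall.mem_iff.1 hpre
  refine ⟨fun p => g (ε • p), ⟨?_, ?_, ?_, ?_⟩, ?_⟩
  · exact hg.isOpenEmbedding.comp (Homeomorph.smulOfNeZero ε hε.ne').isOpenEmbedding
  · simpa using hg.map_zero
  · simp [hg.mem_left, hε.ne']
  · simp [hg.mem_right, hε.ne']
  · rintro _ ⟨p, hp, rfl⟩
    refine hεN ?_
    rw [mem_closedBall_zero_iff] at hp ⊢
    rw [norm_smul, Real.norm_of_nonneg hε.le]
    nlinarith

theorem isPreconnected_inter (hg : IsCrossChart_s8 β ρ w g) :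
    IsPreconnected (β ∩ g '' Metric.ball 0 1) := by
  have : β ∩ g '' Metric.ball 0 1 = g '' (Metric.ball 0 1 ∩ {p | p.2 = 0}) := by
    ext x
    constructor
    · rintro ⟨hx, p, hp, rfl⟩
      exact ⟨p, ⟨hp, (hg.mem_left p).1 hx⟩, rfl⟩
    · rintro ⟨p, ⟨hp, hp0⟩, rfl⟩
      exact ⟨(hg.mem_left p).2 hp0, p, hp, rfl⟩
  rw [this]
  refine (Convex.isPreconnected ((convex_ball _ _).inter ?_)).image _
    hg.isOpenEmbedding.continuous.continuousOn
  exact convex_hyperplane (LinearMap.snd ℝ ℝ ℝ).isLinear 0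

end IsCrossChart_s8

theorem isPreconnected_upper_half_ball :
    IsPreconnected (Metric.ball (0 : ℝ × ℝ) 1 ∩ {p | 0 < p.2}) :=
  ((convex_ball _ _).inter
    (convex_halfSpace_gt (LinearMap.snd ℝ ℝ ℝ).isLinear 0)).isPreconnected

theorem isPreconnected_lower_half_ball :
    IsPreconnected (Metric.ball (0 : ℝ × ℝ) 1 ∩ {p | p.2 < 0}) :=
  ((convex_ball _ _).inter
    (convex_halfSpace_lt (LinearMap.snd ℝ ℝ ℝ).isLinear 0)).isPreconnected

theorem zero_half_mem : ((0 : ℝ), (1 / 2 : ℝ)) ∈ Metric.ball (0 : ℝ × ℝ) 1 ∩ {p | 0 < p.2} := by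
  refine ⟨?_, by simp⟩
  rw [mem_ball_zero_iff, Prod.norm_mk, norm_zero, Real.norm_of_nonneg] <;> norm_num

theorem zero_neg_half_mem :
    ((0 : ℝ), (-(1 / 2) : ℝ)) ∈ Metric.ball (0 : ℝ × ℝ) 1 ∩ {p | p.2 < 0} := by
  refine ⟨?_, by simp⟩
  rw [mem_ball_zero_iff, Prod.norm_mk, norm_zero, norm_neg, Real.norm_of_nonneg] <;> norm_num

/-- Removing a small chart around an interior point of an arc of `β` from a closed curve made of
this arc and a connected set leaves a connected set. -/
theorem IsCrossChart_s8.isPreconnected_sdiff {β ρ : Set ℂ} {b : ℝ → ℂ} {z : ℂ}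
    (hb : IsLoopParam_s8 b β z) {g : ℝ × ℝ → ℂ} {s t τ : ℝ}
    (hg : IsCrossChart_s8 β ρ (b τ) g) (hs : 0 ≤ s) (hsτ : s < τ) (hτt : τ < t) (ht : t ≤ 1)
    {K : Set ℂ} (hK : IsPreconnected K) (hsK : b s ∈ K) (htK : b t ∈ K)
    (hKg : Disjoint K (g '' Metric.ball 0 1)) (hzg : z ∉ g '' Metric.ball 0 1) :
    IsPreconnected ((b '' Icc s t ∪ K) \ g '' Metric.ball 0 1) := by
  obtain ⟨θ, hθ, hθb⟩ := hb.exists_time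
  set B := g '' Metric.ball 0 1 with hB
  have hI : IsPreconnected (θ '' (β ∩ B)) :=
    hg.isPreconnected_inter.image _ (hθ.mono fun x hx => ⟨hx.1, fun h => hzg (h ▸ hx.2)⟩)
  have hIoc : OrdConnected (θ '' (β ∩ B)) := hI.ordConnected
  have hmemI : ∀ x ∈ Icc s t, (b x ∈ B ↔ x ∈ θ '' (β ∩ B)) := by
    intro x hx
    constructor
    · intro h
      have hxβ : b x ∈ β := hb.mem_s8 ⟨hs.trans hx.1, hx.2.trans ht⟩
      refine ⟨b x, ⟨hxβ, h⟩, hθb x ?_⟩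
      refine ⟨lt_of_le_of_ne (hs.trans hx.1) ?_, lt_of_le_of_ne (hx.2.trans ht) ?_⟩
      · rintro rfl
        exact hzg (hb.zero ▸ h)
      · rintro rfl
        exact hzg (hb.one ▸ h)
    · rintro ⟨y, ⟨hyβ, hyB⟩, rfl⟩
      obtain ⟨v, hv, rfl⟩ := hb.exists_eq hyβ fun h => hzg (h ▸ hyB)
      rwa [hθb v hv]
  have hτI : τ ∈ θ '' (β ∩ B) := by
    rw [← hmemI τ ⟨hsτ.le, hτt.le⟩, ← hg.map_zero]
    exact mem_image_of_mem _ (Metric.mem_ball_self one_pos)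
  have hleft : IsPreconnected (b '' {x | x ∈ Icc s t ∧ x < τ ∧ x ∉ θ '' (β ∩ B)}) := by
    refine IsPreconnected.image (OrdConnected.isPreconnected ⟨?_⟩) _ hb.continuous.continuousOn
    rintro x ⟨hx, hxτ, hxI⟩ y ⟨hy, hyτ, hyI⟩ v hv
    exact ⟨⟨hx.1.trans hv.1, hv.2.trans hy.2⟩, hv.2.trans_lt hyτ,
      fun h => hyI (hIoc.out h hτI ⟨hv.2, hyτ.le⟩)⟩
  have hright : IsPreconnected (b '' {x | x ∈ Icc s t ∧ τ < x ∧ x ∉ θ '' (β ∩ B)}) := by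
    refine IsPreconnected.image (OrdConnected.isPreconnected ⟨?_⟩) _ hb.continuous.continuousOn
    rintro x ⟨hx, hxτ, hxI⟩ y ⟨hy, hyτ, hyI⟩ v hv
    exact ⟨⟨hx.1.trans hv.1, hv.2.trans hy.2⟩, hxτ.trans_le hv.1,
      fun h => hxI (hIoc.out hτI h ⟨hxτ.le, hv.1⟩)⟩
  have hsI : s ∉ θ '' (β ∩ B) := by
    rw [← hmemI s ⟨le_rfl, (hsτ.trans hτt).le⟩]
    exact disjoint_left.1 hKg hsK
  have htI : t ∉ θ '' (β ∩ B) := by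
    rw [← hmemI t ⟨(hsτ.trans hτt).le, le_rfl⟩]
    exact disjoint_left.1 hKg htK
  have hsl : b s ∈ b '' {x | x ∈ Icc s t ∧ x < τ ∧ x ∉ θ '' (β ∩ B)} :=
    ⟨s, ⟨⟨le_rfl, (hsτ.trans hτt).le⟩, hsτ, hsI⟩, rfl⟩
  have htr : b t ∈ b '' {x | x ∈ Icc s t ∧ τ < x ∧ x ∉ θ '' (β ∩ B)} :=
    ⟨t, ⟨⟨(hsτ.trans hτt).le, le_rfl⟩, hτt, htI⟩, rfl⟩
  have hfin := (hleft.union (b s) hsl hsK hK).union (b t) (Or.inr htK) htr hright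
  convert hfin using 1
  ext x
  constructor
  · rintro ⟨⟨v, hv, rfl⟩ | hx, hxB⟩
    · rw [hmemI v hv] at hxB
      rcases lt_trichotomy v τ with h | rfl | h
      · exact Or.inl (Or.inl ⟨v, ⟨hv, h, hxB⟩, rfl⟩)
      · exact absurd hτI hxB
      · exact Or.inr ⟨v, ⟨hv, h, hxB⟩, rfl⟩
    · exact Or.inl (Or.inr hx)
  · rintro ((⟨v, ⟨hv, -, hvI⟩, rfl⟩ | hx) | ⟨v, ⟨hv, -, hvI⟩, rfl⟩)
    · exact ⟨Or.inl ⟨v, hv, rfl⟩, by rwa [hmemI v hv]⟩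
    · exact ⟨Or.inr hx, disjoint_left.1 hKg hx⟩
    · exact ⟨Or.inl ⟨v, hv, rfl⟩, by rwa [hmemI v hv]⟩

/-- A proper part of a simple closed curve does not separate the plane. -/
theorem IsLoopParam_s8.logEquiv_sdiff {β : Set ℂ} {b : ℝ → ℂ} {z : ℂ} (hb : IsLoopParam_s8 b β z)
    {τ : ℝ} (hτ : τ ∈ Ioo (0 : ℝ) 1) {N : Set ℂ} (hN : N ∈ 𝓝 (b τ)) {r : ℂ} (hr : r ∉ β) :
    LogEquiv (β \ N) r (b τ) := by
  have hpre : b ⁻¹' N ∈ 𝓝 τ := hb.continuous.continuousAt hN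
  obtain ⟨ε, hε, hεN⟩ := Metric.nhds_basis_closedBall.mem_iff.1
    (inter_mem hpre (Ioo_mem_nhds hτ.1 hτ.2))
  rw [Real.closedBall_eq_Icc] at hεN
  have hc := hεN (left_mem_Icc.2 (by linarith : τ - ε ≤ τ + ε))
  have hd := hεN (right_mem_Icc.2 (by linarith : τ - ε ≤ τ + ε))
  have hcl := (isCompact_Icc.image hb.continuous (s := Icc 0 (τ - ε))).isClosed
  have hcr := (isCompact_Icc.image hb.continuous (s := Icc (τ + ε) 1)).isClosed
  have hl : b τ ∉ b '' Icc 0 (τ - ε) := by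
    rintro ⟨x, hx, h⟩
    have := hb.eq_of_eq hτ ⟨hx.1, hx.2.trans hc.2.2.le⟩ h.symm
    linarith [hx.2]
  have hr' : b τ ∉ b '' Icc (τ + ε) 1 := by
    rintro ⟨x, hx, h⟩
    have := hb.eq_of_eq hτ ⟨hd.2.1.le.trans hx.1, hx.2⟩ h.symm
    linarith [hx.1]
  refine LogEquiv.mono (Y := b '' Icc 0 (τ - ε) ∪ b '' Icc (τ + ε) 1)
    (LogEquiv.union hcl hcr ?_ hl ?_ ?_) ?_
  · convert isPreconnected_singleton (x := z) using 1
    ext x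
    constructor
    · rintro ⟨⟨s, hs, rfl⟩, t, ht, hst⟩
      by_contra hne
      have hs1 : s ∈ Ioo (0 : ℝ) 1 := ⟨lt_of_le_of_ne hs.1 fun h => hne (h ▸ hb.zero),
        hs.2.trans_lt hc.2.2⟩
      have := hb.eq_of_eq hs1 ⟨hd.2.1.le.trans ht.1, ht.2⟩ hst.symm
      linarith [hs.2, ht.1]
    · rintro rfl
      exact ⟨⟨0, ⟨le_rfl, hc.2.1.le⟩, hb.zero⟩, 1, ⟨hd.2.2.le, le_rfl⟩, hb.one⟩
  · refine logEquiv_arc hb.continuous hc.2.1.le (hb.injOn_Icc_left hc.2.2) ?_ hl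
    rintro ⟨x, hx, rfl⟩
    exact hr (hb.mem_s8 ⟨hx.1, hx.2.trans hc.2.2.le⟩)
  · refine logEquiv_arc hb.continuous hd.2.2.le (hb.injOn_Icc_right hd.2.1) ?_ hr'
    rintro ⟨x, hx, rfl⟩
    exact hr (hb.mem_s8 ⟨hd.2.1.le.trans hx.1, hx.2⟩)
  · rintro x ⟨hx, hxN⟩
    rw [← hb.image] at hx
    obtain ⟨t, ht, rfl⟩ := hx
    rcases le_total t (τ - ε) with h | h
    · exact Or.inl ⟨t, ⟨ht.1, h⟩, rfl⟩
    rcases le_total (τ + ε) t with h' | h'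
    · exact Or.inr ⟨t, ⟨h', ht.2⟩, rfl⟩
    exact absurd (hεN ⟨h, h'⟩).1 hxN

/-- `C` and `D` are the two sides of `β`. -/
structure IsSides (β C D : Set ℂ) : Prop where
  isOpen_left : IsOpen C
  isOpen_right : IsOpen D
  isPreconnected_left : IsPreconnected C
  isPreconnected_right : IsPreconnected D
  disjoint : Disjoint C D
  union : C ∪ D = βᶜ

theorem IsSides.symm {β C D : Set ℂ} (h : IsSides β C D) : IsSides β D C :=
  ⟨h.2, h.1, h.4, h.3, h.5.symm, union_comm C D ▸ h.6⟩

theorem IsSides.subset_or_subset {β C D K : Set ℂ} (h : IsSides β C D) (hK : IsPreconnected K)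
    (hKβ : Disjoint K β) : K ⊆ C ∨ K ⊆ D := by
  rcases K.eq_empty_or_nonempty with rfl | ⟨x, hx⟩
  · exact Or.inl (empty_subset _)
  have hsub : K ⊆ C ∪ D := h.union ▸ fun x hx => disjoint_left.1 hKβ hx
  rcases hsub hx with hxC | hxD
  · exact Or.inl (hK.subset_left_of_subset_union h.1 h.2 h.disjoint hsub ⟨x, hx, hxC⟩)
  · exact Or.inr (hK.subset_right_of_subset_union h.1 h.2 h.disjoint hsub ⟨x, hx, hxD⟩)

theorem IsSides.not_mem_left {β C D : Set ℂ} (h : IsSides β C D) {x : ℂ} (hx : x ∈ β) : x ∉ C :=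
  fun hC => (h.union ▸ Or.inl hC : x ∈ βᶜ) hx

theorem IsSides.not_mem_right {β C D : Set ℂ} (h : IsSides β C D) {x : ℂ} (hx : x ∈ β) : x ∉ D :=
  h.symm.not_mem_left hx

theorem IsCrossChart_s8.not_logEquiv {β ρ : Set ℂ} {b : ℝ → ℂ} {z : ℂ} (hb : IsLoopParam_s8 b β z)
    {τ : ℝ} (hτ : τ ∈ Ioo (0 : ℝ) 1) {g : ℝ × ℝ → ℂ} (hg : IsCrossChart_s8 β ρ (b τ) g)
    (hzg : z ∉ g '' Metric.closedBall 0 1) :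
    ¬ LogEquiv β (g (0, 1 / 2)) (g (0, -(1 / 2))) := by
  have hzg' : z ∉ g '' Metric.ball 0 1 := fun h => hzg (image_mono Metric.ball_subset_closedBall h)
  refine not_logEquiv_of_flat hb.isCompact_s8 hg.isOpenEmbedding (fun p _ => hg.mem_left p) ?_
  have := hg.isPreconnected_sdiff hb le_rfl hτ.1 hτ.2 le_rfl (K := {z}) isPreconnected_singleton
    hb.zero hb.one (disjoint_singleton_left.2 hzg') hzg'
  rwa [hb.image, union_eq_self_of_subset_right] at this
  exact singleton_subset_iff.2 (hb.zero ▸ hb.mem_s8 ⟨le_rfl, zero_le_one⟩)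

/-- The Jordan curve theorem, for curves which are locally flat at some point. -/
theorem IsLoopParam_s8.exists_isSides {β ρ : Set ℂ} {b : ℝ → ℂ} {z : ℂ} (hb : IsLoopParam_s8 b β z)
    {τ : ℝ} (hτ : τ ∈ Ioo (0 : ℝ) 1) {g : ℝ × ℝ → ℂ} (hg : IsCrossChart_s8 β ρ (b τ) g) :
    ∃ C D, IsSides β C D := by
  obtain ⟨g, hg, hgz⟩ := hg.exists_shrink
    (isOpen_compl_singleton.mem_nhds (hb.ne_base hτ : b τ ∈ ({z} : Set ℂ)ᶜ))
  have hzg : z ∉ g '' Metric.closedBall 0 1 := fun h => hgz h rfl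
  have hup : g (0, 1 / 2) ∈ βᶜ := by simp [hg.mem_left]
  have hdn : g (0, -(1 / 2)) ∈ βᶜ := by simp [hg.mem_left]
  have ho := hb.isCompact_s8.isClosed.isOpen_compl
  have hgc := hg.isOpenEmbedding.continuous
  refine ⟨connectedComponentIn βᶜ (g (0, 1 / 2)), connectedComponentIn βᶜ (g (0, -(1 / 2))),
    ho.connectedComponentIn, ho.connectedComponentIn, isPreconnected_connectedComponentIn,
    isPreconnected_connectedComponentIn, ?_, ?_⟩
  · rw [disjoint_left]
    intro x hx hx'
    refine hg.not_logEquiv hb hτ hzg (LogEquiv.of_isPreconnected hb.isCompact_s8.isClosed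
      (K := connectedComponentIn βᶜ x) isPreconnected_connectedComponentIn
      (disjoint_left.2 fun y hy => connectedComponentIn_subset _ _ hy) ?_ ?_)
    · rw [← connectedComponentIn_eq hx]
      exact mem_connectedComponentIn hup
    · rw [← connectedComponentIn_eq hx']
      exact mem_connectedComponentIn hdn
  · refine Subset.antisymm (union_subset (connectedComponentIn_subset _ _)
      (connectedComponentIn_subset _ _)) fun r hr => ?_
    have hB : g '' Metric.ball 0 1 ∈ 𝓝 (b τ) := by
      rw [← hg.map_zero]
      exact hg.isOpenEmbedding.isOpenMap.image_mem_nhds (Metric.ball_mem_nhds _ one_pos)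
    have hlog := hb.logEquiv_sdiff hτ hB hr
    rw [← hg.map_zero] at hlog
    obtain ⟨_, hx, p, hp, rfl⟩ := connectedComponentIn_inter_chart_nonempty hb.isCompact_s8
      hg.isOpenEmbedding ((hg.mem_left 0).2 rfl) hr hlog
    have hxβ : g p ∉ β := connectedComponentIn_subset _ _ hx
    rw [hg.mem_left] at hxβ
    have hrx : r ∈ connectedComponentIn βᶜ (g p) := by
      rw [← connectedComponentIn_eq hx]
      exact mem_connectedComponentIn hr
    rcases lt_or_gt_of_ne hxβ with h | h
    · refine Or.inr ?_
      have : g p ∈ connectedComponentIn βᶜ (g (0, -(1 / 2))) :=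
        (isPreconnected_lower_half_ball.image g hgc.continuousOn).subset_connectedComponentIn
          (mem_image_of_mem _ zero_neg_half_mem)
          (by rintro _ ⟨q, hq, rfl⟩; simpa [hg.mem_left] using ne_of_lt hq.2)
          (mem_image_of_mem _ ⟨hp, h⟩)
      rwa [connectedComponentIn_eq this]
    · refine Or.inl ?_
      have : g p ∈ connectedComponentIn βᶜ (g (0, 1 / 2)) :=
        (isPreconnected_upper_half_ball.image g hgc.continuousOn).subset_connectedComponentIn
          (mem_image_of_mem _ zero_half_mem)
          (by rintro _ ⟨q, hq, rfl⟩; simpa [hg.mem_left] using ne_of_gt hq.2)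
          (mem_image_of_mem _ ⟨hp, h⟩)
      rwa [connectedComponentIn_eq this]

/-- Around a crossing there is a small chart whose upper half lies in a prescribed side. -/
theorem IsSides.exists_chart {β ρ C D : Set ℂ} (hS : IsSides β C D) {b : ℝ → ℂ} {z : ℂ}
    (hb : IsLoopParam_s8 b β z) {τ : ℝ} (hτ : τ ∈ Ioo (0 : ℝ) 1)
    (hg : ∃ g, IsCrossChart_s8 β ρ (b τ) g) {N : Set ℂ} (hN : N ∈ 𝓝 (b τ)) :
    ∃ g, IsCrossChart_s8 β ρ (b τ) g ∧ g '' Metric.closedBall 0 1 ⊆ N ∧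
      g '' (Metric.ball 0 1 ∩ {p | 0 < p.2}) ⊆ C ∧
      g '' (Metric.ball 0 1 ∩ {p | p.2 < 0}) ⊆ D := by
  obtain ⟨g, hg⟩ := hg
  obtain ⟨g, hg, hgN⟩ := hg.exists_shrink (inter_mem hN
    (isOpen_compl_singleton.mem_nhds (hb.ne_base hτ : b τ ∈ ({z} : Set ℂ)ᶜ)))
  have hzg : z ∉ g '' Metric.closedBall 0 1 := fun h => (hgN h).2 rfl
  have hgc := hg.isOpenEmbedding.continuous
  have hlog := hg.not_logEquiv hb hτ hzg
  have hnot : ∀ E : Set ℂ, IsPreconnected E → Disjoint E β →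
      g '' (Metric.ball 0 1 ∩ {p | 0 < p.2}) ⊆ E → g '' (Metric.ball 0 1 ∩ {p | p.2 < 0}) ⊆ E →
      False := fun E hE hEβ h h' => hlog (LogEquiv.of_isPreconnected hb.isCompact_s8.isClosed hE hEβ
    (h (mem_image_of_mem _ zero_half_mem)) (h' (mem_image_of_mem _ zero_neg_half_mem)))
  have hCβ : Disjoint C β := disjoint_left.2 fun x hx hx' => hS.not_mem_left hx' hx
  have hDβ : Disjoint D β := disjoint_left.2 fun x hx hx' => hS.not_mem_right hx' hx
  rcases hS.subset_or_subset (isPreconnected_upper_half_ball.image g hgc.continuousOn)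
    (disjoint_left.2 (by rintro _ ⟨q, hq, rfl⟩; simpa [hg.mem_left] using ne_of_gt hq.2))
    with hu | hu <;>
  rcases hS.subset_or_subset (isPreconnected_lower_half_ball.image g hgc.continuousOn)
    (disjoint_left.2 (by rintro _ ⟨q, hq, rfl⟩; simpa [hg.mem_left] using ne_of_lt hq.2))
    with hl | hl
  · exact (hnot C hS.isPreconnected_left hCβ hu hl).elim
  · exact ⟨g, hg, hgN.trans inter_subset_left, hu, hl⟩
  · have hflip : ∀ p : ℝ × ℝ, ‖(p.1, -p.2)‖ = ‖p‖ := fun p => by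
      rw [Prod.norm_mk, norm_neg, Prod.norm_def]
    refine ⟨_, hg.flip_s8, ?_, ?_, ?_⟩
    · rintro _ ⟨p, hp, rfl⟩
      refine (hgN (mem_image_of_mem _ ?_)).1
      rwa [mem_closedBall_zero_iff, hflip, ← mem_closedBall_zero_iff]
    · rintro _ ⟨p, ⟨hp, hp0⟩, rfl⟩
      refine hl (mem_image_of_mem _ ⟨?_, ?_⟩)
      · rwa [mem_ball_zero_iff, hflip, ← mem_ball_zero_iff]
      · simpa using hp0
    · rintro _ ⟨p, ⟨hp, hp0⟩, rfl⟩
      refine hu (mem_image_of_mem _ ⟨?_, ?_⟩)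
      · rwa [mem_ball_zero_iff, hflip, ← mem_ball_zero_iff]
      · simpa using hp0
  · exact (hnot D hS.isPreconnected_right hDβ hu hl).elim

/-- A connected set in the side `C` cannot link the two arcs into which the endpoints of
a connected set `K₁` in the same side cut `β`. -/
theorem IsSides.false_of_linked {β ρ C D : Set ℂ} (hS : IsSides β C D) {b : ℝ → ℂ} {z : ℂ}
    (hb : IsLoopParam_s8 b β z) {s t τ : ℝ} (hs : 0 ≤ s) (hsτ : s < τ) (hτt : τ < t) (ht : t ≤ 1)
    (hg : ∃ g, IsCrossChart_s8 β ρ (b τ) g) {K₁ K₂ : Set ℂ} (hK₁ : IsCompact K₁)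
    (hK₁p : IsPreconnected K₁) (hsK : b s ∈ K₁) (htK : b t ∈ K₁)
    (hK₁β : ∀ x ∈ K₁, x ∈ β → x = b s ∨ x = b t) (hK₁D : Disjoint K₁ D)
    (hK₂ : IsPreconnected K₂) (hK₂C : K₂ ⊆ C) (hK : Disjoint K₁ K₂) (hτK₂ : b τ ∈ closure K₂)
    {y : ℂ} (hyK₂ : y ∈ closure K₂) (hyD : y ∈ closure D) (hyJ : y ∉ b '' Icc s t ∪ K₁) :
    False := by
  have hτ : τ ∈ Ioo (0 : ℝ) 1 := ⟨hs.trans_lt hsτ, hτt.trans_le ht⟩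
  have hbc := hb.continuous
  set F := K₁ ∪ b '' Icc 0 s ∪ b '' Icc t 1 with hF
  have hFcl : IsClosed F := ((hK₁.union (isCompact_Icc.image hbc)).union
    (isCompact_Icc.image hbc)).isClosed
  have hbF : b τ ∈ Fᶜ := by
    rintro ((h | ⟨v, hv, h⟩) | ⟨v, hv, h⟩)
    · rcases hK₁β _ h (hb.mem_s8 (Ioo_subset_Icc_self hτ)) with h | h
      · exact hsτ.ne' (hb.eq_of_eq hτ ⟨hs, by linarith⟩ h)
      · exact hτt.ne (hb.eq_of_eq hτ ⟨by linarith, ht⟩ h)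
    · have := hb.eq_of_eq hτ ⟨hv.1, by linarith [hv.2]⟩ h.symm
      linarith [hv.2]
    · have := hb.eq_of_eq hτ ⟨by linarith [hv.1], hv.2⟩ h.symm
      linarith [hv.1]
  obtain ⟨g, hg, hgN, hgC, hgD⟩ := hS.exists_chart hb hτ hg (hFcl.isOpen_compl.mem_nhds hbF)
  have hgB : g '' Metric.ball 0 1 ⊆ Fᶜ := (image_mono Metric.ball_subset_closedBall).trans hgN
  have hzg : z ∉ g '' Metric.ball 0 1 := fun h =>
    hgB h (Or.inl (Or.inr ⟨0, ⟨le_rfl, hs⟩, hb.zero⟩))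
  set J := b '' Icc s t ∪ K₁ with hJ
  have hJc : IsCompact J := (isCompact_Icc.image hbc).union hK₁
  have hsub : b '' Icc s t ⊆ β := by
    rintro _ ⟨v, hv, rfl⟩
    exact hb.mem_s8 ⟨hs.trans hv.1, hv.2.trans ht⟩
  have hgJ : ∀ p, ‖p‖ ≤ 1 → (g p ∈ J ↔ p.2 = 0) := by
    intro p hp
    have hpN : g p ∈ Fᶜ := hgN (mem_image_of_mem g (mem_closedBall_zero_iff.2 hp))
    rw [← hg.mem_left]
    constructor
    · rintro (h | h)
      · exact hsub h
      · exact absurd (Or.inl (Or.inl h)) hpN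
    · intro h
      rw [← hb.image] at h
      obtain ⟨v, hv, hvp⟩ := h
      refine Or.inl ⟨v, ⟨?_, ?_⟩, hvp⟩
      · by_contra h
        exact hpN (Or.inl (Or.inr ⟨v, ⟨hv.1, (not_le.1 h).le⟩, hvp⟩))
      · by_contra h
        exact hpN (Or.inr ⟨v, ⟨(not_le.1 h).le, hv.2⟩, hvp⟩)
  refine not_logEquiv_of_flat hJc hg.isOpenEmbedding hgJ (hg.isPreconnected_sdiff hb hs hsτ hτt ht
    hK₁p hsK htK (disjoint_left.2 fun x hx hx' => hgB hx' (Or.inl (Or.inl hx))) hzg) ?_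
  obtain ⟨δ, hδ, hδJ⟩ := Metric.isOpen_iff.1 hJc.isClosed.isOpen_compl y hyJ
  have hK₂J : Disjoint K₂ J := disjoint_left.2 fun x hx hxJ => hxJ.elim
    (fun h => hS.not_mem_left (hsub h) (hK₂C hx)) fun h => disjoint_left.1 hK h hx
  have hDJ : Disjoint D J := disjoint_left.2 fun x hx hxJ => hxJ.elim
    (fun h => hS.not_mem_right (hsub h) hx) fun h => disjoint_left.1 hK₁D h hx
  have hUJ : Disjoint (g '' (Metric.ball 0 1 ∩ {p | 0 < p.2})) J := by
    rw [disjoint_left]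
    rintro _ ⟨p, ⟨hp, hp0⟩, rfl⟩ h
    exact (ne_of_gt hp0) ((hgJ p (mem_ball_zero_iff.1 hp).le).1 h)
  have hbJ : Disjoint (Metric.ball y δ) J := disjoint_left.2 hδJ
  obtain ⟨x₁, hx₁, hx₁K⟩ : (g '' (Metric.ball 0 1 ∩ {p | 0 < p.2}) ∩ K₂).Nonempty := by
    obtain ⟨_, ⟨p, hp, rfl⟩, hx⟩ := mem_closure_iff.1 hτK₂ _
      (hg.isOpenEmbedding.isOpenMap _ Metric.isOpen_ball)
      (show b τ ∈ g '' Metric.ball 0 1 from ⟨0, Metric.mem_ball_self one_pos, hg.map_zero⟩)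
    refine ⟨g p, mem_image_of_mem _ ⟨hp, ?_⟩, hx⟩
    rcases lt_trichotomy p.2 0 with h | h | h
    · exact absurd (hgD (mem_image_of_mem _ ⟨hp, h⟩)) (disjoint_left.1 hS.disjoint (hK₂C hx))
    · exact absurd (hK₂C hx) (hS.not_mem_left ((hg.mem_left p).2 h))
    · exact h
  obtain ⟨x₂, hx₂, hx₂K⟩ := mem_closure_iff.1 hyK₂ _ Metric.isOpen_ball (Metric.mem_ball_self hδ)
  obtain ⟨x₃, hx₃, hx₃D⟩ := mem_closure_iff.1 hyD _ Metric.isOpen_ball (Metric.mem_ball_self hδ)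
  have hE := (((isPreconnected_upper_half_ball.image g
    hg.isOpenEmbedding.continuous.continuousOn).union x₁ hx₁ hx₁K hK₂).union x₂ (Or.inr hx₂K) hx₂
    (convex_ball y δ).isPreconnected).union x₃ (Or.inr hx₃) hx₃D hS.isPreconnected_right
  exact LogEquiv.of_isPreconnected hJc.isClosed hE
    (((hUJ.union_left hK₂J).union_left hbJ).union_left hDJ)
    (Or.inl (Or.inl (Or.inl (mem_image_of_mem _ zero_half_mem))))
    (Or.inr (hgD (mem_image_of_mem _ zero_neg_half_mem)))

theorem IsSides.mem_closure_right {β ρ C D : Set ℂ} (hS : IsSides β C D) {b : ℝ → ℂ} {z : ℂ}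
    (hb : IsLoopParam_s8 b β z) {τ : ℝ} (hτ : τ ∈ Ioo (0 : ℝ) 1)
    (hg : ∃ g, IsCrossChart_s8 β ρ (b τ) g) : b τ ∈ closure D := by
  rw [mem_closure_iff_nhds]
  intro N hN
  obtain ⟨g, -, hgN, -, hgD⟩ := hS.exists_chart hb hτ hg hN
  exact ⟨g (0, -(1 / 2)),
    hgN (mem_image_of_mem _ (Metric.ball_subset_closedBall zero_neg_half_mem.1)),
    hgD (mem_image_of_mem _ zero_neg_half_mem)⟩

/-- A crossing is the starting point of a small subarc of `ρ` running in the side `C`. -/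
theorem IsSides.exists_subarc {β ρ C D : Set ℂ} (hS : IsSides β C D) {b r : ℝ → ℂ} {z : ℂ}
    (hb : IsLoopParam_s8 b β z) (hr : IsLoopParam_s8 r ρ z) {u : ℝ} (hu : u ∈ Ioo (0 : ℝ) 1)
    (huβ : r u ∈ β) (hg : ∃ g, IsCrossChart_s8 β ρ (r u) g) :
    ∃ v ∈ Ioo (0 : ℝ) 1, v ≠ u ∧ ∀ x ∈ uIcc u v, x ≠ u → r x ∈ C := by
  have huz : r u ≠ z := hr.ne_base hu
  obtain ⟨τ, hτ, hτu⟩ := hb.exists_eq huβ huz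
  rw [← hτu] at hg
  obtain ⟨g, hg, hgz, hgC, -⟩ := hS.exists_chart hb hτ hg
    (isOpen_compl_singleton.mem_nhds (hb.ne_base hτ : b τ ∈ ({z} : Set ℂ)ᶜ))
  obtain ⟨θ, hθ, hθr⟩ := hr.exists_time
  have hnorm : ∀ y ∈ Icc (0 : ℝ) (1 / 2), ‖((0 : ℝ), y)‖ < 1 := fun y hy => by
    rw [Prod.norm_mk, norm_zero, Real.norm_of_nonneg hy.1, max_eq_right hy.1]
    linarith [hy.2]
  have hmem : ∀ y ∈ Icc (0 : ℝ) (1 / 2), g (0, y) ∈ ρ \ {z} := fun y hy =>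
    ⟨(hg.mem_right _).2 rfl,
      hgz (mem_image_of_mem _ (mem_closedBall_zero_iff.2 (hnorm y hy).le))⟩
  have hrθ : ∀ y ∈ Icc (0 : ℝ) (1 / 2), θ (g (0, y)) ∈ Ioo (0 : ℝ) 1 ∧
      r (θ (g (0, y))) = g (0, y) := fun y hy => by
    obtain ⟨v, hv, hvy⟩ := hr.exists_eq (hmem y hy).1 (hmem y hy).2
    rw [← hvy, hθr v hv]
    exact ⟨hv, rfl⟩
  have hC : ∀ y ∈ Icc (0 : ℝ) (1 / 2), 0 < y → g (0, y) ∈ C := fun y hy hy0 =>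
    hgC (mem_image_of_mem _ ⟨mem_ball_zero_iff.2 (hnorm y hy), hy0⟩)
  have h0 : θ (g (0, 0)) = u := by
    rw [← Prod.zero_eq_mk, hg.map_zero, hτu, hθr u hu]
  have hhalf : (1 / 2 : ℝ) ∈ Icc (0 : ℝ) (1 / 2) := ⟨by norm_num, le_rfl⟩
  have hf : ContinuousOn (fun y : ℝ => θ (g (0, y))) (uIcc 0 (1 / 2)) := by
    rw [uIcc_of_le (by norm_num : (0 : ℝ) ≤ 1 / 2)]
    exact hθ.comp (hg.isOpenEmbedding.continuous.comp (by fun_prop)).continuousOn hmem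
  refine ⟨θ (g (0, 1 / 2)), (hrθ _ hhalf).1, ?_, ?_⟩
  · intro h
    have h1 := (hrθ _ hhalf).2
    rw [h] at h1
    exact hS.not_mem_left huβ (h1 ▸ hC _ hhalf (by norm_num))
  · intro x hx hxu
    rw [← h0] at hx
    obtain ⟨y, hy, rfl⟩ := intermediate_value_uIcc hf hx
    rw [uIcc_of_le (by norm_num : (0 : ℝ) ≤ 1 / 2)] at hy
    rw [(hrθ y hy).2]
    refine hC y hy (lt_of_le_of_ne hy.1 ?_)
    rintro rfl
    exact hxu h0

/-- The subarc of `r` between the times `u` and `v` is a chord of `β` in the side `C`. -/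
structure IsChord_s8 (r : ℝ → ℂ) (β C : Set ℂ) (u v : ℝ) : Prop where
  left : u ∈ Ioo (0 : ℝ) 1
  right : v ∈ Ioo (0 : ℝ) 1
  left_mem : r u ∈ β
  right_mem : r v ∈ β
  lt : u < v
  mem_s8 : ∀ x ∈ Ioo u v, r x ∈ C

theorem IsSides.exists_isChord_of_lt {β ρ C D : Set ℂ} (hS : IsSides β C D) {r : ℝ → ℂ} {z : ℂ}
    (hβ : IsClosed β) (hzβ : z ∈ β) (hr : IsLoopParam_s8 r ρ z)
    (hz : ∃ U ∈ 𝓝 z, ∀ x ∈ U ∩ ρ, x ≠ z → x ∈ D) {u v : ℝ} (hu : u ∈ Ioo (0 : ℝ) 1)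
    (huβ : r u ∈ β) (hv : v ∈ Ioo (0 : ℝ) 1) (huv : u < v) (hC : ∀ x ∈ Ioc u v, r x ∈ C) :
    ∃ w, IsChord_s8 r β C u w := by
  obtain ⟨w, ⟨⟨hvw, hw1⟩, hwβ⟩, hw⟩ := (isCompact_Icc.inter_right
    (hβ.preimage hr.continuous) : IsCompact (Icc v 1 ∩ r ⁻¹' β)).exists_isLeast
    ⟨1, ⟨hv.2.le, le_rfl⟩, show r 1 ∈ β from hr.one.symm ▸ hzβ⟩
  have hvC : r v ∈ C := hC v ⟨huv, le_rfl⟩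
  have hvw : v < w := lt_of_le_of_ne hvw fun h => hS.not_mem_left hwβ (h ▸ hvC)
  have hsub : r '' Ioo u w ⊆ C := by
    have hd : Disjoint (r '' Ioo u w) β := by
      rw [disjoint_left]
      rintro _ ⟨x, hx, rfl⟩ hxβ
      rcases le_total x v with h | h
      · exact hS.not_mem_left hxβ (hC x ⟨hx.1, h⟩)
      · exact (hw ⟨⟨h, hx.2.le.trans hw1⟩, hxβ⟩).not_gt hx.2
    rcases hS.subset_or_subset (isPreconnected_Ioo.image r hr.continuous.continuousOn) hd
      with h | h
    · exact h
    · exact absurd (h (mem_image_of_mem r ⟨huv, hvw⟩)) (disjoint_left.1 hS.disjoint hvC)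
  refine ⟨w, hu, ⟨hv.1.trans hvw, lt_of_le_of_ne hw1 ?_⟩, huβ, hwβ, huv.trans hvw,
    fun x hx => hsub (mem_image_of_mem r hx)⟩
  rintro rfl
  obtain ⟨U, hU, hUD⟩ := hz
  have hpre : r ⁻¹' U ∈ 𝓝[<] (1 : ℝ) :=
    mem_nhdsWithin_of_mem_nhds (hr.continuous.continuousAt (by rwa [hr.one]))
  obtain ⟨x, hxU, hx⟩ := Filter.nonempty_of_mem (inter_mem hpre (Ioo_mem_nhdsLT hu.2))
  have hx01 : x ∈ Ioo (0 : ℝ) 1 := ⟨hu.1.trans hx.1, hx.2⟩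
  exact disjoint_left.1 hS.disjoint (hsub (mem_image_of_mem r hx))
    (hUD _ ⟨hxU, hr.mem_s8 (Ioo_subset_Icc_self hx01)⟩ (hr.ne_base hx01))

/-- Every crossing is an endpoint of a chord in the side `C`. -/
theorem IsSides.exists_isChord {β ρ C D : Set ℂ} (hS : IsSides β C D) {b r : ℝ → ℂ} {z : ℂ}
    (hb : IsLoopParam_s8 b β z) (hr : IsLoopParam_s8 r ρ z)
    (hz : ∃ U ∈ 𝓝 z, ∀ x ∈ U ∩ ρ, x ≠ z → x ∈ D) {u : ℝ} (hu : u ∈ Ioo (0 : ℝ) 1)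
    (huβ : r u ∈ β) (hg : ∃ g, IsCrossChart_s8 β ρ (r u) g) :
    ∃ v, IsChord_s8 r β C u v ∨ IsChord_s8 r β C v u := by
  have hzβ : z ∈ β := hb.zero ▸ hb.mem_s8 ⟨le_rfl, zero_le_one⟩
  obtain ⟨v, hv, hvu, hC⟩ := hS.exists_subarc hb hr hu huβ hg
  rcases hvu.lt_or_gt with h | h
  · rw [uIcc_of_ge h.le] at hC
    obtain ⟨w, hw⟩ := hS.exists_isChord_of_lt hb.isCompact_s8.isClosed hzβ hr.reverse_s8 hz
      (u := 1 - u) (v := 1 - v) ⟨by linarith [hu.2], by linarith [hu.1]⟩ (by simpa using huβ)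
      ⟨by linarith [hv.2], by linarith [hv.1]⟩ (by linarith) fun x hx => hC (1 - x)
        ⟨by linarith [hx.2], by linarith [hx.1]⟩ (by linarith [hx.1])
    refine ⟨1 - w, Or.inr ⟨⟨by linarith [hw.right.2], by linarith [hw.right.1]⟩, hu,
      hw.right_mem, huβ, by linarith [hw.lt], fun x hx => ?_⟩⟩
    simpa using hw.mem_s8 (1 - x) ⟨by linarith [hx.2], by linarith [hx.1]⟩
  · rw [uIcc_of_le h.le] at hC
    obtain ⟨w, hw⟩ := hS.exists_isChord_of_lt hb.isCompact_s8.isClosed hzβ hr hz hu huβ hv h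
      fun x hx => hC x ⟨hx.1.le, hx.2⟩ hx.1.ne'
    exact ⟨w, Or.inl hw⟩

/-- Two chords in the same side are not linked. -/
theorem IsSides.isChord_not_linked {β ρ C D : Set ℂ} (hS : IsSides β C D) {b r : ℝ → ℂ} {z : ℂ}
    (hb : IsLoopParam_s8 b β z) (hr : IsLoopParam_s8 r ρ z)
    (hg : ∀ w ∈ β ∩ ρ, w ≠ z → ∃ g, IsCrossChart_s8 β ρ w g) {u v a c w w' s t τ τ' : ℝ}
    (huv : IsChord_s8 r β C u v) (hac : IsChord_s8 r β C a c)
    (hw : w = a ∧ w' = c ∨ w = c ∧ w' = a)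
    (hst : b s = r u ∧ b t = r v ∨ b s = r v ∧ b t = r u)
    (hs : 0 ≤ s) (hsτ : s < τ) (hτt : τ < t) (ht : t ≤ 1) (hτw : b τ = r w)
    (hτ' : τ' ∈ Ioo (0 : ℝ) 1) (hτw' : b τ' = r w') : τ' ∈ Icc s t := by
  by_contra hτst
  have hrc := hr.continuous
  have hτ : τ ∈ Ioo (0 : ℝ) 1 := ⟨hs.trans_lt hsτ, hτt.trans_le ht⟩
  have hnotC : ∀ {x}, r x ∈ β → r x ∉ C := fun hx => hS.not_mem_left hx
  have hne : ∀ x, (x = w ∨ x = w') → x ≠ u ∧ x ≠ v := by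
    have h1 : ∀ q, q ∈ Ioo (0 : ℝ) 1 → b q ≠ b s → b q ≠ b t → b q ≠ r u ∧ b q ≠ r v := by
      intro q _ h h'
      rcases hst with ⟨e, e'⟩ | ⟨e, e'⟩
      · exact ⟨e ▸ h, e' ▸ h'⟩
      · exact ⟨e' ▸ h', e ▸ h⟩
    have hs01 : s ∈ Icc (0 : ℝ) 1 := ⟨hs, by linarith⟩
    have ht01 : t ∈ Icc (0 : ℝ) 1 := ⟨by linarith, ht⟩
    rintro x (rfl | rfl)
    · have := h1 τ hτ (fun h => hsτ.ne' (hb.eq_of_eq hτ hs01 h))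
        (fun h => hτt.ne (hb.eq_of_eq hτ ht01 h))
      rw [hτw] at this
      exact ⟨fun h => this.1 (h ▸ rfl), fun h => this.2 (h ▸ rfl)⟩
    · have := h1 τ' hτ' (fun h => hτst (by
          rw [hb.eq_of_eq hτ' hs01 h]
          exact left_mem_Icc.2 (hsτ.trans hτt).le))
        (fun h => hτst (by
          rw [hb.eq_of_eq hτ' ht01 h]
          exact right_mem_Icc.2 (hsτ.trans hτt).le))
      rw [hτw'] at this
      exact ⟨fun h => this.1 (h ▸ rfl), fun h => this.2 (h ▸ rfl)⟩
  have ha : a ≠ u ∧ a ≠ v := hne a (by rcases hw with ⟨h, h'⟩ | ⟨h, h'⟩ <;> simp [h, h'])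
  have hc : c ≠ u ∧ c ≠ v := hne c (by rcases hw with ⟨h, h'⟩ | ⟨h, h'⟩ <;> simp [h, h'])
  have hsep : c < u ∨ v < a := by
    by_contra! h
    have h1 : u < c := lt_of_le_of_ne h.1 hc.1.symm
    have h2 : a < v := lt_of_le_of_ne h.2 ha.2
    rcases ha.1.lt_or_gt with h3 | h3
    · exact hnotC huv.left_mem (hac.mem_s8 u ⟨h3, h1⟩)
    · exact hnotC hac.left_mem (huv.mem_s8 a ⟨h3, h2⟩)
  have hdisj : ∀ x ∈ Icc a c, x ∉ Icc u v := fun x hx hx' => by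
    rcases hsep with h | h
    · linarith [hx.2, hx'.1]
    · linarith [hx.1, hx'.2]
  have hsub : ∀ x ∈ Icc a c, x ∈ Ioo (0 : ℝ) 1 := fun x hx =>
    ⟨hac.left.1.trans_le hx.1, hx.2.trans_lt hac.right.2⟩
  have hrdisj : ∀ x ∈ Icc a c, r x ∉ r '' Icc u v := by
    rintro x hx ⟨y, hy, hyx⟩
    have := hr.eq_of_eq (hsub x hx)
      ⟨huv.left.1.le.trans hy.1, hy.2.trans huv.right.2.le⟩ hyx.symm
    exact hdisj x hx (this ▸ hy)
  have hwac : w ∈ Icc a c := by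
    rcases hw with ⟨h, -⟩ | ⟨h, -⟩
    · rw [h]
      exact left_mem_Icc.2 hac.lt.le
    · rw [h]
      exact right_mem_Icc.2 hac.lt.le
  have hwac' : w' ∈ Icc a c := by
    rcases hw with ⟨-, h⟩ | ⟨-, h⟩
    · rw [h]
      exact right_mem_Icc.2 hac.lt.le
    · rw [h]
      exact left_mem_Icc.2 hac.lt.le
  have hchart : ∀ q, q ∈ Ioo (0 : ℝ) 1 → ∀ x ∈ Icc a c, b q = r x →
      ∃ g, IsCrossChart_s8 β ρ (b q) g := fun q hq x hx h =>
    hg _ ⟨hb.mem_s8 (Ioo_subset_Icc_self hq), h ▸ hr.mem_s8 (Ioo_subset_Icc_self (hsub x hx))⟩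
      (hb.ne_base hq)
  have hcl : ∀ x ∈ Icc a c, r x ∈ closure (r '' Ioo a c) := fun x hx => by
    rw [← closure_Ioo hac.lt.ne] at hx
    exact image_closure_subset_closure_image hrc (mem_image_of_mem r hx)
  have huβ : r u ∈ r '' Icc u v := mem_image_of_mem r (left_mem_Icc.2 huv.lt.le)
  have hvβ : r v ∈ r '' Icc u v := mem_image_of_mem r (right_mem_Icc.2 huv.lt.le)
  have hK : ∀ x ∈ Icc u v, x = u ∨ x = v ∨ r x ∈ C := fun x hx => by
    rcases hx.1.eq_or_lt with h | h
    · exact Or.inl h.symm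
    rcases hx.2.eq_or_lt with h' | h'
    · exact Or.inr (Or.inl h')
    · exact Or.inr (Or.inr (huv.mem_s8 x ⟨h, h'⟩))
  refine hS.false_of_linked hb hs hsτ hτt ht (hchart τ hτ w hwac hτw) (K₁ := r '' Icc u v)
    (K₂ := r '' Ioo a c) (isCompact_Icc.image hrc) (isPreconnected_Icc.image r hrc.continuousOn)
    ?_ ?_ ?_ ?_ (isPreconnected_Ioo.image r hrc.continuousOn) ?_ ?_ (hτw ▸ hcl w hwac)
    (hcl w' hwac') (hτw' ▸ hS.mem_closure_right hb hτ' (hchart τ' hτ' w' hwac' hτw')) ?_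
  · rcases hst with ⟨h, -⟩ | ⟨h, -⟩ <;> rw [h] <;> assumption
  · rcases hst with ⟨-, h⟩ | ⟨-, h⟩ <;> rw [h] <;> assumption
  · rintro _ ⟨x, hx, rfl⟩ hxβ
    rcases hK x hx with rfl | rfl | h
    · exact hst.imp (fun h => h.1.symm) fun h => h.2.symm
    · exact hst.symm.imp (fun h => h.1.symm) fun h => h.2.symm
    · exact absurd h (hnotC hxβ)
  · rw [disjoint_left]
    rintro _ ⟨x, hx, rfl⟩ hxD
    rcases hK x hx with rfl | rfl | h
    · exact hS.not_mem_right huv.left_mem hxD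
    · exact hS.not_mem_right huv.right_mem hxD
    · exact disjoint_left.1 hS.disjoint h hxD
  · rintro _ ⟨x, hx, rfl⟩
    exact hac.mem_s8 x hx
  · rw [disjoint_right]
    rintro _ ⟨x, hx, rfl⟩
    exact hrdisj x (Ioo_subset_Icc_self hx)
  · rintro (⟨q, hq, h⟩ | h)
    · have := hb.eq_of_eq hτ' ⟨hs.trans hq.1, hq.2.trans ht⟩ (hτw'.trans h.symm)
      exact hτst (this ▸ hq)
    · exact hrdisj w' hwac' h

/-- An innermost chord cuts out an arc of `β` free of points of `ρ`. -/
theorem IsSides.exists_bigon {β ρ C D : Set ℂ} (hS : IsSides β C D) {b r : ℝ → ℂ} {z : ℂ}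
    (hb : IsLoopParam_s8 b β z) (hr : IsLoopParam_s8 r ρ z)
    (hz : ∃ U ∈ 𝓝 z, ∀ x ∈ U ∩ ρ, x ≠ z → x ∈ D)
    (hg : ∀ w ∈ β ∩ ρ, w ≠ z → ∃ g, IsCrossChart_s8 β ρ w g) (hfin : (β ∩ ρ).Finite)
    (hne : ∃ w ∈ β ∩ ρ, w ≠ z) :
    ∃ u v s t, u ∈ Ioo (0 : ℝ) 1 ∧ v ∈ Ioo (0 : ℝ) 1 ∧ s ∈ Ioo (0 : ℝ) 1 ∧ t ∈ Ioo (0 : ℝ) 1 ∧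
      u < v ∧ s < t ∧ (b s = r u ∧ b t = r v ∨ b s = r v ∧ b t = r u) ∧
      (∀ x ∈ Ioo u v, r x ∉ β) ∧ ∀ x ∈ Ioo s t, b x ∉ ρ := by
  obtain ⟨θ, -, hθ⟩ := hb.exists_time
  have hσ : ∀ x ∈ Ioo (0 : ℝ) 1, r x ∈ β → θ (r x) ∈ Ioo (0 : ℝ) 1 ∧ b (θ (r x)) = r x := by
    intro x hx hxβ
    obtain ⟨q, hq, hqx⟩ := hb.exists_eq hxβ (hr.ne_base hx)
    rw [← hqx, hθ q hq]
    exact ⟨hq, rfl⟩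
  have hgr : ∀ x ∈ Ioo (0 : ℝ) 1, r x ∈ β → ∃ g, IsCrossChart_s8 β ρ (r x) g := fun x hx hxβ =>
    hg _ ⟨hxβ, hr.mem_s8 (Ioo_subset_Icc_self hx)⟩ (hr.ne_base hx)
  have hTfin : {x | x ∈ Ioo (0 : ℝ) 1 ∧ r x ∈ β}.Finite := by
    refine Finite.of_finite_image (f := r) (hfin.subset ?_) ?_
    · rintro _ ⟨x, ⟨hx, hxβ⟩, rfl⟩
      exact ⟨hxβ, hr.mem_s8 (Ioo_subset_Icc_self hx)⟩
    · exact fun x hx y hy h => hr.eq_of_eq hx.1 (Ioo_subset_Icc_self hy.1) h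
  have hPfin : {p : ℝ × ℝ | IsChord_s8 r β C p.1 p.2}.Finite :=
    (hTfin.prod hTfin).subset fun p hp => ⟨⟨hp.left, hp.left_mem⟩, hp.right, hp.right_mem⟩
  have hPne : {p : ℝ × ℝ | IsChord_s8 r β C p.1 p.2}.Nonempty := by
    obtain ⟨w, ⟨hwβ, hwρ⟩, hwz⟩ := hne
    obtain ⟨u, hu, rfl⟩ := hr.exists_eq hwρ hwz
    obtain ⟨v, h | h⟩ := hS.exists_isChord hb hr hz hu hwβ (hgr u hu hwβ)
    · exact ⟨(u, v), h⟩
    · exact ⟨(v, u), h⟩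
  obtain ⟨⟨u, v⟩, huv, hmin⟩ := Set.exists_min_image _
    (fun p : ℝ × ℝ => |θ (r p.1) - θ (r p.2)|) hPfin hPne
  replace huv : IsChord_s8 r β C u v := huv
  obtain ⟨hu1, hu2⟩ := hσ u huv.left huv.left_mem
  obtain ⟨hv1, hv2⟩ := hσ v huv.right huv.right_mem
  have key : ∃ s t, s ∈ Ioo (0 : ℝ) 1 ∧ t ∈ Ioo (0 : ℝ) 1 ∧ s < t ∧
      (b s = r u ∧ b t = r v ∨ b s = r v ∧ b t = r u) ∧ |θ (r u) - θ (r v)| = t - s := by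
    rcases lt_trichotomy (θ (r u)) (θ (r v)) with h | h | h
    · exact ⟨_, _, hu1, hv1, h, Or.inl ⟨hu2, hv2⟩, by rw [abs_sub_comm, abs_of_pos (by linarith)]⟩
    · rw [h, hv2] at hu2
      exact absurd (hr.eq_of_eq huv.right (Ioo_subset_Icc_self huv.left) hu2) huv.lt.ne'
    · exact ⟨_, _, hv1, hu1, h, Or.inr ⟨hv2, hu2⟩, by rw [abs_of_pos (by linarith)]⟩
  obtain ⟨s, t, hs, ht, hst, hstuv, hlen⟩ := key
  refine ⟨u, v, s, t, huv.left, huv.right, hs, ht, huv.lt, hst, hstuv,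
    fun x hx hxβ => hS.not_mem_left hxβ (huv.mem_s8 x hx), fun τ hτ hτρ => ?_⟩
  have hτ01 : τ ∈ Ioo (0 : ℝ) 1 := ⟨hs.1.trans hτ.1, hτ.2.trans ht.2⟩
  obtain ⟨w, hw, hwτ⟩ := hr.exists_eq hτρ (hb.ne_base hτ01)
  have hwβ : r w ∈ β := hwτ ▸ hb.mem_s8 (Ioo_subset_Icc_self hτ01)
  have hθw : θ (r w) = τ := by rw [hwτ, hθ τ hτ01]
  obtain ⟨w', h⟩ := hS.exists_isChord hb hr hz hw hwβ (hgr w hw hwβ)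
  have hshort : θ (r w') ∈ Icc s t → |θ (r w) - θ (r w')| < t - s := fun hmem => by
    rw [hθw, abs_lt]
    constructor <;> linarith [hmem.1, hmem.2, hτ.1, hτ.2]
  rcases h with h | h
  · obtain ⟨h1, h2⟩ := hσ w' h.right h.right_mem
    have h3 := hshort (hS.isChord_not_linked hb hr hg huv h (Or.inl ⟨rfl, rfl⟩) hstuv hs.1.le hτ.1
      hτ.2 ht.2.le hwτ.symm h1 h2)
    have h4 := hmin (w, w') h
    simp only at h4
    linarith
  · obtain ⟨h1, h2⟩ := hσ w' h.left h.left_mem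
    have h3 := hshort (hS.isChord_not_linked hb hr hg huv h (Or.inr ⟨rfl, rfl⟩) hstuv hs.1.le hτ.1
      hτ.2 ht.2.le hwτ.symm h1 h2)
    have h4 := hmin (w', w) h
    simp only at h4
    rw [abs_sub_comm] at h3
    linarith

theorem IsSides.exists_nhds_subset_of_tangential {β ρ C D : Set ℂ} (hS : IsSides β C D)
    {g : ℝ × ℝ → ℂ} (hg : IsOpenEmbedding g) (hβ : ∀ p, g p ∈ β ↔ p.2 = 0)
    (hρ : ∀ p, g p ∈ ρ → 0 ≤ p.2) (hβρ : ∀ p, g p ∈ ρ → p.2 = 0 → p = 0) :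
    (∃ U ∈ 𝓝 (g 0), ∀ x ∈ U ∩ ρ, x ≠ g 0 → x ∈ C) ∨
      ∃ U ∈ 𝓝 (g 0), ∀ x ∈ U ∩ ρ, x ≠ g 0 → x ∈ D := by
  have hpre : IsPreconnected (g '' {p | 0 < p.2}) :=
    (convex_halfSpace_gt (LinearMap.snd ℝ ℝ ℝ).isLinear 0).isPreconnected.image g
      hg.continuous.continuousOn
  have hU : range g ∈ 𝓝 (g 0) := hg.isOpen_range.mem_nhds (mem_range_self 0)
  have hup : ∀ x ∈ range g ∩ ρ, x ≠ g 0 → x ∈ g '' {p | 0 < p.2} := by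
    rintro _ ⟨⟨p, rfl⟩, hp⟩ hp0
    exact mem_image_of_mem g
      (lt_of_le_of_ne (hρ p hp) fun h => hp0 (congrArg g (hβρ p hp h.symm)))
  refine (hS.subset_or_subset hpre (disjoint_left.2 ?_)).imp
    (fun h => ⟨_, hU, fun x hx hx0 => h (hup x hx hx0)⟩)
    fun h => ⟨_, hU, fun x hx hx0 => h (hup x hx hx0)⟩
  rintro _ ⟨p, hp, rfl⟩
  rw [hβ]
  exact ne_of_gt hp

/-- A simple closed curve in the complex plane has a parametrization with any given base point. -/
theorem exists_isLoopParam_s8 {c : Set ℂ} (e : c ≃ₜ Circle) {z : ℂ} (hz : z ∈ c) :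
    ∃ b, IsLoopParam_s8 b c z := by
  have hexp : ∀ s t : ℝ, Circle.exp (2 * Real.pi * s) = Circle.exp (2 * Real.pi * t) ↔
      ∃ m : ℤ, s = t + m := by
    intro s t
    rw [Circle.exp_eq_exp]
    refine exists_congr fun m => ?_
    rw [show 2 * Real.pi * t + m * (2 * Real.pi) = 2 * Real.pi * (t + m) by ring,
      mul_right_inj' Real.two_pi_pos.ne']
  refine ⟨fun t => e.symm (e ⟨z, hz⟩ * Circle.exp (2 * Real.pi * t)), ?_, ?_, ?_, ?_, ?_⟩
  · fun_prop
  · intro s hs t ht h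
    obtain ⟨m, hm⟩ := (hexp s t).1 (mul_left_cancel (e.symm.injective (Subtype.ext h)))
    have h1 : (m : ℝ) < 1 := by linarith [hs.2, ht.1]
    have h2 : (-1 : ℝ) < m := by linarith [hs.1, ht.2]
    have h3 : m = 0 := by
      have h1' : m < 1 := by exact_mod_cast h1
      have h2' : -1 < m := by exact_mod_cast h2
      omega
    simpa [h3] using hm
  · simp
  · simp
  · ext x
    constructor
    · rintro ⟨t, -, rfl⟩
      exact Subtype.coe_prop _
    · intro hx
      set a := Complex.arg (e ⟨x, hx⟩ / e ⟨z, hz⟩ : Circle) with ha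
      refine ⟨Int.fract (a / (2 * Real.pi)), ⟨Int.fract_nonneg _, (Int.fract_lt_one _).le⟩, ?_⟩
      have : Circle.exp (2 * Real.pi * Int.fract (a / (2 * Real.pi))) =
          Circle.exp (2 * Real.pi * (a / (2 * Real.pi))) :=
        (hexp _ _).2 ⟨-⌊a / (2 * Real.pi)⌋, by rw [Int.fract]; push_cast; ring⟩
      simp only [this]
      rw [mul_div_cancel₀ _ Real.two_pi_pos.ne', ha, Circle.exp_arg, mul_div_cancel]
      simp

theorem nonempty_sphere_homeomorph_circle :
    Nonempty (Metric.sphere (0 : EuclideanSpace ℝ (Fin 2)) 1 ≃ₜ Circle) :=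
  ⟨{ toFun x := ⟨Complex.orthonormalBasisOneI.repr.symm x, by
        refine mem_sphere_zero_iff_norm.2 ?_
        rw [LinearIsometryEquiv.norm_map]
        exact mem_sphere_zero_iff_norm.1 x.2⟩
     invFun x := ⟨Complex.orthonormalBasisOneI.repr x, by
        rw [mem_sphere_zero_iff_norm, LinearIsometryEquiv.norm_map, Circle.norm_coe]⟩
     left_inv x := Subtype.ext (LinearIsometryEquiv.apply_symm_apply _ _)
     right_inv x := Subtype.ext (LinearIsometryEquiv.symm_apply_apply _ _)
     continuous_toFun := by fun_prop
     continuous_invFun := by fun_prop }⟩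

theorem IsSimpleClosedCurve.exists_isLoopParam {c : Set (ℝ × ℝ)} (hc : IsSimpleClosedCurve c)
    (ι : ℝ × ℝ ≃ₜ ℂ) {z : ℝ × ℝ} (hz : z ∈ c) : ∃ b, IsLoopParam_s8 b (ι '' c) (ι z) := by
  obtain ⟨e⟩ := hc
  obtain ⟨e'⟩ := nonempty_sphere_homeomorph_circle
  exact _root_.exists_isLoopParam_s8 ((ι.image c).symm.trans (e.trans e')) (mem_image_of_mem ι hz)

/-- The embedding of the plane given by the inverse of a chart is open. -/
theorem isOpenEmbedding_chart_symm (ι : ℝ × ℝ ≃ₜ ℂ) {U : Set (ℝ × ℝ)} (hU : IsOpen U)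
    (h : U ≃ₜ ℝ × ℝ) : IsOpenEmbedding fun p => ι (h.symm p) :=
  ι.isOpenEmbedding.comp (hU.isOpenEmbedding_subtypeVal.comp h.symm.isOpenEmbedding)

theorem mem_chart_iff (ι : ℝ × ℝ ≃ₜ ℂ) {U : Set (ℝ × ℝ)} (h : U ≃ₜ ℝ × ℝ) (β : Set (ℝ × ℝ))
    (p : ℝ × ℝ) : ι (h.symm p) ∈ ι '' β ↔ p ∈ h '' {q : U | (q : ℝ × ℝ) ∈ β} := by
  rw [ι.injective.mem_set_image, Homeomorph.image_eq_preimage_symm]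
  rfl

theorem IsCrossing.exists_isCrossChart {β ρ : Set (ℝ × ℝ)} {w : ℝ × ℝ} (h : IsCrossing β ρ w)
    (ι : ℝ × ℝ ≃ₜ ℂ) : ∃ g, IsCrossChart_s8 (ι '' β) (ι '' ρ) (ι w) g := by
  obtain ⟨U, hU, hw, h, h0, hβ, hρ⟩ := h
  refine ⟨fun p => ι (h.symm p), isOpenEmbedding_chart_symm ι hU h, ?_, fun p => ?_, fun p => ?_⟩
  · rw [Prod.zero_eq_mk, ← h0, h.symm_apply_apply]
  · rw [mem_chart_iff, hβ]
    rfl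
  · rw [mem_chart_iff, hρ]
    rfl

theorem IsTangential.exists_nhds_subset {β ρ : Set (ℝ × ℝ)} {w : ℝ × ℝ} (h : IsTangential β ρ w)
    (ι : ℝ × ℝ ≃ₜ ℂ) {C D : Set ℂ} (hS : IsSides (ι '' β) C D) :
    (∃ U ∈ 𝓝 (ι w), ∀ x ∈ U ∩ ι '' ρ, x ≠ ι w → x ∈ C) ∨
      ∃ U ∈ 𝓝 (ι w), ∀ x ∈ U ∩ ι '' ρ, x ≠ ι w → x ∈ D := by
  obtain ⟨U, hU, hw, h, h0, hβ, hρ, hβρ⟩ := h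
  have h0' : ι w = ι (h.symm 0) := by
    rw [Prod.zero_eq_mk, ← h0, h.symm_apply_apply]
  rw [h0']
  refine hS.exists_nhds_subset_of_tangential (isOpenEmbedding_chart_symm ι hU h)
    (fun p => ?_) (fun p hp => ?_) fun p hp hp0 => ?_
  · rw [mem_chart_iff, hβ]
    rfl
  · rw [mem_chart_iff] at hp
    exact hρ hp
  · rw [mem_chart_iff] at hp
    exact hβρ.subset ⟨hp, hp0⟩

section Arc

variable {f : ℝ → ℝ × ℝ} {s t : ℝ}

theorem isArc_image_Icc (hf : Continuous f) (hst : s < t) (hinj : InjOn f (Icc s t)) :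
    IsArc (f '' Icc s t) := by
  have hc : Continuous hinj.bijOn_image.equiv :=
    (hf.comp continuous_subtype_val).subtype_mk _
  exact ⟨hc.homeoOfEquivCompactToT2.symm.trans (iccHomeoI s t hst)⟩

theorem setOf_isEndpointOf_image_Icc (hf : Continuous f) (hst : s < t)
    (hinj : InjOn f (Icc s t)) : {a | IsEndpointOf a (f '' Icc s t)} = {f s, f t} := by
  have hs : s ∈ Icc s t := left_mem_Icc.2 hst.le
  have ht : t ∈ Icc s t := right_mem_Icc.2 hst.le
  have hdiff : ∀ v ∈ Icc s t, f '' Icc s t \ {f v} = f '' (Icc s t \ {v}) := fun v hv => by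
    rw [hinj.image_sdiff_subset (singleton_subset_iff.2 hv), image_singleton]
  ext a
  constructor
  · rintro ⟨⟨v, hv, rfl⟩, hconn⟩
    by_contra hne
    obtain ⟨θ, hθ, hθf⟩ := isCompact_Icc.exists_continuousOn_leftInverse hf.continuousOn
      (Subset.refl (Icc s t)) fun x hx y hy h => hinj hx hy h
    rw [hdiff v hv] at hconn
    have hpre := (hconn.isPreconnected.image θ (hθ.mono (image_mono sdiff_subset))).ordConnected
    rw [image_image, (show EqOn (fun x => θ (f x)) id (Icc s t \ {v}) from
      fun x hx => hθf x hx.1).image_eq, image_id] at hpre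
    refine (hpre.out ⟨hs, ?_⟩ ⟨ht, ?_⟩ hv).2 rfl
    · rintro rfl
      exact hne (Or.inl rfl)
    · rintro rfl
      exact hne (Or.inr rfl)
  · rintro (rfl | rfl)
    · refine ⟨mem_image_of_mem f hs, ?_⟩
      rw [hdiff s hs, Icc_sdiff_left]
      exact (isConnected_Ioc hst).image f hf.continuousOn
    · refine ⟨mem_image_of_mem f ht, ?_⟩
      rw [hdiff t ht, Icc_sdiff_right]
      exact (isConnected_Ico hst).image f hf.continuousOn

end Arc

/-- An arc of a simple closed curve parametrized by `b` whose interior avoids `ρ` meets `ρ`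
exactly in its endpoints. -/
theorem inter_image_Icc_eq {ρ : Set (ℝ × ℝ)} {f : ℝ → ℝ × ℝ} {s t : ℝ} (hst : s < t)
    (hs : f s ∈ ρ) (ht : f t ∈ ρ) (h : ∀ x ∈ Ioo s t, f x ∉ ρ) :
    ρ ∩ f '' Icc s t = {f s, f t} := by
  ext x
  constructor
  · rintro ⟨hx, y, hy, rfl⟩
    rcases hy.1.eq_or_lt with rfl | h1
    · exact Or.inl rfl
    rcases hy.2.eq_or_lt with rfl | h2
    · exact Or.inr rfl
    · exact absurd hx (h y ⟨h1, h2⟩)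
  · rintro (rfl | rfl)
    · exact ⟨hs, mem_image_of_mem f (left_mem_Icc.2 hst.le)⟩
    · exact ⟨ht, mem_image_of_mem f (right_mem_Icc.2 hst.le)⟩

/-- The arc `b '' Icc s t`, transported to `ℝ × ℝ`. -/
theorem IsLoopParam_s8.exists_arc {β : Set (ℝ × ℝ)} {z : ℝ × ℝ} {ι : ℝ × ℝ ≃ₜ ℂ} {b : ℝ → ℂ}
    (hb : IsLoopParam_s8 b (ι '' β) (ι z)) {ρ : Set (ℝ × ℝ)} {s t : ℝ} (hs : s ∈ Ioo (0 : ℝ) 1)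
    (ht : t ∈ Ioo (0 : ℝ) 1) (hst : s < t) (hsρ : b s ∈ ι '' ρ) (htρ : b t ∈ ι '' ρ)
    (h : ∀ x ∈ Ioo s t, b x ∉ ι '' ρ) :
    ∃ α, IsArc α ∧ α ⊆ β ∧ {a | IsEndpointOf a α} = {ι.symm (b s), ι.symm (b t)} ∧
      ρ ∩ α = {ι.symm (b s), ι.symm (b t)} ∧ z ∉ α := by
  have hf : Continuous fun x => ι.symm (b x) := ι.symm.continuous.comp hb.continuous
  have hmem : ∀ x, ∀ A : Set (ℝ × ℝ), ι.symm (b x) ∈ A ↔ b x ∈ ι '' A := fun x A => by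
    rw [Homeomorph.image_eq_preimage_symm]
    rfl
  have hsub : ∀ x ∈ Icc s t, x ∈ Ioo (0 : ℝ) 1 := fun x hx =>
    ⟨hs.1.trans_le hx.1, hx.2.trans_lt ht.2⟩
  have hinj : InjOn (fun x => ι.symm (b x)) (Icc s t) := fun x hx y hy hxy =>
    hb.eq_of_eq (hsub x hx) (Ioo_subset_Icc_self (hsub y hy)) (ι.symm.injective hxy)
  refine ⟨(fun x => ι.symm (b x)) '' Icc s t, isArc_image_Icc hf hst hinj, ?_,
    setOf_isEndpointOf_image_Icc hf hst hinj, inter_image_Icc_eq hst ((hmem s ρ).2 hsρ)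
    ((hmem t ρ).2 htρ) fun x hx hxρ => h x hx ((hmem x ρ).1 hxρ), ?_⟩
  · rintro _ ⟨x, hx, rfl⟩
    exact (hmem x β).2 (hb.mem_s8 (Ioo_subset_Icc_self (hsub x hx)))
  · rintro ⟨x, hx, hxz⟩
    refine hb.ne_base (hsub x hx) ?_
    rw [← hxz, ι.apply_symm_apply]

/-- If two simple closed curves meet in exactly `ℓ ≥ 3` points, exactly one of which is a
tangential intersection `z` and all the others crossings, then there is a digon of the pair
avoiding `z`. -/
theorem exists_digon_avoiding_tangential_point
    (β ρ : Set (ℝ × ℝ))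
    (hβ : IsSimpleClosedCurve β) (hρ : IsSimpleClosedCurve ρ)
    (ℓ : ℕ) (hℓ : 3 ≤ ℓ) (hcard : (β ∩ ρ).ncard = ℓ)
    (z : ℝ × ℝ) (hz : z ∈ β ∩ ρ)
    (htan : {w ∈ β ∩ ρ | IsTangential β ρ w} = {z})
    (hcr : ∀ w ∈ β ∩ ρ, w ≠ z → IsCrossing β ρ w) :
    ∃ α γ : Set (ℝ × ℝ), IsDigon β ρ α γ ∧ z ∉ α ∪ γ := by
  set ι : ℝ × ℝ ≃ₜ ℂ := Complex.equivRealProdCLM.symm.toHomeomorph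
  obtain ⟨b, hb⟩ := hβ.exists_isLoopParam ι hz.1
  obtain ⟨r, hr⟩ := hρ.exists_isLoopParam ι hz.2
  have hfin : (β ∩ ρ).Finite := Set.finite_of_ncard_ne_zero (by omega)
  obtain ⟨w, hw, hwz⟩ := Set.exists_ne_of_one_lt_ncard (by omega : 1 < (β ∩ ρ).ncard) z
  have hinter : ι '' β ∩ ι '' ρ = ι '' (β ∩ ρ) := (image_inter ι.injective).symm
  have hg : ∀ w ∈ ι '' β ∩ ι '' ρ, w ≠ ι z → ∃ g, IsCrossChart_s8 (ι '' β) (ι '' ρ) w g := by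
    rw [hinter]
    rintro _ ⟨w, hw, rfl⟩ hwz
    exact (hcr w hw fun h => hwz (congrArg ι h)).exists_isCrossChart ι
  have hne : ∃ w ∈ ι '' β ∩ ι '' ρ, w ≠ ι z :=
    ⟨ι w, hinter ▸ mem_image_of_mem ι hw, ι.injective.ne hwz⟩
  obtain ⟨g, hgw⟩ := (hcr w hw hwz).exists_isCrossChart ι
  obtain ⟨τ, hτ, hτw⟩ := hb.exists_eq (mem_image_of_mem ι hw.1) (ι.injective.ne hwz)
  rw [← hτw] at hgw
  obtain ⟨C, D, hS⟩ := hb.exists_isSides hτ hgw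
  have htz : IsTangential β ρ z := (htan.symm.subset rfl : z ∈ {w ∈ β ∩ ρ | _}).2
  obtain ⟨u, v, s, t, hu, hv, hs, ht, huv, hst, hends, hrβ, hbρ⟩ :
      ∃ u v s t, u ∈ Ioo (0 : ℝ) 1 ∧ v ∈ Ioo (0 : ℝ) 1 ∧ s ∈ Ioo (0 : ℝ) 1 ∧ t ∈ Ioo (0 : ℝ) 1 ∧
      u < v ∧ s < t ∧ (b s = r u ∧ b t = r v ∨ b s = r v ∧ b t = r u) ∧
      (∀ x ∈ Ioo u v, r x ∉ ι '' β) ∧ ∀ x ∈ Ioo s t, b x ∉ ι '' ρ := by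
    have hfin' : (ι '' β ∩ ι '' ρ).Finite := hinter ▸ hfin.image ι
    rcases htz.exists_nhds_subset ι hS with h | h
    · exact hS.symm.exists_bigon hb hr h hg hfin' hne
    · exact hS.exists_bigon hb hr h hg hfin' hne
  have hbm : ∀ {x}, x ∈ Ioo (0 : ℝ) 1 → b x ∈ ι '' β := fun hx => hb.mem_s8 (Ioo_subset_Icc_self hx)
  have hrm : ∀ {x}, x ∈ Ioo (0 : ℝ) 1 → r x ∈ ι '' ρ := fun hx => hr.mem_s8 (Ioo_subset_Icc_self hx)
  have hpair : ({ι.symm (b s), ι.symm (b t)} : Set (ℝ × ℝ)) = {ι.symm (r u), ι.symm (r v)} := by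
    rcases hends with ⟨h, h'⟩ | ⟨h, h'⟩ <;> rw [h, h']
    exact pair_comm _ _
  have hends' : b s ∈ ι '' ρ ∧ b t ∈ ι '' ρ ∧ r u ∈ ι '' β ∧ r v ∈ ι '' β := by
    rcases hends with ⟨h, h'⟩ | ⟨h, h'⟩
    · exact ⟨h ▸ hrm hu, h' ▸ hrm hv, h ▸ hbm hs, h' ▸ hbm ht⟩
    · exact ⟨h ▸ hrm hv, h' ▸ hrm hu, h' ▸ hbm ht, h ▸ hbm hs⟩
  obtain ⟨α, hα, hαβ, hαe, hαρ, hαz⟩ := hb.exists_arc hs ht hst hends'.1 hends'.2.1 hbρ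
  obtain ⟨γ, hγ, hγρ, hγe, hγβ, hγz⟩ := hr.exists_arc hu hv huv hends'.2.2.1 hends'.2.2.2 hrβ
  refine ⟨α, γ, ⟨hα, hγ, hαβ, hγρ, ι.symm (r u), ι.symm (r v), fun h => ?_, hpair ▸ hαe, hγe,
    hγβ, hpair ▸ hαρ⟩, fun h => h.elim hαz hγz⟩
  exact huv.ne (hr.eq_of_eq hu (Ioo_subset_Icc_self hv) (ι.symm.injective h))
end

section
/- Let β and ρ be simple closed curves in ℝ² such that β ∩ ρ consists of exactly two points, both of which are crossings of β and ρ. Let b be a point of β that is not in ρ, and let r be a point of ρ that is not in β. Then there exists exactly one digon (α, γ) of (β, ρ) such that α ∪ γ contains neither b nor r. -/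
open Topology Set

/-- A simple closed curve with one point removed is an embedded line. -/
theorem IsSimpleClosedCurve.exists_isEmbedding_range_eq {c : Set (ℝ × ℝ)}
    (hc : IsSimpleClosedCurve c) {b : ℝ × ℝ} (hb : b ∈ c) :
    ∃ g : ℝ → ℝ × ℝ, IsEmbedding g ∧ range g = c \ {b} := by
  obtain ⟨h⟩ := hc
  have : Fact (Module.finrank ℝ (EuclideanSpace ℝ (Fin 2)) = 1 + 1) := ⟨by simp⟩
  let S := stereographic' 1 (h ⟨b, hb⟩)
  let e : EuclideanSpace ℝ (Fin 1) ≃ₜ ℝ :=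
    (EuclideanSpace.equiv (Fin 1) ℝ).toHomeomorph.trans (Homeomorph.funUnique (Fin 1) ℝ)
  have hS : IsOpenEmbedding S.symm :=
    S.symm.isOpenEmbedding (by simp [S])
  have hSr : range S.symm = {h ⟨b, hb⟩}ᶜ := by
    rw [← image_univ, ← stereographic'_target (h ⟨b, hb⟩), S.symm_image_target_eq_source,
      stereographic'_source]
  refine ⟨Subtype.val ∘ h.symm ∘ S.symm ∘ e.symm,
    IsEmbedding.subtypeVal.comp (h.symm.isEmbedding.comp
      (hS.isEmbedding.comp e.symm.isEmbedding)), ?_⟩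
  rw [range_comp, range_comp, e.symm.surjective.range_comp, hSr]
  ext p
  constructor
  · rintro ⟨_, ⟨z, hz, rfl⟩, rfl⟩
    refine ⟨(h.symm z).2, fun hp => hz ?_⟩
    have : h.symm z = ⟨b, hb⟩ := Subtype.ext hp
    simp [← this]
  · rintro ⟨hp, hpb⟩
    exact ⟨⟨p, hp⟩, ⟨h ⟨p, hp⟩, fun hz => hpb (congrArg Subtype.val (h.injective hz)),
      h.symm_apply_apply _⟩, rfl⟩

/-- The endpoints of an embedded compact interval are the images of its two bounds. -/
theorem setOf_isEndpointOf_image_Icc_s10 {g : ℝ → ℝ × ℝ} (hg : IsEmbedding g) {u v : ℝ}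
    (huv : u < v) : {a | IsEndpointOf a (g '' Icc u v)} = {g u, g v} := by
  have hdiff (w : ℝ) : g '' Icc u v \ {g w} = g '' (Icc u v \ {w}) := by
    rw [image_sdiff hg.injective, image_singleton]
  ext a
  constructor
  · rintro ⟨⟨w, hw, rfl⟩, hconn⟩
    rw [hdiff] at hconn
    have hpre := (hg.isInducing.isPreconnected_image.1 hconn.isPreconnected).ordConnected
    by_contra hne
    have hwu : u ≠ w := fun h => hne (by simp [h])
    have hwv : v ≠ w := fun h => hne (by simp [h])
    exact (hpre.out ⟨left_mem_Icc.2 huv.le, hwu⟩ ⟨right_mem_Icc.2 huv.le, hwv⟩ hw).2 rfl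
  · rintro (rfl | rfl)
    · refine ⟨mem_image_of_mem _ (left_mem_Icc.2 huv.le), ?_⟩
      rw [hdiff, Icc_sdiff_left]
      exact (isConnected_Ioc huv).image _ hg.continuous.continuousOn
    · refine ⟨mem_image_of_mem _ (right_mem_Icc.2 huv.le), ?_⟩
      rw [hdiff, Icc_sdiff_right]
      exact (isConnected_Ico huv).image _ hg.continuous.continuousOn

/-- An arc lying on an embedded line is the image of a nondegenerate compact interval. -/
theorem IsArc.exists_eq_image_Icc {A : Set (ℝ × ℝ)} (hA : IsArc A) {g : ℝ → ℝ × ℝ}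
    (hg : IsEmbedding g) (hAg : A ⊆ range g) : ∃ u v, u < v ∧ A = g '' Icc u v := by
  obtain ⟨h⟩ := hA
  have himg : g '' (g ⁻¹' A) = A := image_preimage_eq_of_subset hAg
  have hAcomp : CompactSpace A := h.symm.compactSpace
  have : ConnectedSpace (Icc (0 : ℝ) 1) :=
    isConnected_iff_connectedSpace.1 (isConnected_Icc zero_le_one)
  have hAconn : IsConnected A :=
    isConnected_iff_connectedSpace.2 (h.symm.surjective.connectedSpace h.symm.continuous)
  have hBconn : IsConnected (g ⁻¹' A) := by
    refine ⟨?_, hg.isInducing.isPreconnected_image.1 (himg.symm ▸ hAconn.isPreconnected)⟩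
    exact (himg.symm ▸ hAconn.nonempty).of_image
  have hBcomp : IsCompact (g ⁻¹' A) :=
    hg.isInducing.isCompact_iff.2 (himg.symm ▸ isCompact_iff_compactSpace.2 hAcomp)
  have hB := eq_Icc_of_connected_compact hBconn hBcomp
  refine ⟨_, _, ?_, by rw [← hB, himg]⟩
  by_contra! hle
  have hBs : (g ⁻¹' A).Subsingleton := hB ▸ subsingleton_Icc_of_ge hle
  have hAs : A.Subsingleton := himg ▸ hBs.image g
  have h01 : h.symm ⟨0, by simp⟩ = h.symm ⟨1, by simp⟩ :=
    Subtype.ext (hAs (h.symm _).2 (h.symm _).2)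
  simpa using h.symm.injective h01

/-- Two points of a simple closed curve bound exactly one subarc avoiding a given third point. -/
theorem IsSimpleClosedCurve.existsUnique_isArc {c : Set (ℝ × ℝ)}
    (hc : IsSimpleClosedCurve c) {b x y : ℝ × ℝ} (hb : b ∈ c) (hx : x ∈ c) (hy : y ∈ c)
    (hxy : x ≠ y) (hxb : x ≠ b) (hyb : y ≠ b) :
    ∃! A : Set (ℝ × ℝ), IsArc A ∧ A ⊆ c ∧ {a | IsEndpointOf a A} = {x, y} ∧ b ∉ A := by
  obtain ⟨g, hg, hgr⟩ := hc.exists_isEmbedding_range_eq hb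
  obtain ⟨s, rfl⟩ : x ∈ range g := hgr ▸ ⟨hx, hxb⟩
  obtain ⟨t, rfl⟩ : y ∈ range g := hgr ▸ ⟨hy, hyb⟩
  clear hx hy hxb hyb
  wlog hst : s < t generalizing s t
  · rw [pair_comm]
    exact this t s hxy.symm (lt_of_le_of_ne (not_lt.1 hst) fun h => hxy (h ▸ rfl))
  have hsub : g '' Icc s t ⊆ c \ {b} := hgr ▸ image_subset_range g _
  refine ⟨g '' Icc s t, ⟨?_, hsub.trans sdiff_subset, setOf_isEndpointOf_image_Icc_s10 hg hst,
    fun h => (hsub h).2 rfl⟩, ?_⟩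
  · exact ⟨((hg.homeomorphImage _).symm).trans (iccHomeoI s t hst)⟩
  · rintro A ⟨hA, hAc, hAe, hbA⟩
    obtain ⟨u, v, huv, rfl⟩ := hA.exists_eq_image_Icc hg
      (hgr ▸ fun a ha => ⟨hAc ha, fun h => hbA (h ▸ ha)⟩)
    rw [setOf_isEndpointOf_image_Icc_s10 hg huv, ← image_pair, ← image_pair,
      hg.injective.image_injective.eq_iff, pair_eq_pair_iff] at hAe
    obtain ⟨rfl, rfl⟩ | ⟨rfl, rfl⟩ := hAe
    · rfl
    · exact absurd huv hst.asymm

/-- If two simple closed curves meet in exactly two points, both crossings, then for any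
point `b` of `β` not on `ρ` and any point `r` of `ρ` not on `β`, there is exactly one digon
of the pair avoiding both `b` and `r`. -/
theorem unique_digon_avoiding_two_points_of_two_crossings
    (β ρ : Set (ℝ × ℝ))
    (hβ : IsSimpleClosedCurve β) (hρ : IsSimpleClosedCurve ρ)
    (hcard : (β ∩ ρ).ncard = 2)
    (hcr : ∀ z ∈ β ∩ ρ, IsCrossing β ρ z)
    (b : ℝ × ℝ) (hb : b ∈ β \ ρ)
    (r : ℝ × ℝ) (hr : r ∈ ρ \ β) :
    ∃! d : Set (ℝ × ℝ) × Set (ℝ × ℝ),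
      IsDigon β ρ d.1 d.2 ∧ b ∉ d.1 ∪ d.2 ∧ r ∉ d.1 ∪ d.2 := by
  obtain ⟨x, y, hxy, hI⟩ := ncard_eq_two.1 hcard
  have hx : x ∈ β ∩ ρ := hI ▸ mem_insert x {y}
  have hy : y ∈ β ∩ ρ := hI ▸ mem_insert_of_mem x rfl
  obtain ⟨α, ⟨hα, hαβ, hαe, hbα⟩, hαu⟩ := hβ.existsUnique_isArc hb.1 hx.1 hy.1 hxy
    (fun h => hb.2 (h ▸ hx.2)) (fun h => hb.2 (h ▸ hy.2))
  obtain ⟨γ, ⟨hγ, hγρ, hγe, hrγ⟩, hγu⟩ := hρ.existsUnique_isArc hr.1 hx.2 hy.2 hxy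
    (fun h => hr.2 (h ▸ hx.1)) (fun h => hr.2 (h ▸ hy.1))
  have hends {A : Set (ℝ × ℝ)} (hA : {a | IsEndpointOf a A} = {x, y}) : {x, y} ⊆ A :=
    hA ▸ fun _ ha => ha.1
  refine ⟨(α, γ), ⟨⟨hα, hγ, hαβ, hγρ, x, y, hxy, hαe, hγe, ?_, ?_⟩, ?_, ?_⟩, ?_⟩
  · exact subset_antisymm (hI ▸ inter_subset_inter_right β hγρ)
      (subset_inter (hI ▸ inter_subset_left) (hends hγe))
  · exact subset_antisymm (hI ▸ fun _ ha => ⟨hαβ ha.2, ha.1⟩)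
      (subset_inter (hI ▸ inter_subset_right) (hends hαe))
  · exact fun h => h.elim hbα fun h => hb.2 (hγρ h)
  · exact fun h => h.elim (fun h => hr.2 (hαβ h)) hrγ
  · rintro ⟨α', γ'⟩ ⟨⟨hα', hγ', hαβ', hγρ', x', y', hxy', hαe', hγe', hβγ', -⟩, hb', hr'⟩
    have hpair : ({x', y'} : Set (ℝ × ℝ)) = {x, y} := by
      refine eq_of_subset_of_ncard_le ?_ ?_
      · rw [← hI, ← hβγ']
        exact inter_subset_inter_right β hγρ'
      · rw [ncard_pair hxy, ncard_pair hxy']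
    exact Prod.ext
      (hαu α' ⟨hα', hαβ', hαe'.trans hpair, fun h => hb' (Or.inl h)⟩)
      (hγu γ' ⟨hγ', hγρ', hγe'.trans hpair, fun h => hr' (Or.inr h)⟩)
end
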